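/- There exists N₂ ∈ ℕ such that for every n ≥ N₂ and every σ ∈ S_n with c₁(σ) ≤ 1, one of the eight irreducible representations in EIGHT_n rules for σ: for every irreducible complex character χ of S_n other than the trivial and sign characters, χ̃(σ) ≤ max{F₁(σ), F₂(σ), F₃(σ), F₄(σ), F₅(σ), F₆(σ), F₇(σ), F₈(σ)}. -/

import Mathlib

open CategoryTheory

/-- `c₁(σ)`: the number of fixed points of a permutation. -/
def fixCount {n : ℕ} (σ : Equiv.Perm (Fin n)) : ℕ :=
  (Finset.univ.filter fun x => σ x = x).card

/-- `c_ℓ(σ)`: the number of `ℓ`-cycles of a permutation (for `ℓ ≥ 2`). -/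
def cyc {n : ℕ} (ℓ : ℕ) (σ : Equiv.Perm (Fin n)) : ℕ :=
  Multiset.count ℓ σ.cycleType

/-- The (real-valued) normalized character `χ̃(σ) = χ(σ)/χ(1)` of `V` at `σ`. -/
noncomputable def normChar {n : ℕ} (V : FDRep ℂ (Equiv.Perm (Fin n)))
    (σ : Equiv.Perm (Fin n)) : ℝ :=
  (V.character σ / V.character 1).re

/-- `V` is an irreducible representation whose character is neither the trivial
character nor the sign character. -/
def IsNontrivIrr {n : ℕ} (V : FDRep ℂ (Equiv.Perm (Fin n))) : Prop :=
  Simple V ∧ V.character ≠ (fun _ => 1) ∧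
    V.character ≠ (fun σ => ((Equiv.Perm.sign σ : ℤ) : ℂ))

/-- The maximum of the normalized characters `F₁(σ), …, F₈(σ)` at `σ` of the eight
irreps `EIGHT_n = {(n-1,1), (n-2,2), (n-3,3), (n-3,2,1), (n-4,4),
(n-1,1)ᵗ, (n-2,2)ᵗ, (n-2,1,1)ᵗ}`. -/
noncomputable def maxF (n : ℕ) (σ : Equiv.Perm (Fin n)) : ℝ :=
  let c1 : ℝ := fixCount σ
  let c2 : ℝ := cyc 2 σ
  let c3 : ℝ := cyc 3 σ
  let c4 : ℝ := cyc 4 σ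
  let e : ℝ := ((Equiv.Perm.sign σ : ℤ) : ℝ)
  let N : ℝ := n
  let F1 := (c1 - 1) / (N - 1)
  let F2 := (c1 * (c1 - 3) / 2 + c2) / (N * (N - 3) / 2)
  let F3 := (c1 * (c1 - 1) * (c1 - 5) / 6 + (c1 - 1) * c2 + c3) / (N * (N - 1) * (N - 5) / 6)
  let F4 := (c1 * (c1 - 2) * (c1 - 4) / 3 - c3) / (N * (N - 2) * (N - 4) / 3)
  let F5 := (c1 * (c1 - 1) * (c1 - 2) * (c1 - 7) / 24 + (c1 ^ 2 - 3 * c1 - 1) * c2 / 2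
      + c2 ^ 2 / 2 + (c1 - 1) * c3 + c4) / (N * (N - 1) * (N - 2) * (N - 7) / 24)
  let F6 := e * F1
  let F7 := e * F2
  let F8 := e * ((c1 - 1) * (c1 - 2) / 2 - c2) / ((N - 1) * (N - 2) / 2)
  max (max (max F1 F2) (max F3 F4)) (max (max F5 F6) (max F7 F8))

open Equiv

set_option linter.unusedSectionVars false

/-- A nonzero subspace `W` of a real representation of `Perm β` that is stable under the group,
together with an invariant inner product. -/
structure UnitaryRep (β : Type) [DecidableEq β] [Fintype β] (V : Type*) [AddCommGroup V]
    [Module ℝ V] where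
  ρ : Perm β →* Module.End ℝ V
  B : V →ₗ[ℝ] V →ₗ[ℝ] ℝ
  W : Submodule ℝ V
  symm : ∀ v w, B v w = B w v
  pos : ∀ v, v ≠ 0 → 0 < B v v
  inv : ∀ g v w, B (ρ g v) (ρ g w) = B v w
  stable : ∀ g, ∀ v ∈ W, ρ g v ∈ W
  ne_bot : W ≠ ⊥

/-- The functions on `Perm β` that behave like the matrix coefficient of a vector which is
invariant under `Perm S` for a set `S` of maximal size. -/
structure IsPeel {β : Type} [DecidableEq β] (S : Finset β) (x : Perm β → ℝ) : Prop where
  left : ∀ τ : Perm β, (∀ a ∉ S, τ a = a) → ∀ π, x (τ * π) = x π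
  right : ∀ τ : Perm β, (∀ a ∉ S, τ a = a) → ∀ π, x (π * τ) = x π
  sum : ∀ a ∉ S, ∀ π, x π + ∑ b ∈ S, x (π * swap a b) = 0

section Peel

variable {β : Type} [DecidableEq β] [Fintype β]

/-- The number of points outside `S` that `π` sends into `S`. -/
def exitCount (S : Finset β) (π : Perm β) : ℕ :=
  (Finset.univ.filter fun a => a ∉ S ∧ π a ∈ S).card

/-- The permutations fixing `S` pointwise that agree with `π` wherever `π` stays outside `S`. -/
def extSet (S : Finset β) (π : Perm β) : Finset (Perm β) :=
  Finset.univ.filter fun ψ => (∀ b ∈ S, ψ b = b) ∧ ∀ a ∉ S, π a ∉ S → ψ a = π a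

theorem mem_extSet {S : Finset β} {π ψ : Perm β} :
    ψ ∈ extSet S π ↔ (∀ b ∈ S, ψ b = b) ∧ ∀ a ∉ S, π a ∉ S → ψ a = π a := by
  simp [extSet]

theorem exitCount_eq_entry (S : Finset β) (π : Perm β) :
    (S.filter fun b => π b ∉ S).card = exitCount S π := by
  have h1 : (Finset.univ.filter fun a => π a ∈ S).card = S.card := by
    apply Finset.card_bij (fun a _ => π a)
    · intro a ha; simpa using ha
    · intro a _ b _ h; exact π.injective h
    · intro b hb; exact ⟨π.symm b, by simpa using hb, by simp⟩
  have h2 := Finset.card_filter_add_card_filter_not (s := Finset.univ.filter fun a => π a ∈ S)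
    (fun a => a ∈ S)
  have h3 := Finset.card_filter_add_card_filter_not (s := S) (fun a => π a ∈ S)
  have h4 : ((Finset.univ.filter fun a => π a ∈ S).filter fun a => a ∈ S)
      = S.filter fun a => π a ∈ S := by ext a; simp [and_comm]
  have h5 : ((Finset.univ.filter fun a => π a ∈ S).filter fun a => a ∉ S).card
      = exitCount S π := by
    rw [exitCount]; congr 1; ext a; simp [and_comm]
  rw [h4, h5] at h2
  omega

theorem exitCount_le (S : Finset β) (π : Perm β) : exitCount S π ≤ S.card := by
  rw [← exitCount_eq_entry]; exact Finset.card_filter_le _ _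

theorem extSet_of_exitCount_eq_zero {S : Finset β} {π : Perm β} (h : exitCount S π = 0) :
    ∃ ψ τ : Perm β, extSet S π = {ψ} ∧ (∀ a ∉ S, τ a = a) ∧ π = ψ * τ := by
  have h0 : ∀ a, a ∉ S → π a ∉ S := by
    intro a ha h'
    have : a ∈ (Finset.univ.filter fun a => a ∉ S ∧ π a ∈ S) := by simp [ha, h']
    rw [exitCount, Finset.card_eq_zero] at h
    simp [h] at this
  have h0' : ∀ b, b ∈ S → π b ∈ S := by
    intro b hb
    rw [← exitCount_eq_entry, Finset.card_eq_zero] at h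
    by_contra h'
    have : b ∈ S.filter fun b => π b ∉ S := by simp [hb, h']
    simp [h] at this
  have hiff : ∀ a, (π a ∉ S) ↔ (a ∉ S) := fun a =>
    ⟨fun h1 h2 => h1 (h0' a h2), h0 a⟩
  set ψ : Perm β := Perm.ofSubtype (π.subtypePerm (p := fun a => a ∉ S) hiff) with hψ
  have hψ1 : ∀ b ∈ S, ψ b = b := fun b hb =>
    Perm.ofSubtype_apply_of_not_mem (p := fun a => a ∉ S) _ (by simpa using hb)
  have hψ2 : ∀ a ∉ S, ψ a = π a := fun a ha => by
    rw [hψ, Perm.ofSubtype_apply_of_mem (p := fun a => a ∉ S) _ ha]; rfl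
  refine ⟨ψ, ψ⁻¹ * π, ?_, ?_, by group⟩
  · ext φ
    rw [mem_extSet, Finset.mem_singleton]
    constructor
    · rintro ⟨h1, h2⟩
      ext a
      by_cases ha : a ∈ S
      · rw [h1 a ha, hψ1 a ha]
      · rw [h2 a ha (h0 a ha), hψ2 a ha]
    · rintro rfl
      exact ⟨hψ1, fun a ha _ => hψ2 a ha⟩
  · intro a ha
    rw [Perm.mul_apply, ← hψ2 a ha]; simp

theorem exitCount_mul_swap {S : Finset β} {π : Perm β} {a b : β} (ha : a ∉ S) (ha' : π a ∈ S)
    (hb : b ∈ S) (hb' : π b ∉ S) : exitCount S (π * swap a b) + 1 = exitCount S π := by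
  have hm : a ∈ (Finset.univ.filter fun c => c ∉ S ∧ π c ∈ S) := by simp [ha, ha']
  rw [exitCount, exitCount, ← Finset.card_erase_add_one hm]
  congr 2
  ext c
  rw [Finset.mem_filter, Finset.mem_erase, Finset.mem_filter]
  simp only [Finset.mem_univ, true_and, Perm.mul_apply]
  by_cases hca : c = a
  · subst hca; simp [hb']
  · by_cases hcb : c = b
    · subst hcb; simp [hb]
    · simp [swap_apply_of_ne_of_ne hca hcb, hca]

theorem sum_extSet {S : Finset β} {π : Perm β} {a : β} (ha : a ∉ S) (ha' : π a ∈ S)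
    (f : Perm β → ℝ) :
    ∑ ψ ∈ extSet S π, f ψ
      = ∑ b ∈ S.filter (fun b => π b ∉ S), ∑ ψ ∈ extSet S (π * swap a b), f ψ := by
  rw [← Finset.sum_fiberwise_of_maps_to (t := S.filter (fun b => π b ∉ S))
    (g := fun ψ => π.symm (ψ a))]
  · apply Finset.sum_congr rfl
    intro b hb
    rw [Finset.mem_filter] at hb
    apply Finset.sum_congr _ fun _ _ => rfl
    ext ψ
    rw [Finset.mem_filter, mem_extSet, mem_extSet, Equiv.symm_apply_eq]
    have hab : a ≠ b := fun h => ha (h ▸ hb.1)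
    constructor
    · rintro ⟨⟨h1, h2⟩, h3⟩
      refine ⟨h1, fun c hc hc' => ?_⟩
      by_cases hca : c = a
      · subst hca; simpa using h3
      · have hcb : c ≠ b := fun h => hc (h ▸ hb.1)
        rw [Perm.mul_apply, swap_apply_of_ne_of_ne hca hcb] at hc' ⊢
        exact h2 c hc hc'
    · rintro ⟨h1, h2⟩
      refine ⟨⟨h1, fun c hc hc' => ?_⟩, ?_⟩
      · have hca : c ≠ a := fun h => hc' (h ▸ ha')
        have hcb : c ≠ b := fun h => hc (h ▸ hb.1)
        have := h2 c hc
        rw [Perm.mul_apply, swap_apply_of_ne_of_ne hca hcb] at this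
        exact this hc'
      · have := h2 a ha
        rw [Perm.mul_apply, swap_apply_left] at this
        exact this hb.2
  · intro ψ hψ
    rw [mem_extSet] at hψ
    have h1 : ψ a ∉ S := fun h => ha (by
      have := hψ.1 _ h
      rwa [ψ.injective this] at h)
    rw [Finset.mem_filter]
    refine ⟨?_, by simpa using h1⟩
    by_contra h
    have h2 := hψ.2 _ h (by simpa using h1)
    rw [Equiv.apply_symm_apply] at h2
    have h3 := ψ.injective h2
    rw [h3] at h2
    apply h1
    rw [← Equiv.apply_symm_apply π (ψ a), h3]
    exact ha'

theorem card_extSet (S : Finset β) (π : Perm β) :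
    (extSet S π).card = (exitCount S π).factorial := by
  induction hr : exitCount S π generalizing π with
  | zero =>
    obtain ⟨ψ, _, h, _⟩ := extSet_of_exitCount_eq_zero hr
    simp [h]
  | succ r ih =>
    have hne : (Finset.univ.filter fun a => a ∉ S ∧ π a ∈ S).Nonempty := by
      rw [← Finset.card_pos]; unfold exitCount at hr; omega
    obtain ⟨a, ha⟩ := hne
    simp only [Finset.mem_filter, Finset.mem_univ, true_and] at ha
    have h := sum_extSet ha.1 ha.2 (fun _ => 1)
    have h2 : ∀ b ∈ S.filter (fun b => π b ∉ S),
        ∑ ψ ∈ extSet S (π * swap a b), (1 : ℝ) = r.factorial := by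
      intro b hb
      rw [Finset.mem_filter] at hb
      have := exitCount_mul_swap ha.1 ha.2 hb.1 hb.2
      rw [Finset.sum_const, ih _ (by omega)]; simp
    rw [Finset.sum_congr rfl h2, Finset.sum_const, Finset.sum_const, exitCount_eq_entry, hr] at h
    simp only [nsmul_eq_mul, mul_one] at h
    rw [Nat.factorial_succ]
    exact_mod_cast h

theorem IsPeel.formula {S : Finset β} {x : Perm β → ℝ} (hx : IsPeel S x) (π : Perm β) :
    x π * S.card.factorial
      = (-1) ^ exitCount S π * (S.card - exitCount S π).factorial * ∑ ψ ∈ extSet S π, x ψ := by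
  induction hr : exitCount S π generalizing π with
  | zero =>
    obtain ⟨ψ, τ, h, hτ, rfl⟩ := extSet_of_exitCount_eq_zero hr
    rw [h, Finset.sum_singleton, hx.right τ hτ]; simp [mul_comm]
  | succ r ih =>
    have hne : (Finset.univ.filter fun a => a ∉ S ∧ π a ∈ S).Nonempty := by
      rw [← Finset.card_pos]; unfold exitCount at hr; omega
    obtain ⟨a, ha⟩ := hne
    simp only [Finset.mem_filter, Finset.mem_univ, true_and] at ha
    have hle : r + 1 ≤ S.card := hr ▸ exitCount_le S π
    have h := sum_extSet ha.1 ha.2 x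
    have h1 := hx.sum a ha.1 π
    rw [← Finset.sum_filter_add_sum_filter_not S (fun b => π b ∉ S)] at h1
    have h2 : ∀ b ∈ S.filter (fun b => ¬ π b ∉ S), x (π * swap a b) = x π := by
      intro b hb
      rw [Finset.mem_filter, not_not] at hb
      rw [mul_swap_eq_swap_mul]
      apply hx.left
      intro c hc
      exact swap_apply_of_ne_of_ne (fun h => hc (h ▸ ha.2)) (fun h => hc (h ▸ hb.2))
    rw [Finset.sum_congr rfl h2, Finset.sum_const] at h1
    have h3 := Finset.card_filter_add_card_filter_not (s := S) (fun b => π b ∉ S)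
    rw [exitCount_eq_entry, hr] at h3
    have h4 : ∀ b ∈ S.filter (fun b => π b ∉ S), x (π * swap a b) * S.card.factorial
        = (-1) ^ r * (S.card - r).factorial * ∑ ψ ∈ extSet S (π * swap a b), x ψ := by
      intro b hb
      rw [Finset.mem_filter] at hb
      have := exitCount_mul_swap ha.1 ha.2 hb.1 hb.2
      exact ih _ (by omega)
    have h5 := Finset.sum_congr rfl h4
    rw [← Finset.sum_mul, ← Finset.mul_sum, ← h] at h5
    obtain ⟨q, hq⟩ : ∃ q, S.card = q + (r + 1) := ⟨S.card - (r + 1), by omega⟩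
    have hc : (S.filter fun b => ¬ π b ∉ S).card = q := by omega
    rw [hc, nsmul_eq_mul] at h1
    have e1 : S.card - r = q + 1 := by omega
    have e2 : S.card - (r + 1) = q := by omega
    rw [e1, Nat.factorial_succ] at h5
    rw [e2]
    push_cast at h5
    have hq0 : (q : ℝ) + 1 ≠ 0 := by positivity
    apply mul_left_cancel₀ hq0
    rw [pow_succ]
    linear_combination (S.card.factorial : ℝ) * h1 - h5

theorem IsPeel.abs_le {S : Finset β} {x : Perm β → ℝ} (hx : IsPeel S x) (π : Perm β) {b : ℝ}
    (hb : ∀ ψ ∈ extSet S π, |x ψ| ≤ b) :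
    |x π| ≤ b / (S.card.choose (exitCount S π)) := by
  have h := hx.formula π
  have hle := exitCount_le S π
  have h1 : |∑ ψ ∈ extSet S π, x ψ| ≤ (exitCount S π).factorial * b := by
    refine (Finset.abs_sum_le_sum_abs _ _).trans ((Finset.sum_le_sum hb).trans ?_)
    rw [Finset.sum_const, card_extSet, nsmul_eq_mul]
  have hp : (0 : ℝ) < S.card.choose (exitCount S π) := by
    exact_mod_cast Nat.choose_pos hle
  have h2 := Nat.choose_mul_factorial_mul_factorial hle
  have h3 := congrArg abs h
  rw [abs_mul, abs_mul, abs_mul, abs_pow, abs_neg, abs_one, one_pow, one_mul, Nat.abs_cast,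
    Nat.abs_cast] at h3
  have hf : (0 : ℝ) < (S.card - exitCount S π).factorial := by positivity
  have hf2 : (0 : ℝ) < (exitCount S π).factorial := by positivity
  rw [le_div_iff₀ hp]
  have h2' : (S.card.choose (exitCount S π) : ℝ) * (exitCount S π).factorial
      * (S.card - exitCount S π).factorial = S.card.factorial := by exact_mod_cast h2
  rw [← h2'] at h3
  have h4 : |x π| * (S.card.choose (exitCount S π)) * ((exitCount S π).factorial
      * (S.card - exitCount S π).factorial)
      ≤ b * ((exitCount S π).factorial * (S.card - exitCount S π).factorial) := by
    calc _ = ((S.card - exitCount S π).factorial : ℝ) * |∑ ψ ∈ extSet S π, x ψ| := by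
          rw [← h3]; ring
      _ ≤ (S.card - exitCount S π).factorial * ((exitCount S π).factorial * b) := by gcongr
      _ = _ := by ring
  exact le_of_mul_le_mul_right h4 (by positivity)

end Peel

namespace UnitaryRep

variable {β : Type} [DecidableEq β] [Fintype β] {V : Type*} [AddCommGroup V] [Module ℝ V]

/-- The vectors of `W` fixed by all permutations supported in `S`. -/
def sym (U : UnitaryRep β V) (S : Finset β) : Submodule ℝ V where
  carrier := {v | v ∈ U.W ∧ ∀ τ : Perm β, (∀ a ∉ S, τ a = a) → U.ρ τ v = v}
  add_mem' := fun ha hb => ⟨U.W.add_mem ha.1 hb.1, fun τ hτ => by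
    rw [map_add, ha.2 τ hτ, hb.2 τ hτ]⟩
  zero_mem' := ⟨U.W.zero_mem, fun _ _ => map_zero _⟩
  smul_mem' := fun c _ hv => ⟨U.W.smul_mem c hv.1, fun τ hτ => by rw [map_smul, hv.2 τ hτ]⟩

theorem mem_sym {U : UnitaryRep β V} {S : Finset β} {v : V} :
    v ∈ U.sym S ↔ v ∈ U.W ∧ ∀ τ : Perm β, (∀ a ∉ S, τ a = a) → U.ρ τ v = v := Iff.rfl

/-- The sign representation as a map into endomorphisms. -/
def signTwist (U : UnitaryRep β V) : Perm β →* Module.End ℝ V where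
  toFun g := ((Perm.sign g : ℤ) : ℝ) • U.ρ g
  map_one' := by simp
  map_mul' g h := by
    rw [map_mul, map_mul, smul_mul_smul_comm]; push_cast; rfl

theorem sign_mul_self (g : Perm β) :
    ((Perm.sign g : ℤ) : ℝ) * ((Perm.sign g : ℤ) : ℝ) = 1 := by
  rcases Int.units_eq_one_or (Perm.sign g) with h | h <;> simp [h]

/-- The tensor product with the sign character. -/
def twist (U : UnitaryRep β V) : UnitaryRep β V where
  ρ := U.signTwist
  B := U.B
  W := U.W
  symm := U.symm
  pos := U.pos
  inv g v w := by
    simp only [signTwist, MonoidHom.coe_mk, OneHom.coe_mk, LinearMap.smul_apply, map_smul,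
      smul_eq_mul]
    rw [← mul_assoc, sign_mul_self, one_mul, U.inv]
  stable g v hv := U.W.smul_mem _ (U.stable g v hv)
  ne_bot := U.ne_bot

theorem twist_ρ (U : UnitaryRep β V) (g : Perm β) (v : V) :
    U.twist.ρ g v = ((Perm.sign g : ℤ) : ℝ) • U.ρ g v := rfl

theorem twist_twist (U : UnitaryRep β V) : U.twist.twist = U := by
  have : U.twist.twist.ρ = U.ρ := by
    ext g v
    rw [twist_ρ, twist_ρ, smul_smul, sign_mul_self, one_smul]
  cases U
  simp only [twist] at this ⊢
  congr

/-- The restriction to the permutations fixing `S` pointwise, acting on the vectors fixed by the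
permutations supported in `S`. -/
def restrict (U : UnitaryRep β V) (S : Finset β) (hS : U.sym S ≠ ⊥) :
    UnitaryRep {a // a ∉ S} V where
  ρ := U.ρ.comp Perm.ofSubtype
  B := U.B
  W := U.sym S
  symm := U.symm
  pos := U.pos
  inv g v w := U.inv _ v w
  stable g v hv := by
    refine ⟨U.stable _ v hv.1, fun τ hτ => ?_⟩
    have hcomm : τ * Perm.ofSubtype g = Perm.ofSubtype g * τ := by
      ext a
      by_cases ha : a ∈ S
      · have h1 : τ a ∈ S := by
          by_contra h
          have := τ.injective (hτ _ h)
          rw [this] at h; exact h ha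
        rw [Perm.mul_apply, Perm.mul_apply,
          Perm.ofSubtype_apply_of_not_mem (p := fun a => a ∉ S) _ (by simpa using ha),
          Perm.ofSubtype_apply_of_not_mem (p := fun a => a ∉ S) _ (by simpa using h1)]
      · rw [Perm.mul_apply, Perm.mul_apply, hτ a ha,
          Perm.ofSubtype_apply_of_mem (p := fun a => a ∉ S) _ ha]
        exact hτ _ (g ⟨a, ha⟩).2
    change U.ρ τ (U.ρ (Perm.ofSubtype g) v) = U.ρ (Perm.ofSubtype g) v
    rw [← Module.End.mul_apply, ← map_mul, hcomm, map_mul, Module.End.mul_apply, hv.2 τ hτ]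
  ne_bot := hS

theorem restrict_ρ (U : UnitaryRep β V) (S : Finset β) (hS : U.sym S ≠ ⊥)
    (g : Perm {a // a ∉ S}) (v : V) : (U.restrict S hS).ρ g v = U.ρ (Perm.ofSubtype g) v := rfl

theorem restrict_B (U : UnitaryRep β V) (S : Finset β) (hS : U.sym S ≠ ⊥) :
    (U.restrict S hS).B = U.B := rfl

theorem B_nonneg (U : UnitaryRep β V) (v : V) : 0 ≤ U.B v v := by
  by_cases h : v = 0
  · simp [h]
  · exact (U.pos v h).le

/-- The matrix coefficient of a vector. -/
def coeff (U : UnitaryRep β V) (v : V) (π : Perm β) : ℝ := U.B v (U.ρ π v)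

theorem abs_coeff_le (U : UnitaryRep β V) (v : V) (π : Perm β) : |U.coeff v π| ≤ U.B v v := by
  have h1 := U.B_nonneg (v + U.ρ π v)
  have h2 := U.B_nonneg (v - U.ρ π v)
  simp only [map_add, map_sub, LinearMap.add_apply, LinearMap.sub_apply, U.inv] at h1 h2
  rw [U.symm (U.ρ π v) v] at h1 h2
  rw [abs_le, coeff]
  constructor <;> linarith

theorem exists_unit (U : UnitaryRep β V) {P : Submodule ℝ V} (hP : P ≠ ⊥) :
    ∃ v ∈ P, U.B v v = 1 := by
  obtain ⟨v, hv, h0⟩ := P.ne_bot_iff.1 hP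
  have hp := U.pos v h0
  refine ⟨(Real.sqrt (U.B v v))⁻¹ • v, P.smul_mem _ hv, ?_⟩
  simp only [map_smul, LinearMap.smul_apply, smul_eq_mul]
  have := Real.mul_self_sqrt hp.le
  have h3 : Real.sqrt (U.B v v) ≠ 0 := (Real.sqrt_pos.2 hp).ne'
  field_simp
  nlinarith

theorem sum_swap_mem_sym (U : UnitaryRep β V) {S : Finset β} {v : V} (hv : v ∈ U.sym S) {a : β}
    (ha : a ∉ S) : v + ∑ b ∈ S, U.ρ (swap a b) v ∈ U.sym (insert a S) := by
  have hsum : v + ∑ b ∈ S, U.ρ (swap a b) v = ∑ b ∈ insert a S, U.ρ (swap a b) v := by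
    rw [Finset.sum_insert ha, swap_self]; simp [← Perm.one_def]
  rw [hsum]
  refine ⟨U.W.sum_mem fun b _ => U.stable _ _ hv.1, fun τ hτ => ?_⟩
  rw [map_sum]
  have hmem : ∀ d, τ d ∈ insert a S ↔ d ∈ insert a S := by
    intro d
    constructor
    · intro h
      by_contra h'
      rw [hτ d h'] at h
      exact h' h
    · intro h
      by_contra h'
      have := τ.injective (hτ _ h')
      rw [this] at h'
      exact h' h
  refine Finset.sum_bij (fun d _ => τ d) (fun d hd => (hmem d).2 hd)
    (fun d _ e _ h => τ.injective h) (fun d hd => ⟨τ.symm d, ?_, by simp⟩) (fun d hd => ?_)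
  · rw [← hmem]; simpa using hd
  · have h := hv.2 (swap a (τ d) * τ * swap a d) (fun c hc => ?_)
    · conv_rhs => rw [← h]
      rw [← Module.End.mul_apply, ← Module.End.mul_apply, ← map_mul, ← map_mul]
      congr 2
      simp [mul_assoc]
    · by_cases hca : c = a
      · subst hca; simp
      · have hc' : c ∉ insert a S := by simp [hca, hc]
        have hcd : c ≠ d := fun h => hc' (h ▸ hd)
        have hcd' : c ≠ τ d := fun h => hc' (h ▸ (hmem d).2 hd)
        rw [Perm.mul_apply, Perm.mul_apply, swap_apply_of_ne_of_ne hca hcd, hτ c hc',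
          swap_apply_of_ne_of_ne hca hcd']

theorem coeff_mul_left (U : UnitaryRep β V) {S : Finset β} {v : V} (hv : v ∈ U.sym S)
    {τ : Perm β} (hτ : ∀ a ∉ S, τ a = a) (π : Perm β) : U.coeff v (τ * π) = U.coeff v π := by
  have h := U.inv τ v (U.ρ π v)
  rw [hv.2 τ hτ] at h
  rw [coeff, map_mul, Module.End.mul_apply, h, coeff]

theorem isPeel_coeff (U : UnitaryRep β V) {S : Finset β} {v : V} (hv : v ∈ U.sym S)
    (hS : ∀ a ∉ S, U.sym (insert a S) = ⊥) : IsPeel S (U.coeff v) where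
  left _ hτ π := U.coeff_mul_left hv hτ π
  right τ hτ π := by rw [coeff, map_mul, Module.End.mul_apply, hv.2 τ hτ, coeff]
  sum a ha π := by
    have h := U.sum_swap_mem_sym hv ha
    rw [hS a ha, Submodule.mem_bot] at h
    have h1 := congrArg (fun u => U.B v (U.ρ π u)) h
    simp only [map_add, map_sum, map_zero, ← Module.End.mul_apply, ← map_mul] at h1
    exact h1

/-- The average of a function over a conjugacy class. -/
noncomputable def classAvg (x : Perm β → ℝ) (π : Perm β) : ℝ :=
  (∑ h : Perm β, x (h * π * h⁻¹)) / (Fintype.card (Perm β))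

theorem classAvg_twist (U : UnitaryRep β V) (v : V) (σ : Perm β) :
    classAvg (U.twist.coeff v) σ = ((Perm.sign σ : ℤ) : ℝ) * classAvg (U.coeff v) σ := by
  rw [classAvg, classAvg, ← mul_div_assoc, Finset.mul_sum]
  congr 1
  apply Finset.sum_congr rfl
  intro h _
  have : Perm.sign (h * σ * h⁻¹) = Perm.sign σ := by
    rw [map_mul, map_mul, mul_comm (Perm.sign h), mul_assoc]; simp
  rw [coeff, twist_ρ, this, map_smul]; rfl

theorem classAvg_conj (x : Perm β → ℝ) (κ π : Perm β) :
    classAvg x (κ * π * κ⁻¹) = classAvg x π := by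
  rw [classAvg, classAvg]
  congr 1
  rw [← Equiv.sum_comp (Equiv.mulRight κ) (fun h => x (h * π * h⁻¹))]
  apply Finset.sum_congr rfl
  intro h _
  simp [mul_assoc]

/-- The average of a function over conjugation by the permutations fixing `S` pointwise. -/
noncomputable def fixAvg (S : Finset β) (x : Perm β → ℝ) (π : Perm β) : ℝ :=
  (∑ κ : Perm {a // a ∉ S}, x (Perm.ofSubtype κ * π * (Perm.ofSubtype κ)⁻¹))
    / (Fintype.card (Perm {a // a ∉ S}))

theorem classAvg_fixAvg (S : Finset β) (x : Perm β → ℝ) :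
    classAvg (fixAvg S x) = classAvg x := by
  ext π
  simp only [classAvg, fixAvg]
  rw [← Finset.sum_div, Finset.sum_comm]
  have : ∀ κ : Perm {a // a ∉ S}, ∑ h : Perm β,
      x (Perm.ofSubtype κ * (h * π * h⁻¹) * (Perm.ofSubtype κ)⁻¹)
        = ∑ h : Perm β, x (h * π * h⁻¹) := by
    intro κ
    rw [← Equiv.sum_comp (Equiv.mulLeft (Perm.ofSubtype κ)) (fun h => x (h * π * h⁻¹))]
    apply Finset.sum_congr rfl
    intro h _
    simp [mul_assoc]
  rw [Finset.sum_congr rfl fun κ _ => this κ, Finset.sum_const, nsmul_eq_mul, Finset.card_univ,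
    mul_div_cancel_left₀]
  exact_mod_cast Fintype.card_ne_zero

theorem ofSubtype_apply_mem {S : Finset β} (κ : Perm {a // a ∉ S}) {b : β} (hb : b ∈ S) :
    Perm.ofSubtype κ b = b :=
  Perm.ofSubtype_apply_of_not_mem (p := fun a => a ∉ S) _ (by simpa using hb)

theorem ofSubtype_apply_notMem {S : Finset β} (κ : Perm {a // a ∉ S}) {b : β} (hb : b ∉ S) :
    Perm.ofSubtype κ b ∉ S := by
  rw [Perm.ofSubtype_apply_of_mem (p := fun a => a ∉ S) _ hb]
  exact (κ ⟨b, hb⟩).2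

end UnitaryRep

open UnitaryRep in
theorem IsPeel.fixAvg {β : Type} [DecidableEq β] [Fintype β] {S : Finset β} {x : Perm β → ℝ}
    (hx : IsPeel S x) : IsPeel S (fixAvg S x) := by
  have hfix : ∀ (κ : Perm {a // a ∉ S}) (τ : Perm β), (∀ a ∉ S, τ a = a) →
      ∀ a ∉ S, (Perm.ofSubtype κ * τ * (Perm.ofSubtype κ)⁻¹) a = a := by
    intro κ τ hτ a ha
    rw [Perm.mul_apply, Perm.mul_apply, ← map_inv, hτ _ (ofSubtype_apply_notMem _ ha), map_inv]
    simp
  constructor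
  · intro τ hτ π
    simp only [UnitaryRep.fixAvg]
    congr 1
    apply Finset.sum_congr rfl
    intro κ _
    rw [← hx.left _ (hfix κ τ hτ) (Perm.ofSubtype κ * π * (Perm.ofSubtype κ)⁻¹)]
    congr 1
    group
  · intro τ hτ π
    simp only [UnitaryRep.fixAvg]
    congr 1
    apply Finset.sum_congr rfl
    intro κ _
    rw [← hx.right _ (hfix κ τ hτ) (Perm.ofSubtype κ * π * (Perm.ofSubtype κ)⁻¹)]
    congr 1
    group
  · intro a ha π
    simp only [UnitaryRep.fixAvg]
    rw [← Finset.sum_div, ← add_div, Finset.sum_comm, ← Finset.sum_add_distrib]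
    rw [Finset.sum_eq_zero, zero_div]
    intro κ _
    rw [← hx.sum _ (ofSubtype_apply_notMem κ ha) (Perm.ofSubtype κ * π * (Perm.ofSubtype κ)⁻¹)]
    congr 1
    apply Finset.sum_congr rfl
    intro b hb
    congr 1
    have h1 := Equiv.mul_swap_eq_swap_mul (Perm.ofSubtype κ) a b
    rw [ofSubtype_apply_mem κ hb] at h1
    have h2 : swap (Perm.ofSubtype κ a) b = Perm.ofSubtype κ * swap a b * (Perm.ofSubtype κ)⁻¹ := by
      rw [h1]; group
    rw [h2]
    group

namespace UnitaryRep

variable {β : Type} [DecidableEq β] [Fintype β] {V : Type*} [AddCommGroup V] [Module ℝ V]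

theorem fixAvg_ofSubtype (U : UnitaryRep β V) (S : Finset β) (hS : U.sym S ≠ ⊥) (v : V)
    (ψ : Perm {a // a ∉ S}) :
    fixAvg S (U.coeff v) (Perm.ofSubtype ψ) = classAvg ((U.restrict S hS).coeff v) ψ := by
  rw [fixAvg, classAvg]
  congr 1
  apply Finset.sum_congr rfl
  intro κ _
  rw [coeff, coeff, restrict_ρ, restrict_B]
  simp

theorem exists_ofSubtype_of_mem_extSet {S : Finset β} {π ψ : Perm β} (h : ψ ∈ extSet S π) :
    ∃ φ : Perm {a // a ∉ S}, Perm.ofSubtype φ = ψ := by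
  rw [mem_extSet] at h
  have hiff : ∀ a, (ψ a ∉ S) ↔ (a ∉ S) := by
    intro a
    constructor
    · intro h1 h2; rw [h.1 a h2] at h1; exact h1 h2
    · intro h1 h2
      have := ψ.injective (h.1 _ h2)
      rw [this] at h2
      exact h1 h2
  refine ⟨ψ.subtypePerm (p := fun a => a ∉ S) hiff, ?_⟩
  apply Perm.ofSubtype_subtypePerm
  intro a ha h'
  exact ha (h.1 a h')

end UnitaryRep

theorem avg_smul_of_isPretransitive {G Y : Type*} [Group G] [Fintype G] [MulAction G Y] [Fintype Y]
    [MulAction.IsPretransitive G Y] (F : Y → ℝ) (y₀ : Y) :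
    (∑ h : G, F (h • y₀)) / Fintype.card G = (∑ y, F y) / Fintype.card Y := by
  have h1 : ∀ y : Y, ∑ h : G, F (h • y) = ∑ h : G, F (h • y₀) := by
    intro y
    obtain ⟨g, rfl⟩ := MulAction.exists_smul_eq G y₀ y
    rw [← Equiv.sum_comp (Equiv.mulRight g) (fun h => F (h • y₀))]
    simp [mul_smul]
  have h2 : ∑ y : Y, ∑ h : G, F (h • y) = Fintype.card Y * ∑ h : G, F (h • y₀) := by
    rw [Finset.sum_congr rfl fun y _ => h1 y, Finset.sum_const, nsmul_eq_mul, Finset.card_univ]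
  have h3 : ∑ y : Y, ∑ h : G, F (h • y) = Fintype.card G * ∑ y : Y, F y := by
    rw [Finset.sum_comm]
    have : ∀ h : G, ∑ y : Y, F (h • y) = ∑ y, F y := fun h =>
      Equiv.sum_comp (MulAction.toPerm h) F
    rw [Finset.sum_congr rfl fun h _ => this h, Finset.sum_const, nsmul_eq_mul, Finset.card_univ]
  have hG : (Fintype.card G : ℝ) ≠ 0 := by exact_mod_cast Fintype.card_ne_zero
  have hY : (Fintype.card Y : ℝ) ≠ 0 := by
    have : Nonempty Y := ⟨y₀⟩
    exact_mod_cast Fintype.card_ne_zero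
  rw [div_eq_div_iff hG hY]
  linarith

section

variable {β : Type} [DecidableEq β] [Fintype β]

theorem sum_map_perm (F : Finset β → ℝ) (A₀ : Finset β) :
    (∑ h : Perm β, F (A₀.map h.toEmbedding)) / Fintype.card (Perm β)
      = (∑ A ∈ Finset.univ.powersetCard A₀.card, F A)
        / ((Fintype.card β).choose A₀.card) := by
  have := Set.powersetCard.isPretransitive (α := β) (n := A₀.card)
  have h := avg_smul_of_isPretransitive (G := Perm β) (Y := Set.powersetCard β A₀.card)
    (fun A => F A.1) ⟨A₀, rfl⟩
  have h1 : ∀ h : Perm β, (h • (⟨A₀, rfl⟩ : Set.powersetCard β A₀.card)).1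
      = A₀.map h.toEmbedding := by
    intro h
    ext a
    rw [Set.powersetCard.coe_smul, Finset.mem_smul_finset]
    simp [← Equiv.eq_symm_apply]
  simp only [h1] at h
  rw [h]
  have hs : (∑ y : Set.powersetCard β A₀.card, F y.1)
      = ∑ A ∈ Finset.univ.powersetCard A₀.card, F A := by
    symm
    apply Finset.sum_subtype
    intro A
    simp [Set.powersetCard.mem_iff]
  rw [hs]
  congr 2
  rw [← Nat.card_eq_fintype_card, Set.powersetCard.card, Nat.card_eq_fintype_card]

/-- The number of points of `A` that `σ` sends outside `A`. -/
def leaveCount (σ : Perm β) (A : Finset β) : ℕ := (A.filter fun a => σ a ∉ A).card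

theorem exitCount_conj (S : Finset β) (h σ : Perm β) :
    exitCount S (h⁻¹ * σ * h) = leaveCount σ (Sᶜ.map h.toEmbedding) := by
  rw [exitCount, leaveCount]
  apply Finset.card_bij (fun a _ => h a)
  · intro a ha
    rw [Finset.mem_filter, Perm.mul_apply, Perm.mul_apply] at ha
    simp only [Finset.mem_filter, Finset.mem_map_equiv, Finset.mem_compl, not_not,
      Equiv.symm_apply_apply]
    exact ha.2
  · intro a _ b _ h'; exact h.injective h'
  · intro b hb
    simp only [Finset.mem_filter, Finset.mem_map_equiv, Finset.mem_compl, not_not] at hb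
    refine ⟨h.symm b, ?_, by simp⟩
    rw [Finset.mem_filter, Perm.mul_apply, Perm.mul_apply, Equiv.apply_symm_apply]
    exact ⟨Finset.mem_univ _, hb⟩

theorem UnitaryRep.classAvg_eq_inv (x : Perm β → ℝ) (σ : Perm β) :
    classAvg x σ = (∑ h : Perm β, x (h⁻¹ * σ * h)) / Fintype.card (Perm β) := by
  rw [classAvg, ← Equiv.sum_comp (Equiv.inv (Perm β))]
  simp

/-- The average of `1 / (m choose r)` over all subsets of size `k`, where `r` is the number of
points leaving the subset. -/
noncomputable def peelWeight (k : ℕ) (σ : Perm β) : ℝ :=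
  (∑ A ∈ Finset.univ.powersetCard k,
    1 / (((Fintype.card β - k).choose (leaveCount σ A) : ℕ) : ℝ)) / ((Fintype.card β).choose k)

theorem IsPeel.abs_classAvg_le {S : Finset β} {x : Perm β → ℝ} (hx : IsPeel S x) (σ : Perm β)
    {b : ℝ} (hb : ∀ h : Perm β, ∀ ψ ∈ extSet S (h⁻¹ * σ * h), |x ψ| ≤ b) :
    |UnitaryRep.classAvg x σ| ≤ b * peelWeight Sᶜ.card σ := by
  have hS : S.card = Fintype.card β - Sᶜ.card := by
    have := Finset.card_add_card_compl S; omega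
  rw [UnitaryRep.classAvg_eq_inv, abs_div, Nat.abs_cast, peelWeight, ← sum_map_perm (fun A =>
    1 / (((Fintype.card β - Sᶜ.card).choose (leaveCount σ A) : ℕ) : ℝ)) Sᶜ, ← mul_div_assoc,
    Finset.mul_sum]
  apply div_le_div_of_nonneg_right _ (Nat.cast_nonneg _)
  refine (Finset.abs_sum_le_sum_abs _ _).trans (Finset.sum_le_sum fun h _ => ?_)
  rw [← exitCount_conj, ← hS, mul_one_div]
  exact hx.abs_le _ (hb h)

end

namespace UnitaryRep

variable {β : Type} [DecidableEq β] [Fintype β] {V : Type*} [AddCommGroup V] [Module ℝ V]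

theorem sym_of_card_le_one (U : UnitaryRep β V) {S : Finset β} (hS : S.card ≤ 1) :
    U.sym S = U.W := by
  ext v
  rw [mem_sym]
  refine ⟨fun h => h.1, fun h => ⟨h, fun τ hτ => ?_⟩⟩
  have : τ = 1 := by
    ext a
    by_cases ha : a ∈ S
    · by_contra h
      have h1 : τ a ∉ S := fun h' => h (by simpa using Finset.card_le_one.1 hS _ h' _ ha)
      exact h (by simpa using τ.injective (hτ _ h1))
    · simpa using hτ a ha
  rw [this]; simp

theorem exists_max_sym (U : UnitaryRep β V) :
    ∃ S, U.sym S ≠ ⊥ ∧ ∀ S' : Finset β, S.card < S'.card → U.sym S' = ⊥ := by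
  classical
  obtain ⟨S, hS, hmax⟩ := Finset.exists_max_image
    (Finset.univ.filter fun S => U.sym S ≠ ⊥) Finset.card
    ⟨∅, by simpa [U.sym_of_card_le_one (S := ∅) (by simp)] using U.ne_bot⟩
  refine ⟨S, by simpa using hS, fun S' hS' => ?_⟩
  by_contra h
  have := hmax S' (by simpa using h)
  omega

theorem isPeel_of_max (U : UnitaryRep β V) {S : Finset β} {v : V} (hv : v ∈ U.sym S)
    (hmax : ∀ S' : Finset β, S.card < S'.card → U.sym S' = ⊥) : IsPeel S (U.coeff v) :=
  U.isPeel_coeff hv fun a ha => hmax _ (by rw [Finset.card_insert_of_notMem ha]; omega)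

theorem exists_ofSubtype_of_map {S : Finset β} {T : Finset {a // a ∉ S}} {τ : Perm β}
    (hτ : ∀ a ∉ T.map (Function.Embedding.subtype _), τ a = a) :
    ∃ φ : Perm {a // a ∉ S}, Perm.ofSubtype φ = τ ∧ ∀ a ∉ T, φ a = a := by
  have h1 : ∀ b ∈ S, τ b = b := fun b hb => hτ b (by simp [hb])
  have hiff : ∀ a, (τ a ∉ S) ↔ (a ∉ S) := by
    intro a
    constructor
    · intro h h2; rw [h1 a h2] at h; exact h h2
    · intro h h2
      have := τ.injective (h1 _ h2)
      rw [this] at h2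
      exact h h2
  refine ⟨τ.subtypePerm (p := fun a => a ∉ S) hiff, ?_, fun a ha => ?_⟩
  · apply Perm.ofSubtype_subtypePerm
    intro a ha h'
    exact ha (h1 a h')
  · apply Subtype.ext
    exact hτ a (by simpa using fun _ => ha)

theorem restrict_sym_le (U : UnitaryRep β V) {S : Finset β} (hS : U.sym S ≠ ⊥)
    (T : Finset {a // a ∉ S}) :
    (U.restrict S hS).sym T ≤ U.sym (T.map (Function.Embedding.subtype _)) := by
  intro v hv
  refine ⟨hv.1.1, fun τ hτ => ?_⟩
  obtain ⟨φ, rfl, hφ⟩ := exists_ofSubtype_of_map hτ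
  exact hv.2 φ hφ

theorem restrict_twist_sym_le (U : UnitaryRep β V) {S : Finset β} (hS : U.sym S ≠ ⊥)
    (T : Finset {a // a ∉ S}) :
    (U.restrict S hS).twist.sym T ≤ U.twist.sym (T.map (Function.Embedding.subtype _)) := by
  intro v hv
  refine ⟨hv.1.1, fun τ hτ => ?_⟩
  obtain ⟨φ, rfl, hφ⟩ := exists_ofSubtype_of_map hτ
  have := hv.2 φ hφ
  rw [twist_ρ, restrict_ρ] at this
  rw [twist_ρ, Perm.sign_ofSubtype]
  exact this

theorem restrict_sym_eq_bot (U : UnitaryRep β V) {S : Finset β} (hS : U.sym S ≠ ⊥) {a : ℕ}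
    (h : ∀ T : Finset β, a < T.card → U.sym T = ⊥) (T : Finset {a // a ∉ S}) (hT : a < T.card) :
    (U.restrict S hS).sym T = ⊥ := by
  rw [eq_bot_iff, ← h (T.map (Function.Embedding.subtype _)) (by simpa using hT)]
  exact U.restrict_sym_le hS T

theorem restrict_twist_sym_eq_bot (U : UnitaryRep β V) {S : Finset β} (hS : U.sym S ≠ ⊥) {a : ℕ}
    (h : ∀ T : Finset β, a < T.card → U.twist.sym T = ⊥) (T : Finset {a // a ∉ S})
    (hT : a < T.card) : (U.restrict S hS).twist.sym T = ⊥ := by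
  rw [eq_bot_iff, ← h (T.map (Function.Embedding.subtype _)) (by simpa using hT)]
  exact U.restrict_twist_sym_le hS T

/-- The representation-theoretic form of the Erdős–Szekeres bound: a partition of `n` with parts
at most `a` has at least `n / a` parts. -/
theorem exists_twist_sym_ne_bot {β : Type} [DecidableEq β] [Fintype β] (U : UnitaryRep β V)
    {a : ℕ} (h : ∀ S : Finset β, a < S.card → U.sym S = ⊥) :
    ∃ T : Finset β, U.twist.sym T ≠ ⊥ ∧ Fintype.card β ≤ a * T.card := by
  induction hn : Fintype.card β using Nat.strong_induction_on generalizing β with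
  | _ n ih =>
  by_cases hβ : n = 0
  · refine ⟨∅, ?_, by omega⟩
    rw [sym_of_card_le_one _ (by simp)]
    exact U.ne_bot
  obtain ⟨S, hS, hmax⟩ := U.exists_max_sym
  have hSa : S.card ≤ a := by
    by_contra hc
    exact hS (h S (by omega))
  have hS1 : S.Nonempty := by
    by_contra hc
    rw [Finset.not_nonempty_iff_eq_empty] at hc
    subst hc
    have : Nonempty β := Fintype.card_pos_iff.1 (by omega)
    have := hmax {Classical.arbitrary β} (by simp)
    rw [sym_of_card_le_one _ (by simp)] at this
    exact U.ne_bot this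
  obtain ⟨x, hx⟩ := hS1
  have hcard : Fintype.card {a // a ∉ S} = n - S.card := by
    rw [← hn, Fintype.card_subtype_compl]; simp
  have hSpos : 0 < S.card := Finset.card_pos.2 ⟨x, hx⟩
  have hSle : S.card ≤ n := hn ▸ Finset.card_le_univ S
  obtain ⟨T', hT', hle⟩ := ih _ (by omega) (U.restrict S hS)
    (U.restrict_sym_eq_bot hS h) hcard
  obtain ⟨w, hw, hw0⟩ := (Submodule.ne_bot_iff _).1 hT'
  have hwS : w ∈ U.sym S := hw.1
  set T := T'.map (Function.Embedding.subtype _) with hT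
  have hwT : w ∈ U.twist.sym T := U.restrict_twist_sym_le hS T' hw
  have hTS : ∀ y ∈ T, y ∉ S := by
    intro y hy
    simp only [hT, Finset.mem_map] at hy
    obtain ⟨y', _, rfl⟩ := hy
    exact y'.2
  have hxT : x ∉ T := fun h' => hTS x h' hx
  refine ⟨insert x T, ?_, ?_⟩
  · have hu := U.twist.sum_swap_mem_sym hwT hxT
    rw [Submodule.ne_bot_iff]
    refine ⟨_, hu, fun h0 => ?_⟩
    have h1 := congrArg (U.B w) h0
    have hpeel := U.isPeel_of_max hwS hmax
    have h2 : ∀ y ∈ T, U.B w (U.twist.ρ (swap x y) w) = U.B w w / S.card := by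
      intro y hy
      have hyS := hTS y hy
      have hxy : x ≠ y := fun h' => hyS (h' ▸ hx)
      have h3 := hpeel.sum y hyS 1
      have h4 : ∀ b ∈ S, U.coeff w (1 * swap y b) = U.B w (U.ρ (swap x y) w) := by
        intro b hb
        have hconj : swap x b * (1 * swap y b) * swap x b = swap x y := by
          by_cases hbx : b = x
          · subst hbx; simp [swap_comm, ← Perm.one_def]
          · rw [one_mul]
            have := Equiv.swap_mul_swap_mul_swap (x := y) (y := b) (z := x)
              (fun h' => hyS (h' ▸ hb)) hxy.symm
            rw [swap_comm y b] at *
            rw [swap_comm b x] at this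
            exact this
        have hsup : ∀ a ∉ S, swap x b a = a := fun a ha =>
          swap_apply_of_ne_of_ne (fun h' => ha (h' ▸ hx)) (fun h' => ha (h' ▸ hb))
        rw [← hpeel.left _ hsup, ← hpeel.right _ hsup, hconj, coeff]
      rw [Finset.sum_congr rfl h4, Finset.sum_const, nsmul_eq_mul, coeff, map_one,
        Module.End.one_apply] at h3
      rw [twist_ρ, Perm.sign_swap hxy, map_smul, smul_eq_mul, eq_div_iff (by positivity)]
      push_cast
      linarith
    rw [map_add, map_sum, Finset.sum_congr rfl h2, Finset.sum_const, map_zero, nsmul_eq_mul] at h1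
    have h5 := U.pos w hw0
    have : 0 ≤ (T.card : ℝ) * (U.B w w / S.card) := by positivity
    linarith
  · rw [Finset.card_insert_of_notMem hxT, hT, Finset.card_map, mul_add, mul_one]
    omega

end UnitaryRep

section Transfer

variable {R : Type*} [CommRing R]

/-- The partition function of the two-state model with transition weights `w` along the cycles
of `σ`. -/
def transferSum {β : Type} [DecidableEq β] [Fintype β] (w : Bool → Bool → R) (σ : Perm β) : R :=
  ∑ A : β → Bool, ∏ x, w (A x) (A (σ x))

variable {β γ : Type} [DecidableEq β] [Fintype β] [DecidableEq γ] [Fintype γ]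

theorem transferSum_permCongr (w : Bool → Bool → R) (e : β ≃ γ) (σ : Perm β) :
    transferSum w (e.permCongr σ) = transferSum w σ := by
  rw [transferSum, transferSum, ← Equiv.sum_comp (e.arrowCongr (Equiv.refl Bool))]
  apply Finset.sum_congr rfl
  intro A _
  rw [← Equiv.prod_comp e]
  simp

theorem transferSum_sumCongr (w : Bool → Bool → R) (σ : Perm β) (τ : Perm γ) :
    transferSum w (Equiv.sumCongr σ τ) = transferSum w σ * transferSum w τ := by
  rw [transferSum, ← Equiv.sum_comp (Equiv.sumArrowEquivProdArrow β γ Bool).symm,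
    Fintype.sum_prod_type, transferSum, transferSum, Finset.sum_mul_sum]
  apply Finset.sum_congr rfl
  intro A _
  apply Finset.sum_congr rfl
  intro B _
  rw [Fintype.prod_sum_type]
  simp [Equiv.sumArrowEquivProdArrow]

theorem transferSum_eq_of_cycleType_eq (w : Bool → Bool → R) {σ τ : Perm β}
    (h : σ.cycleType = τ.cycleType) : transferSum w σ = transferSum w τ := by
  obtain ⟨g, hg⟩ := isConj_iff.1 (Perm.isConj_of_cycleType_eq h)
  rw [← hg, ← transferSum_permCongr w g]
  congr 1

theorem transferSum_one (w : Bool → Bool → R) :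
    transferSum w (1 : Perm β) = (w true true + w false false) ^ Fintype.card β := by
  have := (Finset.prod_univ_sum (fun _ : β => (Finset.univ : Finset Bool))
    (fun _ b => w b b)).symm
  rw [Fintype.piFinset_univ] at this
  simp only [Fintype.sum_bool, Finset.prod_const, Finset.card_univ] at this
  rw [← this]
  rfl

theorem sum_path_eq (w f : Bool → Bool → R) (k : ℕ) :
    ∑ A : Fin (k + 1) → Bool, (∏ i : Fin k, w (A i.castSucc) (A i.succ)) * f (A (Fin.last k)) (A 0)
      = ∑ a, ∑ b, ((Matrix.of w) ^ k) a b * f b a := by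
  induction k generalizing f with
  | zero =>
    rw [← (Equiv.funUnique (Fin 1) Bool).symm.sum_comp]
    simp [Matrix.one_apply]
  | succ k ih =>
    rw [← (Fin.snocEquiv (fun _ : Fin (k + 2) => Bool)).sum_comp, Fintype.sum_prod_type,
      Finset.sum_comm]
    have h := ih (fun b a => ∑ c, w b c * f c a)
    have h2 : ∀ A : Fin (k + 1) → Bool, ∑ c : Bool,
        (∏ i : Fin (k + 1), w ((Fin.snocEquiv (fun _ : Fin (k + 2) => Bool)) (c, A) i.castSucc)
          ((Fin.snocEquiv (fun _ : Fin (k + 2) => Bool)) (c, A) i.succ)) *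
          f ((Fin.snocEquiv (fun _ : Fin (k + 2) => Bool)) (c, A) (Fin.last (k + 1)))
            ((Fin.snocEquiv (fun _ : Fin (k + 2) => Bool)) (c, A) 0)
        = (∏ i : Fin k, w (A i.castSucc) (A i.succ)) *
          ∑ c, w (A (Fin.last k)) c * f c (A 0) := by
      intro A
      rw [Finset.mul_sum]
      apply Finset.sum_congr rfl
      intro c _
      have e0 : (Fin.snocEquiv (fun _ : Fin (k + 2) => Bool)) (c, A) 0 = A 0 := by
        change Fin.snoc (α := fun _ => Bool) A c (Fin.castSucc 0) = _
        rw [Fin.snoc_castSucc]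
      have e1 : (Fin.snocEquiv (fun _ : Fin (k + 2) => Bool)) (c, A) (Fin.last (k + 1)) = c := by
        change Fin.snoc (α := fun _ => Bool) A c (Fin.last _) = _
        rw [Fin.snoc_last]
      have e2 : ∀ i : Fin (k + 1),
          (Fin.snocEquiv (fun _ : Fin (k + 2) => Bool)) (c, A) i.castSucc = A i := by
        intro i
        change Fin.snoc (α := fun _ => Bool) A c (Fin.castSucc i) = _
        rw [Fin.snoc_castSucc]
      rw [e0, e1, Fin.prod_univ_castSucc]
      simp only [Fin.succ_last, e1, e2, Fin.succ_castSucc]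
      ring
    rw [Finset.sum_congr rfl fun A _ => h2 A, h]
    simp only [pow_succ, Matrix.mul_apply, Matrix.of_apply, Fintype.sum_bool]
    ring

theorem transferSum_finRotate (w : Bool → Bool → R) (k : ℕ) :
    transferSum w (finRotate (k + 1)) = ((Matrix.of w) ^ (k + 1)).trace := by
  rw [transferSum, pow_succ]
  have h := sum_path_eq w w k
  have h2 : ∀ A : Fin (k + 1) → Bool, ∏ x, w (A x) (A (finRotate (k + 1) x))
      = (∏ i : Fin k, w (A i.castSucc) (A i.succ)) * w (A (Fin.last k)) (A 0) := by
    intro A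
    rw [Fin.prod_univ_castSucc]
    simp [finRotate_apply, Fin.coeSucc_eq_succ]
  rw [Finset.sum_congr rfl fun A _ => h2 A, h, Matrix.trace]
  simp [Matrix.mul_apply]

theorem trace_pow_eq (w : Bool → Bool → R) {a b : R} (h1 : a + b = w true true + w false false)
    (h2 : a * b = w true true * w false false - w true false * w false true) (k : ℕ) :
    ((Matrix.of w) ^ k).trace = a ^ k + b ^ k := by
  have hM : (Matrix.of w) ^ 2 = (a + b) • Matrix.of w - (a * b) • 1 := by
    ext i j
    rw [h1, h2]
    cases i <;> cases j <;>
      simp [pow_two, Matrix.mul_apply] <;> ring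
  induction k using Nat.twoStepInduction with
  | zero => simp [Matrix.trace_one, one_add_one_eq_two]
  | one => simp [Matrix.trace, h1]
  | more k ih1 ih2 =>
    rw [pow_add, hM, mul_sub, Matrix.trace_sub, mul_smul_comm, mul_smul_comm, Matrix.trace_smul,
      Matrix.trace_smul, mul_one, ← pow_succ, ih1, ih2, smul_eq_mul, smul_eq_mul]
    ring

theorem cycleType_permCongr (e : β ≃ γ) (σ : Perm β) :
    (e.permCongr σ).cycleType = σ.cycleType := by
  have : e.permCongr σ = σ.extendDomain
      (e.trans (Equiv.subtypeUnivEquiv (p := fun _ : γ => True) fun _ => trivial).symm) := by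
    ext x
    rw [Perm.extendDomain_apply_subtype _ _ trivial]
    rfl
  rw [this, Perm.cycleType_extendDomain]

theorem cycleType_sumCongr (σ : Perm β) (τ : Perm γ) :
    Perm.cycleType (Equiv.sumCongr σ τ) = σ.cycleType + τ.cycleType := by
  have h1 : Perm.sumCongr σ 1 = σ.extendDomain
      (Equiv.ofInjective (Sum.inl : β → β ⊕ γ) Sum.inl_injective) := by
    ext x
    rcases x with x | x
    · have := Perm.extendDomain_apply_image σ
        (Equiv.ofInjective (Sum.inl : β → β ⊕ γ) Sum.inl_injective) x
      simp only [Equiv.ofInjective_apply] at this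
      rw [this]; rfl
    · rw [Perm.extendDomain_apply_not_subtype]
      · rfl
      · simp
  have h2 : Perm.sumCongr 1 τ = τ.extendDomain
      (Equiv.ofInjective (Sum.inr : γ → β ⊕ γ) Sum.inr_injective) := by
    ext x
    rcases x with x | x
    · rw [Perm.extendDomain_apply_not_subtype]
      · rfl
      · simp
    · have := Perm.extendDomain_apply_image τ
        (Equiv.ofInjective (Sum.inr : γ → β ⊕ γ) Sum.inr_injective) x
      simp only [Equiv.ofInjective_apply] at this
      rw [this]; rfl
  have h3 : Equiv.sumCongr σ τ = Perm.sumCongr σ 1 * Perm.sumCongr 1 τ := by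
    rw [Perm.sumCongr_mul]; simp
  have h4 : Perm.Disjoint (Perm.sumCongr σ (1 : Perm γ)) (Perm.sumCongr (1 : Perm β) τ) := by
    rintro (x | x)
    · right; rfl
    · left; rfl
  rw [h3, h4.cycleType_mul, h1, h2, Perm.cycleType_extendDomain, Perm.cycleType_extendDomain]

theorem transferSum_eq (w : Bool → Bool → R) {a b : R}
    (h1 : a + b = w true true + w false false)
    (h2 : a * b = w true true * w false false - w true false * w false true) (σ : Perm β) :
    transferSum w σ = (a + b) ^ (Fintype.card β - σ.cycleType.sum)
      * (σ.cycleType.map fun l => a ^ l + b ^ l).prod := by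
  induction hm : σ.cycleType using Multiset.induction generalizing β with
  | empty =>
    rw [Perm.cycleType_eq_zero] at hm
    subst hm
    rw [transferSum_one, h1]
    simp
  | cons l m ih =>
    have hl : 2 ≤ l := Perm.two_le_of_mem_cycleType (σ := σ) (by simp [hm])
    have hsum := Perm.sum_cycleType_le σ
    rw [hm, Multiset.sum_cons] at hsum
    obtain ⟨τ, hτ⟩ := (Perm.exists_with_cycleType_iff (α := Fin (Fintype.card β - l)) (m := m)).2
      ⟨by simp; omega, fun c hc => Perm.two_le_of_mem_cycleType (σ := σ) (by simp [hm, hc])⟩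
    have hcard : Fintype.card (Fin l ⊕ Fin (Fintype.card β - l)) = Fintype.card β := by
      simp; omega
    let e := Fintype.equivOfCardEq hcard
    have h3 : σ.cycleType
        = (e.permCongr (Equiv.sumCongr (finRotate l) τ)).cycleType := by
      rw [cycleType_permCongr, cycleType_sumCongr, cycleType_finRotate_of_le hl, hτ, hm]; rfl
    rw [transferSum_eq_of_cycleType_eq w h3, transferSum_permCongr, transferSum_sumCongr,
      ih τ hτ]
    obtain ⟨k, rfl⟩ : ∃ k, l = k + 1 := ⟨l - 1, by omega⟩
    rw [transferSum_finRotate, trace_pow_eq w h1 h2, Fintype.card_fin, Multiset.map_cons,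
      Multiset.prod_cons, Multiset.sum_cons, Nat.sub_sub]
    ring

theorem sum_finset_eq_transferSum (w : Bool → Bool → R) (σ : Perm β) :
    ∑ A : Finset β, ∏ x, w (decide (x ∈ A)) (decide (σ x ∈ A)) = transferSum w σ := by
  have hb : Function.Bijective (fun (A : Finset β) (x : β) => decide (x ∈ A)) := by
    constructor
    · intro A B h
      ext x
      simpa using congrFun h x
    · intro f
      refine ⟨Finset.univ.filter fun x => f x = true, ?_⟩
      ext x
      simp
  rw [transferSum, ← hb.sum_comp]

end Transfer

section Weights

variable {β : Type} [DecidableEq β] [Fintype β]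

theorem exitCount_eq_leaveCount_compl (S : Finset β) (σ : Perm β) :
    exitCount S σ = leaveCount σ Sᶜ := by
  have h := exitCount_conj S 1 σ
  have e : Sᶜ.map (Equiv.toEmbedding (1 : Perm β)) = Sᶜ := by
    ext x; simp only [Finset.mem_map_equiv]; rfl
  rw [e] at h
  simpa using h

theorem leaveCount_compl (σ : Perm β) (A : Finset β) : leaveCount σ Aᶜ = leaveCount σ A := by
  rw [← exitCount_eq_leaveCount_compl, ← exitCount_eq_entry, leaveCount]

theorem leaveCount_le (σ : Perm β) (A : Finset β) : leaveCount σ A ≤ A.card :=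
  Finset.card_filter_le _ _

theorem peelWeight_eq {k m : ℕ} (h : k + m = Fintype.card β) (σ : Perm β) :
    peelWeight k σ = (∑ B ∈ Finset.univ.powersetCard m,
      1 / ((m.choose (leaveCount σ B) : ℕ) : ℝ)) / ((Fintype.card β).choose m) := by
  have h1 : Fintype.card β - k = m := by omega
  rw [peelWeight, h1, ← Nat.choose_symm_of_eq_add h.symm]
  congr 1
  refine Finset.sum_nbij' (fun A => Aᶜ) (fun A => Aᶜ) ?_ ?_ ?_ ?_ ?_
  · intro A hA
    rw [Finset.mem_powersetCard] at *
    refine ⟨Finset.subset_univ _, ?_⟩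
    rw [Finset.card_compl]; omega
  · intro A hA
    rw [Finset.mem_powersetCard] at *
    refine ⟨Finset.subset_univ _, ?_⟩
    rw [Finset.card_compl]; omega
  · intro A _; simp
  · intro A _; simp
  · intro A _; rw [leaveCount_compl]

/-- The transition weights counting the size of a set and the number of points leaving it. -/
def leaveWeight {R : Type*} [CommRing R] (y z : R) : Bool → Bool → R
  | true, true => y
  | true, false => y * z
  | false, _ => 1

/-- The transition weights counting the size of a set and the number of points staying in it. -/
def stayWeight {R : Type*} [CommRing R] (y z : R) : Bool → Bool → R
  | true, true => y * z
  | true, false => y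
  | false, _ => 1

theorem prod_leaveWeight {R : Type*} [CommRing R] (y z : R) (σ : Perm β) (A : Finset β) :
    ∏ x, leaveWeight y z (decide (x ∈ A)) (decide (σ x ∈ A))
      = y ^ A.card * z ^ leaveCount σ A := by
  have h : ∀ x, leaveWeight y z (decide (x ∈ A)) (decide (σ x ∈ A))
      = (if x ∈ A then y else 1) * (if x ∈ A ∧ σ x ∉ A then z else 1) := by
    intro x
    by_cases h1 : x ∈ A <;> by_cases h2 : σ x ∈ A <;> simp [h1, h2, leaveWeight]
  rw [Finset.prod_congr rfl fun x _ => h x, Finset.prod_mul_distrib, Finset.prod_ite,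
    Finset.prod_ite]
  simp only [Finset.prod_const_one, mul_one, Finset.prod_const]
  congr 2
  · simp
  · rw [leaveCount]; congr 1; ext x; simp

theorem prod_stayWeight {R : Type*} [CommRing R] (y z : R) (σ : Perm β) (A : Finset β) :
    ∏ x, stayWeight y z (decide (x ∈ A)) (decide (σ x ∈ A))
      = y ^ A.card * z ^ (A.card - leaveCount σ A) := by
  have h : ∀ x, stayWeight y z (decide (x ∈ A)) (decide (σ x ∈ A))
      = (if x ∈ A then y else 1) * (if x ∈ A ∧ σ x ∈ A then z else 1) := by
    intro x
    by_cases h1 : x ∈ A <;> by_cases h2 : σ x ∈ A <;> simp [h1, h2, stayWeight]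
  rw [Finset.prod_congr rfl fun x _ => h x, Finset.prod_mul_distrib, Finset.prod_ite,
    Finset.prod_ite]
  simp only [Finset.prod_const_one, mul_one, Finset.prod_const]
  congr 2
  · simp
  · have h3 := Finset.card_filter_add_card_filter_not (s := A) (fun x => σ x ∈ A)
    have h4 : (Finset.univ.filter fun x => x ∈ A ∧ σ x ∈ A) = A.filter fun x => σ x ∈ A := by
      ext x; simp
    rw [h4]; rw [leaveCount]; omega

/-- The number of fixed points, read off from the cycle type. -/
def fixNum (σ : Perm β) : ℕ := Fintype.card β - σ.cycleType.sum

theorem fixNum_add_sum (σ : Perm β) : fixNum σ + σ.cycleType.sum = Fintype.card β := by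
  have := Perm.sum_cycleType_le σ; rw [fixNum]; omega

theorem multiset_prod_map_le_pow {a b h : ℝ} (hh : 0 ≤ h) (hab : a ^ 2 + b ^ 2 ≤ h ^ 2)
    (m : Multiset ℕ) (hm : ∀ l ∈ m, 2 ≤ l) :
    |(m.map fun l => a ^ l + b ^ l).prod| ≤ h ^ m.sum := by
  have ha : |a| ≤ h := abs_le_of_sq_le_sq (by nlinarith [sq_nonneg b]) hh
  have hb : |b| ≤ h := abs_le_of_sq_le_sq (by nlinarith [sq_nonneg a]) hh
  induction m using Multiset.induction with
  | empty => simp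
  | cons l m ih =>
    rw [Multiset.map_cons, Multiset.prod_cons, Multiset.sum_cons, pow_add, abs_mul]
    have h1 := ih fun l hl => hm l (by simp [hl])
    obtain ⟨j, rfl⟩ : ∃ j, l = j + 2 := ⟨l - 2, by have := hm l (by simp); omega⟩
    have h2 : |a ^ (j + 2) + b ^ (j + 2)| ≤ h ^ (j + 2) := by
      calc |a ^ (j + 2) + b ^ (j + 2)| ≤ |a ^ (j + 2)| + |b ^ (j + 2)| := abs_add_le _ _
        _ = |a| ^ j * a ^ 2 + |b| ^ j * b ^ 2 := by
          rw [abs_pow, abs_pow, pow_add, pow_add, sq_abs, sq_abs]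
        _ ≤ h ^ j * a ^ 2 + h ^ j * b ^ 2 := by gcongr
        _ = h ^ j * (a ^ 2 + b ^ 2) := by ring
        _ ≤ h ^ j * h ^ 2 := by gcongr
        _ = h ^ (j + 2) := by ring
    gcongr

/-- The two roots of a monic quadratic polynomial with nonnegative discriminant. -/
theorem exists_roots {t d : ℝ} (h : 0 ≤ t ^ 2 - 4 * d) :
    ∃ a b : ℝ, a + b = t ∧ a * b = d ∧ a - b = Real.sqrt (t ^ 2 - 4 * d) := by
  have h1 := Real.mul_self_sqrt h
  refine ⟨(t + Real.sqrt (t ^ 2 - 4 * d)) / 2, (t - Real.sqrt (t ^ 2 - 4 * d)) / 2,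
    by ring, ?_, by ring⟩
  nlinarith

theorem sum_card_eq_le {y : ℝ} (hy : 0 < y) (k : ℕ) (g : Finset β → ℝ) (hg : ∀ A, 0 ≤ g A) :
    y ^ k * ∑ A ∈ Finset.univ.powersetCard k, g A ≤ ∑ A : Finset β, y ^ A.card * g A := by
  rw [Finset.mul_sum]
  calc ∑ A ∈ Finset.univ.powersetCard k, y ^ k * g A
      = ∑ A ∈ Finset.univ.powersetCard k, y ^ A.card * g A := by
        apply Finset.sum_congr rfl
        intro A hA
        rw [(Finset.mem_powersetCard.1 hA).2]
    _ ≤ _ := Finset.sum_le_sum_of_subset_of_nonneg (Finset.subset_univ _)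
        fun A _ _ => mul_nonneg (by positivity) (hg A)

theorem transferSum_abs_le (w : Bool → Bool → ℝ) (σ : Perm β) {t d h : ℝ}
    (ht : t = w true true + w false false) (ht0 : 0 ≤ t)
    (hd : d = w true true * w false false - w true false * w false true)
    (hdisc : 0 ≤ t ^ 2 - 4 * d) (hh : 0 ≤ h) (hth : t ^ 2 - 2 * d ≤ h ^ 2) :
    transferSum w σ ≤ t ^ fixNum σ * h ^ (Fintype.card β - fixNum σ) := by
  obtain ⟨a, b, h1, h2, -⟩ := exists_roots hdisc
  have e : Fintype.card β - fixNum σ = σ.cycleType.sum := by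
    have := fixNum_add_sum σ; omega
  rw [transferSum_eq w (h1.trans ht) (h2.trans hd), h1, e]
  have h3 : a ^ 2 + b ^ 2 ≤ h ^ 2 := by
    have : a ^ 2 + b ^ 2 = t ^ 2 - 2 * d := by rw [← h1, ← h2]; ring
    linarith
  have := multiset_prod_map_le_pow hh h3 σ.cycleType
    fun l hl => Perm.two_le_of_mem_cycleType hl
  have h4 := (le_abs_self _).trans this
  have h5 : 0 ≤ t ^ fixNum σ := by positivity
  exact mul_le_mul_of_nonneg_left h4 h5

theorem sum_half_pow_leaveCount_le {y : ℝ} (hy : 0 < y) (k : ℕ) (σ : Perm β) :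
    y ^ k * ∑ A ∈ Finset.univ.powersetCard k, (1 / 2 : ℝ) ^ leaveCount σ A
      ≤ (1 + y) ^ fixNum σ * (Real.sqrt ((1 + y) ^ 2 - y)) ^ (Fintype.card β - fixNum σ) := by
  refine (sum_card_eq_le hy k _ fun A => by positivity).trans ?_
  rw [← Finset.sum_congr rfl fun A _ => prod_leaveWeight y (1 / 2) σ A, sum_finset_eq_transferSum]
  apply transferSum_abs_le _ _ (d := y / 2)
  · simp [leaveWeight]; ring
  · positivity
  · simp [leaveWeight]; ring
  · nlinarith [sq_nonneg (1 - y)]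
  · positivity
  · rw [Real.sq_sqrt (by nlinarith)]; linarith

theorem sum_half_pow_stay_le {y : ℝ} (hy : 0 < y) (k : ℕ) (σ : Perm β) :
    y ^ k * ∑ A ∈ Finset.univ.powersetCard k, (1 / 2 : ℝ) ^ (k - leaveCount σ A)
      ≤ (1 + y) ^ fixNum σ
        * (Real.sqrt ((1 + y) ^ 2 - 3 / 4 * y ^ 2)) ^ (Fintype.card β - fixNum σ) := by
  have h0 : ∑ A ∈ Finset.univ.powersetCard k, (1 / 2 : ℝ) ^ (k - leaveCount σ A)
      = ∑ A ∈ Finset.univ.powersetCard k, (1 / 2 : ℝ) ^ (A.card - leaveCount σ A) := by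
    apply Finset.sum_congr rfl
    intro A hA
    rw [(Finset.mem_powersetCard.1 hA).2]
  rw [h0]
  refine (sum_card_eq_le hy k _ fun A => by positivity).trans ?_
  rw [← Finset.sum_congr rfl fun A _ => prod_stayWeight y (1 / 2) σ A, sum_finset_eq_transferSum]
  refine (transferSum_abs_le _ _ (t := 1 + y / 2) (d := - (y / 2))
    (h := Real.sqrt ((1 + y) ^ 2 - 3 / 4 * y ^ 2)) ?_ ?_ ?_ ?_ ?_ ?_).trans ?_
  · simp [stayWeight]; ring
  · positivity
  · simp [stayWeight]; ring
  · nlinarith [sq_nonneg (1 - y)]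
  · positivity
  · rw [Real.sq_sqrt (by nlinarith)]; nlinarith
  · gcongr
    linarith

theorem prod_one_add_pow_le {y : ℝ} (hy : 0 ≤ y) (hy1 : y ≤ 1) (m : Multiset ℕ)
    (hm : ∀ l ∈ m, 2 ≤ l) :
    (m.map fun l => 1 + y ^ l).prod ≤ Real.exp (m.count 2 * y ^ 2 + m.sum * y ^ 3 / 3) := by
  induction m using Multiset.induction with
  | empty => simp
  | cons l m ih =>
    rw [Multiset.map_cons, Multiset.prod_cons, Multiset.sum_cons]
    have h1 := ih fun l hl => hm l (by simp [hl])
    have hl := hm l (by simp)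
    have h2 : 1 + y ^ l ≤ Real.exp ((if l = 2 then 1 else 0) * y ^ 2 + l * y ^ 3 / 3) := by
      have h3 := Real.add_one_le_exp (y ^ l)
      refine le_trans (by linarith) (Real.exp_le_exp.2 ?_)
      by_cases h : l = 2
      · subst h; simp only [if_true]; push_cast; nlinarith [pow_nonneg hy 3]
      · have h4 : (3 : ℝ) ≤ l := by exact_mod_cast (by omega : 3 ≤ l)
        have h5 : y ^ l ≤ y ^ 3 := pow_le_pow_of_le_one hy hy1 (by omega)
        have h6 := pow_nonneg hy 3
        simp only [h, if_false]
        nlinarith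
    have h7 : Multiset.count 2 (l ::ₘ m) = Multiset.count 2 m + if l = 2 then 1 else 0 := by
      rw [Multiset.count_cons]; simp [eq_comm]
    rw [h7]
    have h8 : 0 ≤ (m.map fun l => 1 + y ^ l).prod := by
      apply Multiset.prod_nonneg
      intro a ha
      obtain ⟨l, _, rfl⟩ := Multiset.mem_map.1 ha
      positivity
    calc _ ≤ Real.exp ((if l = 2 then 1 else 0) * y ^ 2 + l * y ^ 3 / 3)
          * Real.exp (m.count 2 * y ^ 2 + m.sum * y ^ 3 / 3) := by gcongr
      _ = _ := by
        rw [← Real.exp_add]; congr 1; push_cast; ring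

theorem sum_pow_leaveCount_le {y z : ℝ} (hy : 0 < y) (hy1 : y ≤ 1 / 2) (hz : 0 ≤ z) (hz1 : z ≤ 1)
    (k : ℕ) (σ : Perm β) :
    y ^ k * ∑ A ∈ Finset.univ.powersetCard k, z ^ leaveCount σ A
      ≤ Real.exp (2 * y * z * Fintype.card β + fixNum σ * y + σ.cycleType.count 2 * y ^ 2
        + Fintype.card β * y ^ 3 / 3) := by
  refine (sum_card_eq_le hy k _ fun A => by positivity).trans ?_
  rw [← Finset.sum_congr rfl fun A _ => prod_leaveWeight y z σ A, sum_finset_eq_transferSum]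
  have hyz : 0 ≤ y * z := by positivity
  have hdisc : (0 : ℝ) ≤ (1 + y) ^ 2 - 4 * (y * (1 - z)) := by nlinarith [sq_nonneg (1 - y)]
  obtain ⟨a, b, h1, h2, h3⟩ := exists_roots hdisc
  have hs : a - b ≤ 1 - y + 4 * (y * z) := by
    rw [h3]; apply Real.sqrt_le_iff.2
    constructor <;> nlinarith
  have hs2 : 1 - y ≤ a - b := by
    rw [h3]; apply Real.le_sqrt_of_sq_le; nlinarith
  have ha : a ≤ 1 + 2 * (y * z) := by linarith
  have ha1 : 1 ≤ a := by linarith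
  have hb : b ≤ y := by linarith
  have hb0 : 0 ≤ b := by
    by_contra h
    have : a * b < 0 := mul_neg_of_pos_of_neg (by linarith) (by linarith)
    nlinarith
  rw [transferSum_eq (leaveWeight y z) (a := a) (b := b) (by rw [h1]; simp [leaveWeight]; ring)
    (by rw [h2]; simp [leaveWeight]; ring)]
  have hc : 1 ≤ 1 + 2 * (y * z) := by linarith
  have h4 : (σ.cycleType.map fun l => a ^ l + b ^ l).prod
      ≤ (σ.cycleType.map fun l => (1 + 2 * (y * z)) ^ l * (1 + y ^ l)).prod := by
    apply Multiset.prod_map_le_prod_map₀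
    · intro l _; positivity
    · intro l _
      have e1 : a ^ l ≤ (1 + 2 * (y * z)) ^ l := by gcongr
      have e2 : b ^ l ≤ y ^ l := by gcongr
      have e3 : 1 ≤ (1 + 2 * (y * z)) ^ l := one_le_pow₀ hc
      have e4 : 0 ≤ y ^ l := by positivity
      nlinarith
  rw [Multiset.prod_map_mul] at h4
  have h5 : (σ.cycleType.map fun l => (1 + 2 * (y * z)) ^ l).prod
      = (1 + 2 * (y * z)) ^ σ.cycleType.sum := by
    induction σ.cycleType using Multiset.induction with
    | empty => simp
    | cons l m ih => simp [pow_add, ih]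
  rw [h5] at h4
  have h6 := prod_one_add_pow_le hy.le (by linarith) σ.cycleType
    fun l hl => Perm.two_le_of_mem_cycleType hl
  have h7 : (1 + 2 * (y * z)) ≤ Real.exp (2 * y * z) := by
    have := Real.add_one_le_exp (2 * y * z); linarith
  have h8 : a + b ≤ Real.exp y * Real.exp (2 * y * z) := by
    have := Real.add_one_le_exp y
    have e : 1 ≤ Real.exp (2 * y * z) := Real.one_le_exp (by positivity)
    have e2 := Real.exp_pos y
    nlinarith
  have hn := fixNum_add_sum σ
  have hn' : (fixNum σ : ℝ) + σ.cycleType.sum = Fintype.card β := by exact_mod_cast hn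
  have h9 : (σ.cycleType.sum : ℝ) * y ^ 3 ≤ Fintype.card β * y ^ 3 := by
    gcongr
    omega
  change (a + b) ^ fixNum σ * _ ≤ _
  calc (a + b) ^ fixNum σ * (σ.cycleType.map fun l => a ^ l + b ^ l).prod
      ≤ (Real.exp y * Real.exp (2 * y * z)) ^ fixNum σ
        * (Real.exp (2 * y * z) ^ σ.cycleType.sum
          * Real.exp (σ.cycleType.count 2 * y ^ 2 + σ.cycleType.sum * y ^ 3 / 3)) := by
        apply mul_le_mul
        · gcongr
        · refine h4.trans ?_
          gcongr
          apply Multiset.prod_nonneg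
          intro c hc
          obtain ⟨l, _, rfl⟩ := Multiset.mem_map.1 hc
          positivity
        · apply Multiset.prod_nonneg
          intro c hc
          obtain ⟨l, _, rfl⟩ := Multiset.mem_map.1 hc
          positivity
        · positivity
    _ = Real.exp (2 * y * z * (fixNum σ + σ.cycleType.sum) + fixNum σ * y
          + σ.cycleType.count 2 * y ^ 2 + σ.cycleType.sum * y ^ 3 / 3) := by
        rw [mul_pow, ← Real.exp_nat_mul, ← Real.exp_nat_mul, ← Real.exp_nat_mul, ← Real.exp_add,
          ← Real.exp_add, ← Real.exp_add]
        congr 1; ring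
    _ ≤ _ := by
        apply Real.exp_le_exp.2
        rw [hn']; linarith

end Weights

theorem pow_mul_factorial_le (k j : ℕ) : k ^ j * k.factorial ≤ k ^ k * j.factorial := by
  rcases le_total j k with h | h
  · obtain ⟨d, rfl⟩ := Nat.exists_eq_add_of_le h
    have h1 : (j + d).factorial ≤ j.factorial * (j + d) ^ d := by
      rw [← Nat.factorial_mul_ascFactorial]
      refine Nat.mul_le_mul_left _ ?_
      exact Nat.ascFactorial_le_pow_add j d
    calc (j + d) ^ j * (j + d).factorial ≤ (j + d) ^ j * (j.factorial * (j + d) ^ d) :=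
          Nat.mul_le_mul_left _ h1
      _ = (j + d) ^ (j + d) * j.factorial := by rw [pow_add _ j d]; ring
  · have h1 := Nat.factorial_mul_pow_sub_le_factorial h
    calc k ^ j * k.factorial = k ^ k * (k.factorial * k ^ (j - k)) := by
          rw [mul_comm k.factorial, ← mul_assoc, ← pow_add]
          congr 2; omega
      _ ≤ _ := Nat.mul_le_mul_left _ h1

theorem choose_mul_pow_le (k m j : ℕ) (hj : j ≤ k + m) :
    k ^ j * m ^ (k + m - j) * (k + m).choose j ≤ (k + m).choose k * k ^ k * m ^ m := by
  have h1 := pow_mul_factorial_le k j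
  have h2 := pow_mul_factorial_le m (k + m - j)
  have h3 := Nat.choose_mul_factorial_mul_factorial hj
  have h4 := Nat.choose_mul_factorial_mul_factorial (Nat.le_add_right k m)
  rw [Nat.add_sub_cancel_left] at h4
  have p1 := Nat.factorial_pos k
  have p2 := Nat.factorial_pos m
  have p3 := Nat.factorial_pos j
  have p4 := Nat.factorial_pos (k + m - j)
  set F := (k + m).choose j
  set G := (k + m).choose k
  set a := k.factorial
  set b := m.factorial
  set c := j.factorial
  set d := (k + m - j).factorial
  refine Nat.le_of_mul_le_mul_right (c := a * b * (c * d)) ?_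
    (Nat.mul_pos (Nat.mul_pos p1 p2) (Nat.mul_pos p3 p4))
  calc k ^ j * m ^ (k + m - j) * F * (a * b * (c * d))
      = (k ^ j * a) * (m ^ (k + m - j) * b) * (F * c * d) := by ring
    _ ≤ (k ^ k * c) * (m ^ m * d) * (F * c * d) := by gcongr
    _ = G * k ^ k * m ^ m * (a * b * (c * d)) := by rw [h3, ← h4]; ring

theorem add_pow_le_choose (k m : ℕ) :
    (k + m) ^ (k + m) ≤ (k + m + 1) * ((k + m).choose k * k ^ k * m ^ m) := by
  rw [add_pow]
  refine (Finset.sum_le_card_nsmul _ _ ((k + m).choose k * k ^ k * m ^ m) ?_).trans ?_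
  · intro j hj
    exact choose_mul_pow_le k m j (by have := Finset.mem_range.1 hj; omega)
  · simp

theorem one_add_div_pow_le {k m : ℕ} (hm : 0 < m) :
    (1 + (k : ℝ) / m) ^ (k + m) ≤ (k + m + 1) * ((k + m).choose k * ((k : ℝ) / m) ^ k) := by
  have h : ((k : ℝ) + m) ^ (k + m) ≤ (k + m + 1) * ((k + m).choose k * k ^ k * m ^ m) := by
    exact_mod_cast add_pow_le_choose k m
  have hm' : (0 : ℝ) < m := by exact_mod_cast hm
  have e : (1 + (k : ℝ) / m) = (k + m) / m := by field_simp; ring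
  rw [e, div_pow, div_pow, div_le_iff₀ (by positivity)]
  refine h.trans (le_of_eq ?_)
  rw [pow_add]; field_simp

theorem div_le_exp_of_mode {n m f : ℕ} {S y x c C : ℝ} (hy : 0 < y) (hC : 0 < C)
    (hf : f ≤ n)
    (hS : y ^ m * S ≤ (1 + y) ^ f * Real.sqrt ((1 + y) ^ 2 * (1 - x)) ^ (n - f))
    (hmode : (1 + y) ^ n ≤ c * (C * y ^ m)) :
    S / C ≤ c * Real.exp (-(x / 2) * (n - f : ℕ)) := by
  have h1 : Real.sqrt ((1 + y) ^ 2 * (1 - x)) ≤ (1 + y) * Real.exp (-(x / 2)) := by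
    rw [Real.sqrt_le_iff]
    refine ⟨by positivity, ?_⟩
    rw [mul_pow, ← Real.exp_nat_mul]
    gcongr
    have := Real.add_one_le_exp (-x)
    calc 1 - x ≤ Real.exp (-x) := by linarith
      _ = _ := by congr 1; push_cast; ring
  have h2 : y ^ m * S ≤ (1 + y) ^ n * Real.exp (-(x / 2) * (n - f : ℕ)) := by
    refine hS.trans ?_
    calc (1 + y) ^ f * Real.sqrt ((1 + y) ^ 2 * (1 - x)) ^ (n - f)
        ≤ (1 + y) ^ f * ((1 + y) * Real.exp (-(x / 2))) ^ (n - f) := by gcongr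
      _ = (1 + y) ^ (f + (n - f)) * Real.exp (-(x / 2)) ^ (n - f) := by
        rw [mul_pow, pow_add]; ring
      _ = _ := by rw [Nat.add_sub_cancel' hf, ← Real.exp_nat_mul, mul_comm _ (-(x / 2))]
  rw [div_le_iff₀ hC]
  refine le_of_mul_le_mul_left (a := y ^ m) ?_ (by positivity)
  refine h2.trans ?_
  calc (1 + y) ^ n * Real.exp (-(x / 2) * (n - f : ℕ))
      ≤ c * (C * y ^ m) * Real.exp (-(x / 2) * (n - f : ℕ)) := by gcongr
    _ = _ := by ring

theorem inv_choose_le {m r : ℕ} (hr : r ≤ m) (hm : 12 ≤ m) :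
    1 / ((m.choose r : ℕ) : ℝ) ≤ 1 / (((m / 2).choose 6 : ℕ) : ℝ) + 32 * (1 / 2) ^ r
      + 32 * (1 / 2) ^ (m - r) := by
  have hpos : (1 : ℝ) ≤ (m.choose r : ℕ) := by exact_mod_cast Nat.choose_pos hr
  have h1 : 1 / ((m.choose r : ℕ) : ℝ) ≤ 1 := by
    rw [div_le_one (by linarith)]; exact hpos
  have p0 : (0 : ℝ) ≤ 1 / (((m / 2).choose 6 : ℕ) : ℝ) := by positivity
  have key : ∀ i : ℕ, i ≤ 5 → (1 : ℝ) ≤ 32 * (1 / 2) ^ i := by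
    intro i hi
    interval_cases i <;> norm_num
  have q1 : (0 : ℝ) ≤ 32 * (1 / 2) ^ r := by positivity
  have q2 : (0 : ℝ) ≤ 32 * (1 / 2) ^ (m - r) := by positivity
  by_cases c1 : r ≤ 5
  · have := key r c1; linarith
  by_cases c2 : m - r ≤ 5
  · have := key _ c2; linarith
  have main : ∀ i, 6 ≤ i → i ≤ m / 2 → (m / 2).choose 6 ≤ m.choose i := by
    intro i h6 hi
    calc (m / 2).choose 6 ≤ (m / 2 + (m - m / 2)).choose (6 + (i - 6)) := by
          rw [Nat.add_choose_eq]
          refine le_trans ?_ (Finset.single_le_sum (f := fun ij : ℕ × ℕ =>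
            (m / 2).choose ij.1 * (m - m / 2).choose ij.2) (fun _ _ => Nat.zero_le _)
            (show ((6, i - 6) : ℕ × ℕ) ∈ Finset.HasAntidiagonal.antidiagonal (6 + (i - 6)) by simp))
          exact Nat.le_mul_of_pos_right _ (Nat.choose_pos (by omega))
      _ = _ := by congr 1 <;> omega
  have hle : (m / 2).choose 6 ≤ m.choose r := by
    by_cases c3 : r ≤ m / 2
    · exact main r (by omega) c3
    · rw [← Nat.choose_symm hr]; exact main _ (by omega) (by omega)
  have hp6 : (0 : ℝ) < ((m / 2).choose 6 : ℕ) := by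
    exact_mod_cast Nat.choose_pos (by omega)
  have : 1 / ((m.choose r : ℕ) : ℝ) ≤ 1 / (((m / 2).choose 6 : ℕ) : ℝ) := by
    apply one_div_le_one_div_of_le hp6
    exact_mod_cast hle
  linarith

section Estimates

variable {β : Type} [DecidableEq β] [Fintype β]

theorem avg_half_pow_leaveCount_le {k m : ℕ} (h : k + m = Fintype.card β) (hk : 0 < k) (hm : 0 < m)
    (σ : Perm β) :
    (∑ B ∈ Finset.univ.powersetCard m, (1 / 2 : ℝ) ^ leaveCount σ B)
        / ((Fintype.card β).choose m)
      ≤ (Fintype.card β + 1) * Real.exp (-((k : ℝ) * m / (Fintype.card β) ^ 2 / 2)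
        * (Fintype.card β - fixNum σ : ℕ)) := by
  have hk' : (0 : ℝ) < k := by exact_mod_cast hk
  have hm' : (0 : ℝ) < m := by exact_mod_cast hm
  have hn : (Fintype.card β : ℝ) = k + m := by rw [← h]; push_cast; ring
  have h1 := one_add_div_pow_le (k := m) hk
  have hS := sum_half_pow_leaveCount_le (y := (m : ℝ) / k) (by positivity) m σ
  refine div_le_exp_of_mode (y := (m : ℝ) / k) (m := m) (f := fixNum σ)
    (by positivity) ?_ ?_ ?_ ?_
  · exact_mod_cast Nat.choose_pos (by omega)
  · have := fixNum_add_sum σ; omega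
  · convert hS using 4
    rw [hn]; field_simp
    try ring
  · rw [← h, add_comm k m]; push_cast; exact h1

theorem avg_half_pow_stay_le {k m : ℕ} (h : k + m = Fintype.card β) (hk : 0 < k) (hm : 0 < m)
    (σ : Perm β) :
    (∑ B ∈ Finset.univ.powersetCard m, (1 / 2 : ℝ) ^ (m - leaveCount σ B))
        / ((Fintype.card β).choose m)
      ≤ (Fintype.card β + 1) * Real.exp (-(3 / 4 * (m : ℝ) ^ 2 / (Fintype.card β) ^ 2 / 2)
        * (Fintype.card β - fixNum σ : ℕ)) := by
  have hk' : (0 : ℝ) < k := by exact_mod_cast hk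
  have hm' : (0 : ℝ) < m := by exact_mod_cast hm
  have hn : (Fintype.card β : ℝ) = k + m := by rw [← h]; push_cast; ring
  have h1 := one_add_div_pow_le (k := m) hk
  have hS := sum_half_pow_stay_le (y := (m : ℝ) / k) (by positivity) m σ
  refine div_le_exp_of_mode (y := (m : ℝ) / k) (m := m) (f := fixNum σ)
    (by positivity) ?_ ?_ ?_ ?_
  · exact_mod_cast Nat.choose_pos (by omega)
  · have := fixNum_add_sum σ; omega
  · convert hS using 4
    rw [hn]; field_simp
    try ring
  · rw [← h, add_comm k m]; push_cast; exact h1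

theorem peelWeight_le_of_twelve_le {k m : ℕ} (h : k + m = Fintype.card β) (hk : 0 < k)
    (hm : 12 ≤ m) (σ : Perm β) :
    peelWeight k σ ≤ 1 / (((m / 2).choose 6 : ℕ) : ℝ)
      + 32 * ((Fintype.card β + 1) * Real.exp (-((k : ℝ) * m / (Fintype.card β) ^ 2 / 2)
        * (Fintype.card β - fixNum σ : ℕ)))
      + 32 * ((Fintype.card β + 1) * Real.exp (-(3 / 4 * (m : ℝ) ^ 2 / (Fintype.card β) ^ 2 / 2)
        * (Fintype.card β - fixNum σ : ℕ))) := by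
  have hC : (0 : ℝ) < ((Fintype.card β).choose m : ℕ) := by
    exact_mod_cast Nat.choose_pos (by omega)
  rw [peelWeight_eq h]
  have h1 : ∑ B ∈ Finset.univ.powersetCard m, 1 / ((m.choose (leaveCount σ B) : ℕ) : ℝ)
      ≤ ∑ B ∈ Finset.univ.powersetCard m, (1 / (((m / 2).choose 6 : ℕ) : ℝ)
        + 32 * (1 / 2 : ℝ) ^ leaveCount σ B + 32 * (1 / 2 : ℝ) ^ (m - leaveCount σ B)) := by
    apply Finset.sum_le_sum
    intro B hB
    have := leaveCount_le σ B
    rw [(Finset.mem_powersetCard.1 hB).2] at this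
    exact inv_choose_le this hm
  refine (div_le_div_of_nonneg_right h1 hC.le).trans ?_
  rw [Finset.sum_add_distrib, Finset.sum_add_distrib, add_div, add_div, ← Finset.mul_sum,
    ← Finset.mul_sum, mul_div_assoc, mul_div_assoc]
  have e : (∑ B ∈ (Finset.univ : Finset β).powersetCard m, 1 / (((m / 2).choose 6 : ℕ) : ℝ))
      / ((Fintype.card β).choose m : ℕ) = 1 / (((m / 2).choose 6 : ℕ) : ℝ) := by
    rw [Finset.sum_const, Finset.card_powersetCard, Finset.card_univ, nsmul_eq_mul]
    field_simp
  rw [e]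
  gcongr
  · exact avg_half_pow_leaveCount_le h hk (by omega) σ
  · exact avg_half_pow_stay_le h hk (by omega) σ

end Estimates

theorem pow_le_choose_mul_pow {n k : ℕ} (h : k ≤ n) : n ^ k ≤ n.choose k * k ^ k := by
  have h1 : n ^ k * k.factorial ≤ n.descFactorial k * k ^ k := by
    rw [← Nat.descFactorial_self k, Nat.descFactorial_eq_prod_range,
      Nat.descFactorial_eq_prod_range, ← Finset.card_range k, ← Finset.prod_const,
      ← Finset.prod_const, Finset.card_range, ← Finset.prod_mul_distrib,
      ← Finset.prod_mul_distrib]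
    apply Finset.prod_le_prod'
    intro i hi
    have hi := Finset.mem_range.1 hi
    zify [hi.le, (by omega : i ≤ n)]
    have : (i : ℤ) * k ≤ i * n := by gcongr
    nlinarith
  rw [Nat.descFactorial_eq_factorial_mul_choose] at h1
  refine Nat.le_of_mul_le_mul_right (c := k.factorial) ?_ (Nat.factorial_pos k)
  refine h1.trans (le_of_eq (by ring))

theorem inv_choose_le_pow {n k r : ℕ} (hr : r ≤ k) (h : 2 * k < n) :
    1 / (((n - k).choose r : ℕ) : ℝ) ≤ ((k : ℝ) / (n - 2 * k)) ^ r := by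
  have h1 : (n - 2 * k) ^ r ≤ (n - k).choose r * k ^ r := by
    calc (n - 2 * k) ^ r ≤ (n - k + 1 - r) ^ r := Nat.pow_le_pow_left (by omega) _
      _ ≤ (n - k).descFactorial r := Nat.pow_sub_le_descFactorial _ _
      _ = (n - k).choose r * r.factorial := by
        rw [Nat.descFactorial_eq_factorial_mul_choose, mul_comm]
      _ ≤ (n - k).choose r * k ^ r := by
        refine Nat.mul_le_mul_left _ ((Nat.factorial_le_pow r).trans ?_)
        exact Nat.pow_le_pow_left hr _
  have h2 : ((n : ℝ) - 2 * k) ^ r ≤ ((n - k).choose r : ℕ) * (k : ℝ) ^ r := by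
    have : (((n - 2 * k : ℕ) ^ r : ℕ) : ℝ) ≤ (((n - k).choose r * k ^ r : ℕ) : ℝ) := by
      exact_mod_cast h1
    rw [Nat.cast_pow, Nat.cast_sub h.le] at this
    push_cast at this
    exact this
  have hpos : (0 : ℝ) < (n : ℝ) - 2 * k := by
    have : (2 : ℝ) * k < n := by exact_mod_cast h
    linarith
  have hC : (0 : ℝ) < ((n - k).choose r : ℕ) := by exact_mod_cast Nat.choose_pos (by omega)
  rw [div_pow, div_le_div_iff₀ hC (by positivity)]
  linarith

section Small

variable {β : Type} [DecidableEq β] [Fintype β]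

theorem peelWeight_le_exp {k : ℕ} (hk : 0 < k) (hkn : 100 * k ≤ Fintype.card β) {y : ℝ}
    (hy : 0 < y) (hy1 : y ≤ 1 / 2) (σ : Perm β) :
    peelWeight k σ ≤ (k / (Fintype.card β * y)) ^ k
      * Real.exp (2.05 * k * y + fixNum σ * y + σ.cycleType.count 2 * y ^ 2
        + Fintype.card β * y ^ 3 / 3) := by
  have hk' : (1 : ℝ) ≤ k := by exact_mod_cast hk
  have hn : (100 : ℝ) * k ≤ Fintype.card β := by exact_mod_cast hkn
  set n := Fintype.card β with hnd
  have hpos : (0 : ℝ) < (n : ℝ) - 2 * k := by linarith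
  have hz : (k : ℝ) / (n - 2 * k) ≤ 1 := by rw [div_le_one hpos]; linarith
  have h1 := sum_pow_leaveCount_le hy hy1 (z := (k : ℝ) / (n - 2 * k)) (by positivity) hz k σ
  have hC : (0 : ℝ) < (n.choose k : ℕ) := by exact_mod_cast Nat.choose_pos (by omega)
  have hCn : (n : ℝ) ^ k ≤ (n.choose k : ℕ) * (k : ℝ) ^ k := by
    exact_mod_cast pow_le_choose_mul_pow (by omega : k ≤ n)
  have hzn : 2 * y * ((k : ℝ) / (n - 2 * k)) * n ≤ 2.05 * k * y := by
    have : ((k : ℝ) / (n - 2 * k)) * n ≤ 1.025 * k := by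
      rw [div_mul_eq_mul_div, div_le_iff₀ hpos]; nlinarith
    nlinarith
  set E := 2.05 * k * y + fixNum σ * y + σ.cycleType.count 2 * y ^ 2 + n * y ^ 3 / 3 with hE
  have h2 : y ^ k * ∑ A ∈ Finset.univ.powersetCard k, ((k : ℝ) / (n - 2 * k)) ^ leaveCount σ A
      ≤ Real.exp E := by
    refine h1.trans (Real.exp_le_exp.2 ?_)
    rw [hE, ← hnd]; linarith
  have h3 : ∑ A ∈ Finset.univ.powersetCard k, 1 / (((n - k).choose (leaveCount σ A) : ℕ) : ℝ)
      ≤ ∑ A ∈ Finset.univ.powersetCard k, ((k : ℝ) / (n - 2 * k)) ^ leaveCount σ A := by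
    apply Finset.sum_le_sum
    intro A hA
    apply inv_choose_le_pow
    · have := leaveCount_le σ A
      rwa [(Finset.mem_powersetCard.1 hA).2] at this
    · omega
  rw [peelWeight, ← hnd, div_le_iff₀ hC]
  have hn0 : (0 : ℝ) < n := by linarith
  refine le_of_mul_le_mul_left (a := y ^ k) ?_ (by positivity)
  calc y ^ k * ∑ A ∈ Finset.univ.powersetCard k, 1 / (((n - k).choose (leaveCount σ A) : ℕ) : ℝ)
      ≤ Real.exp E := le_trans (by gcongr) h2
    _ ≤ Real.exp E * ((n.choose k : ℕ) * (k : ℝ) ^ k / n ^ k) := by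
        apply le_mul_of_one_le_right (Real.exp_pos _).le
        rw [one_le_div (by positivity)]; exact hCn
    _ = y ^ k * ((k / (n * y)) ^ k * Real.exp E * (n.choose k : ℕ)) := by
        rw [div_pow, mul_pow]; field_simp

theorem two_mul_count_le (σ : Perm β) : 2 * σ.cycleType.count 2 + fixNum σ ≤ Fintype.card β := by
  have h := fixNum_add_sum σ
  have : ∀ m : Multiset ℕ, 2 * m.count 2 ≤ m.sum := by
    intro m
    induction m using Multiset.induction with
    | empty => simp
    | cons l m ih =>
      rw [Multiset.count_cons, Multiset.sum_cons]
      split_ifs with h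
      · subst h; omega
      · omega
  have := this σ.cycleType
  omega

theorem peelWeight_sq_le {k : ℕ} (hk : 4 ≤ k) (hkn : 100 * k ≤ Fintype.card β) (σ : Perm β)
    (hf : fixNum σ ≤ 1) :
    peelWeight k σ ^ 2 ≤ (6 * k / Fintype.card β) ^ k := by
  have hk' : (4 : ℝ) ≤ k := by exact_mod_cast hk
  have hn : (100 : ℝ) * k ≤ Fintype.card β := by exact_mod_cast hkn
  have hn0 : (0 : ℝ) < Fintype.card β := by linarith
  have hc2 : (2 : ℝ) * σ.cycleType.count 2 ≤ Fintype.card β := by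
    have := two_mul_count_le σ
    exact_mod_cast (by omega : 2 * σ.cycleType.count 2 ≤ Fintype.card β)
  have hf' : (fixNum σ : ℝ) ≤ 1 := by exact_mod_cast hf
  set y := Real.sqrt (k / Fintype.card β) with hy
  have hy2 : y ^ 2 = k / Fintype.card β := Real.sq_sqrt (by positivity)
  have hy0 : 0 < y := Real.sqrt_pos.2 (by positivity)
  have hny : Fintype.card β * y ^ 2 = k := by rw [hy2]; field_simp
  have hy1 : y ≤ 1 / 10 := by
    apply abs_le_of_sq_le_sq' _ (by norm_num) |>.2
    rw [hy2, div_le_iff₀ hn0]; linarith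
  have h0 : 0 ≤ peelWeight k σ := by
    rw [peelWeight]; positivity
  have h1 := peelWeight_le_exp (by omega) hkn hy0 (by linarith) σ
  have h2 : 2.05 * k * y + fixNum σ * y + σ.cycleType.count 2 * y ^ 2
      + Fintype.card β * y ^ 3 / 3 ≤ 0.77 * k := by
    have e1 : (k : ℝ) * y ≤ k * (1 / 10) := by gcongr
    have e2 : fixNum σ * y ≤ 1 * (1 / 10) := by gcongr
    have e3 : 2 * (σ.cycleType.count 2 * y ^ 2) ≤ k := by rw [← hny]; nlinarith
    have e4 : Fintype.card β * y ^ 3 = k * y := by rw [← hny]; ring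
    rw [e4]; linarith
  have e6 : Real.exp (0.77 * 2) ≤ 6 := by
    have := Real.exp_one_lt_d9
    have e : Real.exp (0.77 * 2) ^ 50 = Real.exp 1 ^ 77 := by
      rw [← Real.exp_nat_mul, ← Real.exp_nat_mul]; congr 1; norm_num
    refine le_of_pow_le_pow_left₀ (n := 50) (by norm_num) (by norm_num) ?_
    rw [e]
    calc Real.exp 1 ^ 77 ≤ 2.7182818286 ^ 77 := by gcongr
      _ ≤ _ := by norm_num
  calc peelWeight k σ ^ 2
      ≤ ((k / (Fintype.card β * y)) ^ k * Real.exp (0.77 * k)) ^ 2 := by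
        gcongr
        exact h1.trans (by gcongr)
    _ = ((k / (Fintype.card β * y)) ^ 2 * Real.exp (0.77 * 2)) ^ k := by
        rw [mul_pow, mul_pow, ← Real.exp_nat_mul, ← Real.exp_nat_mul, ← pow_mul, ← pow_mul,
          mul_comm k 2]
        congr 2; push_cast; ring
    _ ≤ ((k / (Fintype.card β * y)) ^ 2 * 6) ^ k := by gcongr
    _ = (6 * k / Fintype.card β) ^ k := by
        congr 1
        rw [div_pow, mul_pow, hy2]; field_simp

theorem six_mul_div_pow_le {n : ℝ} {k : ℕ} (hk : 7 ≤ k) (hkn : 100 * (k : ℝ) ≤ n) :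
    (6 * k / n) ^ k ≤ (42 / n) ^ 7 := by
  induction k, hk using Nat.le_induction with
  | base => norm_num
  | succ k hk ih =>
    push_cast at *
    have hk' : (7 : ℝ) ≤ k := by exact_mod_cast hk
    have hn : 0 < n := by linarith
    refine le_trans ?_ (ih (by linarith))
    have e1 : (1 + 1 / (k : ℝ)) ^ k ≤ 3 := by
      have := Real.add_one_le_exp (1 / (k : ℝ))
      calc (1 + 1 / (k : ℝ)) ^ k ≤ Real.exp (1 / k) ^ k := by
            gcongr; linarith
        _ = Real.exp 1 := by rw [← Real.exp_nat_mul]; congr 1; field_simp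
        _ ≤ 3 := by have := Real.exp_one_lt_d9; linarith
    have e2 : 6 * ((k : ℝ) + 1) / n ≤ 1 / 3 := by
      rw [div_le_iff₀ hn]; linarith
    calc (6 * ((k : ℝ) + 1) / n) ^ (k + 1)
        = (6 * k / n) ^ k * ((1 + 1 / (k : ℝ)) ^ k * (6 * ((k : ℝ) + 1) / n)) := by
          rw [pow_succ, ← mul_assoc, ← mul_pow]; congr 2; field_simp
      _ ≤ (6 * k / n) ^ k * (3 * (1 / 3)) := by gcongr
      _ = _ := by ring

theorem peelWeight_le_of_seven_le {k : ℕ} (hk : 7 ≤ k) (hkn : 100 * k ≤ Fintype.card β)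
    (hn : 42 ^ 7 ≤ Fintype.card β) (σ : Perm β) (hf : fixNum σ ≤ 1) :
    peelWeight k σ ≤ 1 / (Fintype.card β : ℝ) ^ 3 := by
  have hn' : (42 : ℝ) ^ 7 ≤ Fintype.card β := by exact_mod_cast hn
  have h1 := peelWeight_sq_le (by omega) hkn σ hf
  have h2 := six_mul_div_pow_le (n := Fintype.card β) hk (by exact_mod_cast hkn)
  have hn0 : (0 : ℝ) < Fintype.card β := by linarith [show (0 : ℝ) < 42 ^ 7 by norm_num]
  apply abs_le_of_sq_le_sq' _ (by positivity) |>.2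
  refine (h1.trans h2).trans ?_
  rw [div_pow, one_div, inv_pow, ← pow_mul, ← one_div, div_le_div_iff₀ (by positivity)
    (by positivity)]
  calc (42 : ℝ) ^ 7 * Fintype.card β ^ (3 * 2) ≤ Fintype.card β * Fintype.card β ^ (3 * 2) := by
        gcongr
    _ = _ := by ring

end Small

section Small

variable {β : Type} [DecidableEq β] [Fintype β]

theorem peelWeight_nonneg (k : ℕ) (σ : Perm β) : 0 ≤ peelWeight k σ := by
  rw [peelWeight]; positivity

theorem peelWeight_pow_three_le {k : ℕ} (hk0 : 0 < k) (hk : k ≤ 6)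
    (hn : 10 ^ 6 ≤ Fintype.card β) (σ : Perm β) (hf : fixNum σ ≤ 1)
    (hc : σ.cycleType.count 2 ^ 3 ≤ Fintype.card β ^ 2) :
    peelWeight k σ ^ 3 ≤ 20000 * k ^ (3 * k) / (Fintype.card β : ℝ) ^ (2 * k) := by
  have hn' : (10 : ℝ) ^ 6 ≤ Fintype.card β := by exact_mod_cast hn
  have hn0 : (0 : ℝ) < Fintype.card β := by linarith
  have hf' : (fixNum σ : ℝ) ≤ 1 := by exact_mod_cast hf
  have hk' : (k : ℝ) ≤ 6 := by exact_mod_cast hk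
  have hk0' : (0 : ℝ) < k := by exact_mod_cast hk0
  have hc' : (σ.cycleType.count 2 : ℝ) ^ 3 ≤ (Fintype.card β : ℝ) ^ 2 := by exact_mod_cast hc
  obtain ⟨y, hy0, hy3⟩ : ∃ y : ℝ, 0 < y ∧ y ^ 3 = 1 / Fintype.card β := by
    refine ⟨(1 / Fintype.card β : ℝ) ^ ((1 : ℝ) / 3), by positivity, ?_⟩
    rw [← Real.rpow_natCast, ← Real.rpow_mul (by positivity)]; norm_num
  have hny : Fintype.card β * y ^ 3 = 1 := by rw [hy3]; field_simp
  have hy1 : y ≤ 1 / 100 := by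
    refine le_of_pow_le_pow_left₀ (n := 3) (by norm_num) (by norm_num) ?_
    rw [hy3, div_pow, div_le_div_iff₀ hn0 (by norm_num)]; linarith
  have hcy : σ.cycleType.count 2 * y ^ 2 ≤ 1 := by
    refine le_of_pow_le_pow_left₀ (n := 3) (by norm_num) (by norm_num) ?_
    calc (σ.cycleType.count 2 * y ^ 2) ^ 3 = (σ.cycleType.count 2 : ℝ) ^ 3 * (y ^ 3) ^ 2 := by ring
      _ ≤ (Fintype.card β : ℝ) ^ 2 * (y ^ 3) ^ 2 := by gcongr
      _ = 1 ^ 3 := by rw [← mul_pow, hny]; norm_num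
  have h1 := peelWeight_le_exp hk0 (by omega) hy0 (by linarith) σ
  have h2 : 2.05 * k * y + fixNum σ * y + σ.cycleType.count 2 * y ^ 2
      + Fintype.card β * y ^ 3 / 3 ≤ 3 := by
    have e1 : (k : ℝ) * y ≤ 6 * (1 / 100) := by gcongr
    have e2 : fixNum σ * y ≤ 1 * (1 / 100) := by gcongr
    rw [hny]; linarith
  have e9 : Real.exp 3 ^ 3 ≤ 20000 := by
    have := Real.exp_one_lt_d9
    have e : Real.exp 3 ^ 3 = Real.exp 1 ^ 9 := by
      rw [← Real.exp_nat_mul, ← Real.exp_nat_mul]; congr 1; norm_num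
    rw [e]
    calc Real.exp 1 ^ 9 ≤ 2.7182818286 ^ 9 := by gcongr
      _ ≤ _ := by norm_num
  calc peelWeight k σ ^ 3
      ≤ ((k / (Fintype.card β * y)) ^ k * Real.exp 3) ^ 3 := by
        apply pow_le_pow_left₀ (peelWeight_nonneg k σ)
        exact h1.trans (by gcongr)
    _ = (k / (Fintype.card β * y)) ^ (3 * k) * Real.exp 3 ^ 3 := by
        rw [mul_pow, ← pow_mul, mul_comm k 3]
    _ ≤ (k / (Fintype.card β * y)) ^ (3 * k) * 20000 := by gcongr
    _ = _ := by
        have : (Fintype.card β * y) ^ (3 * k) = (Fintype.card β : ℝ) ^ (2 * k) := by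
          rw [pow_mul, mul_pow, hy3, pow_mul]; congr 1; field_simp
        rw [div_pow, this]; ring

theorem peelWeight_four_le (hn : 10 ^ 15 ≤ Fintype.card β) (σ : Perm β) (hf : fixNum σ ≤ 1)
    (hc : σ.cycleType.count 2 ^ 3 ≤ Fintype.card β ^ 2) :
    peelWeight 4 σ ≤ 1 / (Fintype.card β : ℝ) ^ 2 := by
  have h := peelWeight_pow_three_le (by norm_num) (by norm_num : 4 ≤ 6) (by omega) σ hf hc
  have hn' : (10 : ℝ) ^ 15 ≤ Fintype.card β := by exact_mod_cast hn
  have hn0 : (0 : ℝ) < Fintype.card β := by linarith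
  refine le_of_pow_le_pow_left₀ (n := 3) (by norm_num) (by positivity) (h.trans ?_)
  rw [div_pow, div_le_div_iff₀ (by positivity) (by positivity)]
  calc _ ≤ (Fintype.card β : ℝ) ^ 2 * ((Fintype.card β : ℝ) ^ 2) ^ 3 := by
        gcongr
        calc _ ≤ ((10 : ℝ) ^ 15) ^ 2 := by norm_num
          _ ≤ _ := by gcongr
    _ = _ := by ring

theorem peelWeight_five_six_le {k : ℕ} (hk : k = 5 ∨ k = 6) (hn : 10 ^ 15 ≤ Fintype.card β)
    (σ : Perm β) (hf : fixNum σ ≤ 1)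
    (hc : σ.cycleType.count 2 ^ 3 ≤ Fintype.card β ^ 2) :
    peelWeight k σ ≤ 1 / (Fintype.card β : ℝ) ^ 3 := by
  have h := peelWeight_pow_three_le (by omega) (by omega : k ≤ 6) (by omega) σ hf hc
  have hn' : (10 : ℝ) ^ 15 ≤ Fintype.card β := by exact_mod_cast hn
  have hn0 : (0 : ℝ) < Fintype.card β := by linarith
  refine le_of_pow_le_pow_left₀ (n := 3) (by norm_num) (by positivity) (h.trans ?_)
  rw [div_pow, div_le_div_iff₀ (by positivity) (by positivity)]
  rcases hk with rfl | rfl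
  · calc _ ≤ (Fintype.card β : ℝ) * ((Fintype.card β : ℝ) ^ 3) ^ 3 := by
          gcongr
          calc _ ≤ (10 : ℝ) ^ 15 := by norm_num
            _ ≤ _ := by gcongr
      _ = _ := by ring
  · calc _ ≤ (Fintype.card β : ℝ) ^ 3 * ((Fintype.card β : ℝ) ^ 3) ^ 3 := by
          gcongr
          calc _ ≤ ((10 : ℝ) ^ 15) ^ 3 := by norm_num
            _ ≤ _ := by gcongr
      _ = _ := by ring

theorem peelWeight_le_div_sq {k : ℕ} (hk : 4 ≤ k) (hk6 : k ≤ 6) (hn : 600 ≤ Fintype.card β)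
    (σ : Perm β) (hf : fixNum σ ≤ 1) :
    peelWeight k σ ≤ 1296 / (Fintype.card β : ℝ) ^ 2 := by
  have h := peelWeight_sq_le hk (by omega) σ hf
  have hn' : (600 : ℝ) ≤ Fintype.card β := by exact_mod_cast hn
  have hn0 : (0 : ℝ) < Fintype.card β := by linarith
  have hk' : (k : ℝ) ≤ 6 := by exact_mod_cast hk6
  refine le_of_pow_le_pow_left₀ (n := 2) (by norm_num) (by positivity) (h.trans ?_)
  calc (6 * (k : ℝ) / Fintype.card β) ^ k ≤ (36 / Fintype.card β) ^ k := by
        gcongr; linarith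
    _ ≤ (36 / Fintype.card β) ^ 4 := by
        apply pow_le_pow_of_le_one (by positivity) _ hk
        rw [div_le_one hn0]; linarith
    _ = _ := by
        rw [div_pow, div_pow, ← pow_mul]; norm_num

end Small

theorem exists_pow_le_exp : ∃ Q : ℕ, ∀ q : ℕ, Q ≤ q →
    4096 * (q : ℝ) ^ 32 ≤ Real.exp ((q : ℝ) ^ 2 / 400) := by
  have h := isLittleO_pow_exp_pos_mul_atTop 32 (b := 1 / 400) (by norm_num)
  have h1 := (h.comp_tendsto tendsto_natCast_atTop_atTop).bound (c := 1 / 4096) (by norm_num)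
  obtain ⟨Q, hQ⟩ := Filter.eventually_atTop.1 h1
  refine ⟨Q + 1, fun q hq => ?_⟩
  have h2 := hQ q (by omega)
  simp only [Function.comp, Real.norm_eq_abs] at h2
  rw [abs_of_nonneg (by positivity), abs_of_nonneg (by positivity)] at h2
  have hq1 : (1 : ℝ) ≤ q := by exact_mod_cast (by omega : 1 ≤ q)
  calc 4096 * (q : ℝ) ^ 32 ≤ Real.exp (1 / 400 * q) := by linarith
    _ ≤ _ := by apply Real.exp_le_exp.2; nlinarith

theorem cast_choose_six_ge {a : ℕ} (ha : 10 ≤ a) :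
    ((a : ℝ) / 2) ^ 6 / 720 ≤ (a.choose 6 : ℕ) := by
  have h := Nat.pow_le_choose (α := ℝ) 6 a
  refine le_trans ?_ h
  have e : ((Nat.factorial 6 : ℕ) : ℝ) = 720 := by norm_num [Nat.factorial]
  rw [e]
  have ha' : (10 : ℝ) ≤ a := by exact_mod_cast ha
  gcongr
  rw [Nat.cast_sub (by omega)]
  push_cast; linarith

theorem exists_peelWeight_le : ∃ Q : ℕ, ∀ q : ℕ, Q ≤ q →
    ∀ {β : Type} [DecidableEq β] [Fintype β] (σ : Perm β), fixNum σ ≤ 1 →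
    q ^ 8 ≤ Fintype.card β → Fintype.card β < (q + 1) ^ 8 → ∀ k m : ℕ, k + m = Fintype.card β →
    q ^ 5 ≤ m → Fintype.card β ≤ 100 * k → peelWeight k σ ≤ 1 / (Fintype.card β : ℝ) ^ 3 := by
  obtain ⟨Q, hQ⟩ := exists_pow_le_exp
  refine ⟨max Q 40, fun q hq β _ _ σ hf hn1 hn2 k m hkm hm hk => ?_⟩
  have hq40 : 40 ≤ q := le_trans (le_max_right _ _) hq
  have hexp := hQ q (le_trans (le_max_left _ _) hq)
  set n := Fintype.card β with hn
  have hq4 : (40 : ℝ) ≤ q := by exact_mod_cast hq40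
  have hq' : (30 : ℝ) ≤ q := by linarith
  have hn1' : (q : ℝ) ^ 8 ≤ n := by exact_mod_cast hn1
  have hn2' : (n : ℝ) ≤ 2 * (q : ℝ) ^ 8 := by
    have h1 : (n : ℝ) ≤ (q + 1 : ℝ) ^ 8 := by exact_mod_cast hn2.le
    have h2 : (q + 1 : ℝ) ≤ q * (31 / 30) := by linarith
    calc (n : ℝ) ≤ (q * (31 / 30)) ^ 8 := h1.trans (by gcongr)
      _ = (31 / 30) ^ 8 * (q : ℝ) ^ 8 := by ring
      _ ≤ _ := by gcongr; norm_num
  have hm' : (q : ℝ) ^ 5 ≤ m := by exact_mod_cast hm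
  have hk' : (n : ℝ) ≤ 100 * k := by exact_mod_cast hk
  have hbig : (30 : ℝ) ^ 5 ≤ (q : ℝ) ^ 5 := by gcongr
  have hbig8 : (30 : ℝ) ^ 8 ≤ (q : ℝ) ^ 8 := by gcongr
  have hmbig : (30 : ℝ) ^ 5 ≤ m := hbig.trans hm'
  have hmN : 30 ^ 5 ≤ m := by exact_mod_cast hmbig
  have hn0 : (0 : ℝ) < n := by linarith [show (0 : ℝ) < 30 ^ 8 by norm_num]
  have hk0 : 0 < k := by
    have : (0 : ℝ) < k := by linarith
    exact_mod_cast this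
  have hmain := peelWeight_le_of_twelve_le (hkm.trans hn) hk0 (by omega) σ
  rw [← hn] at hmain
  have hnf : (n : ℝ) / 2 ≤ ((n - fixNum σ : ℕ) : ℝ) := by
    rw [Nat.cast_sub (by have := fixNum_add_sum σ; omega)]
    have : (fixNum σ : ℝ) ≤ 1 := by exact_mod_cast hf
    linarith [show (2 : ℝ) ≤ 30 ^ 8 by norm_num]
  have hq2 : (q : ℝ) ^ 2 ≤ (q : ℝ) ^ 5 := pow_le_pow_right₀ (by linarith) (by norm_num)
  have t1 : (q : ℝ) ^ 2 / 400 ≤ (k : ℝ) * m / n ^ 2 / 2 * (n - fixNum σ : ℕ) := by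
    calc (q : ℝ) ^ 2 / 400 ≤ m / 400 := by linarith
      _ ≤ (100 * k) * m / n ^ 2 / 2 / 100 * (n / 2) := by
        have : (100 * (k : ℝ)) * m / n ^ 2 / 2 / 100 * (n / 2) = (m / 400) * ((100 * k) / n) := by
          field_simp; ring
        rw [this]
        apply le_mul_of_one_le_right (by positivity)
        rw [one_le_div hn0]; exact hk'
      _ = (k : ℝ) * m / n ^ 2 / 2 * (n / 2) := by ring
      _ ≤ _ := by gcongr
  have t2 : (q : ℝ) ^ 2 / 400 ≤ 3 / 4 * (m : ℝ) ^ 2 / n ^ 2 / 2 * (n - fixNum σ : ℕ) := by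
    calc (q : ℝ) ^ 2 / 400 ≤ 3 / 16 * ((q : ℝ) ^ 5) ^ 2 / (2 * (q : ℝ) ^ 8) := by
          have : 3 / 16 * ((q : ℝ) ^ 5) ^ 2 / (2 * (q : ℝ) ^ 8) = 3 / 32 * (q : ℝ) ^ 2 := by
            field_simp; ring
          rw [this]; nlinarith
      _ ≤ 3 / 16 * (m : ℝ) ^ 2 / n := by gcongr
      _ = 3 / 4 * (m : ℝ) ^ 2 / n ^ 2 / 2 * (n / 2) := by field_simp; ring
      _ ≤ _ := by gcongr
  have hE : Real.exp (-((q : ℝ) ^ 2 / 400)) ≤ 1 / (4096 * (q : ℝ) ^ 32) := by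
    rw [Real.exp_neg, ← one_div]
    exact one_div_le_one_div_of_le (by positivity) hexp
  have hn3 : (n : ℝ) ^ 3 ≤ 8 * (q : ℝ) ^ 24 := by
    calc (n : ℝ) ^ 3 ≤ (2 * (q : ℝ) ^ 8) ^ 3 := by gcongr
      _ = _ := by ring
  have s : ∀ x : ℝ, (q : ℝ) ^ 2 / 400 ≤ x →
      32 * ((n + 1) * Real.exp (-x)) ≤ 1 / 4 * (1 / (n : ℝ) ^ 3) := by
    intro x hx
    have h1 : Real.exp (-x) ≤ 1 / (4096 * (q : ℝ) ^ 32) :=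
      (Real.exp_le_exp.2 (by linarith)).trans hE
    calc 32 * ((n + 1) * Real.exp (-x))
        ≤ 32 * ((4 * (q : ℝ) ^ 8) * (1 / (4096 * (q : ℝ) ^ 32))) := by
          gcongr; nlinarith
      _ = 1 / 4 * (1 / (8 * (q : ℝ) ^ 24)) := by field_simp; norm_num
      _ ≤ _ := by gcongr
  have s1 := s _ t1
  have s2 := s _ t2
  have c1 := cast_choose_six_ge (a := m / 2) (by omega)
  have c2 : (m : ℝ) / 4 ≤ ((m / 2 : ℕ) : ℝ) := by
    have : (m : ℝ) ≤ 2 * ((m / 2 : ℕ) : ℝ) + 1 := by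
      exact_mod_cast (by omega : m ≤ 2 * (m / 2) + 1)
    linarith
  have s0 : 1 / (((m / 2).choose 6 : ℕ) : ℝ) ≤ 1 / 2 * (1 / (n : ℝ) ^ 3) := by
    have : 2 * (n : ℝ) ^ 3 ≤ ((m / 2).choose 6 : ℕ) := by
      refine le_trans ?_ c1
      calc 2 * (n : ℝ) ^ 3 ≤ 16 * (q : ℝ) ^ 24 := by linarith
        _ ≤ (q : ℝ) ^ 24 * ((q : ℝ) ^ 6 / (8 ^ 6 * 720)) := by
          rw [mul_comm]; gcongr
          rw [le_div_iff₀ (by norm_num)]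
          calc (16 : ℝ) * (8 ^ 6 * 720) ≤ 40 ^ 6 := by norm_num
            _ ≤ _ := by gcongr
        _ = ((q : ℝ) ^ 5 / 4 / 2) ^ 6 / 720 := by field_simp; norm_num
        _ ≤ _ := by gcongr; linarith
    calc _ ≤ 1 / (2 * (n : ℝ) ^ 3) := one_div_le_one_div_of_le (by positivity) this
      _ = _ := by field_simp
  rw [neg_mul, neg_mul] at hmain
  linarith

theorem choose_sub_mul_pow_le {a h : ℕ} (hh : h ≤ a) (j : ℕ) :
    (a - h).choose j * a ^ j ≤ a.choose j * (a - h) ^ j := by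
  rcases lt_or_ge (a - h) j with hj | hj
  · rw [Nat.choose_eq_zero_of_lt hj]; simp
  have h1 : (a - h).descFactorial j * a ^ j ≤ a.descFactorial j * (a - h) ^ j := by
    rw [Nat.descFactorial_eq_prod_range, Nat.descFactorial_eq_prod_range]
    have e : ∀ x : ℕ, x ^ j = ∏ _i ∈ Finset.range j, x := by intro x; simp
    rw [e a, e (a - h), ← Finset.prod_mul_distrib, ← Finset.prod_mul_distrib]
    apply Finset.prod_le_prod'
    intro i hi
    have hi := Finset.mem_range.1 hi
    zify [hh, (by omega : i ≤ a - h), (by omega : i ≤ a)]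
    have : (0 : ℤ) ≤ i * h := by positivity
    nlinarith
  rw [Nat.descFactorial_eq_factorial_mul_choose, Nat.descFactorial_eq_factorial_mul_choose] at h1
  refine Nat.le_of_mul_le_mul_right (c := j.factorial) ?_ (Nat.factorial_pos j)
  refine le_trans (le_of_eq (by ring)) (h1.trans (le_of_eq (by ring)))

theorem choose_sub_div_choose_le {a h j : ℕ} (hh : h ≤ a) (ha : 0 < a) (hj : j ≤ a) :
    ((a - h).choose j : ℝ) / (a.choose j : ℕ) ≤ Real.exp (-(h * j / a : ℝ)) := by
  have h1 := choose_sub_mul_pow_le hh j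
  have h2 : ((a - h).choose j : ℝ) * (a : ℝ) ^ j ≤ (a.choose j : ℕ) * ((a : ℝ) - h) ^ j := by
    rw [← Nat.cast_sub hh]; exact_mod_cast h1
  have hC : (0 : ℝ) < (a.choose j : ℕ) := by exact_mod_cast Nat.choose_pos hj
  have ha' : (0 : ℝ) < a := by exact_mod_cast ha
  have hah : (0 : ℝ) ≤ (a : ℝ) - h := by rw [← Nat.cast_sub hh]; positivity
  calc ((a - h).choose j : ℝ) / (a.choose j : ℕ) ≤ (((a : ℝ) - h) / a) ^ j := by
        rw [div_le_iff₀ hC, div_pow, div_mul_eq_mul_div, le_div_iff₀ (by positivity)]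
        linarith
    _ ≤ Real.exp (-(h / a)) ^ j := by
        have := Real.add_one_le_exp (-((h : ℝ) / a))
        have e : ((a : ℝ) - h) / a = -((h : ℝ) / a) + 1 := by field_simp; ring
        rw [← e] at this
        gcongr
    _ = _ := by rw [← Real.exp_nat_mul]; congr 1; ring

section Disjoint

variable {β : Type} [DecidableEq β] [Fintype β]

theorem leaveCount_eq_card_iff {σ : Perm β} {B : Finset β} :
    leaveCount σ B = B.card ↔ ∀ b ∈ B, σ b ∉ B := by
  rw [leaveCount, Finset.card_filter_eq_iff]

theorem card_disjoint_mul_choose_le (σ : Perm β) (m h : ℕ) :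
    ((Finset.univ.powersetCard m).filter fun B => ∀ b ∈ B, σ b ∉ B).card * m.choose h
      ≤ (Fintype.card β).choose h * (Fintype.card β - 2 * h).choose (m - h) := by
  classical
  have hL : ((Finset.univ.powersetCard m).filter fun B => ∀ b ∈ B, σ b ∉ B).card * m.choose h
      = (((Finset.univ.powersetCard m).filter fun B => ∀ b ∈ B, σ b ∉ B).sigma
          fun B => B.powersetCard h).card := by
    rw [Finset.card_sigma, Finset.sum_congr rfl (g := fun _ => m.choose h), Finset.sum_const,
      smul_eq_mul]
    intro B hB
    rw [Finset.card_powersetCard]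
    rw [(Finset.mem_powersetCard.1 (Finset.mem_filter.1 hB).1).2]
  have hR : (((Finset.univ.powersetCard h).filter fun B => ∀ b ∈ B, σ b ∉ B).sigma
        fun B => (B ∪ B.map σ.toEmbedding)ᶜ.powersetCard (m - h)).card
      ≤ (Fintype.card β).choose h * (Fintype.card β - 2 * h).choose (m - h) := by
    rw [Finset.card_sigma, Finset.sum_congr rfl
      (g := fun _ => (Fintype.card β - 2 * h).choose (m - h)), Finset.sum_const, smul_eq_mul]
    · gcongr
      refine (Finset.card_filter_le _ _).trans ?_
      rw [Finset.card_powersetCard, Finset.card_univ]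
    · intro B hB
      rw [Finset.mem_filter, Finset.mem_powersetCard] at hB
      rw [Finset.card_powersetCard, Finset.card_compl, Finset.card_union_of_disjoint,
        Finset.card_map, hB.1.2, two_mul]
      rw [Finset.disjoint_left]
      intro b hb hb'
      obtain ⟨c, hc, rfl⟩ := Finset.mem_map.1 hb'
      exact hB.2 c hc hb
  rw [hL]
  refine le_trans ?_ hR
  apply Finset.card_le_card_of_injOn (fun p => ⟨p.2, p.1 \ p.2⟩)
  · rintro ⟨B, C⟩ hp
    simp only [Finset.coe_sigma, Set.mem_sigma_iff, Finset.mem_coe, Finset.mem_filter,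
      Finset.mem_powersetCard, Finset.subset_univ, true_and] at hp ⊢
    obtain ⟨⟨hB, hd⟩, hC, hCh⟩ := hp
    refine ⟨⟨hCh, fun b hb hb' => hd b (hC hb) (hC hb')⟩, ?_, ?_⟩
    · intro b hb
      rw [Finset.mem_sdiff] at hb
      rw [Finset.mem_compl, Finset.mem_union, not_or]
      refine ⟨hb.2, fun hb' => ?_⟩
      obtain ⟨c, hc, rfl⟩ := Finset.mem_map.1 hb'
      exact hd c (hC hc) hb.1
    · rw [Finset.card_sdiff_of_subset hC, hB, hCh]
  · rintro ⟨B, C⟩ hp ⟨B', C'⟩ hp' heq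
    simp only [Finset.coe_sigma, Set.mem_sigma_iff, Finset.mem_coe,
      Finset.mem_powersetCard] at hp hp'
    simp only [Sigma.mk.injEq, heq_eq_eq] at heq
    obtain ⟨rfl, h2⟩ := heq
    have : B = B' := by
      rw [← Finset.sdiff_union_of_subset hp.2.1, h2, Finset.sdiff_union_of_subset hp'.2.1]
    rw [this]

theorem disjoint_div_choose_le (σ : Perm β) {m h : ℕ} (hhm : h ≤ m) (hm : m ≤ Fintype.card β)
    (hh : h < Fintype.card β) :
    (((Finset.univ.powersetCard m).filter fun B => ∀ b ∈ B, σ b ∉ B).card : ℝ)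
        / ((Fintype.card β).choose m : ℕ)
      ≤ Real.exp (-(h * (m - h) / Fintype.card β : ℝ)) := by
  rcases lt_or_ge (Fintype.card β) (2 * h) with h2 | h2
  · have h0 := card_disjoint_mul_choose_le σ m m
    rw [Nat.choose_self, mul_one] at h0
    have : ((Finset.univ.powersetCard m).filter fun B : Finset β => ∀ b ∈ B, σ b ∉ B).card = 0 := by
      have h3 := card_disjoint_mul_choose_le σ m h
      rcases Nat.eq_zero_or_pos (m - h) with h4 | h4
      · rw [Finset.card_eq_zero, Finset.filter_eq_empty_iff]
        intro B hB hd
        have hB := (Finset.mem_powersetCard.1 hB).2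
        have : (B ∪ B.map σ.toEmbedding).card ≤ Fintype.card β := Finset.card_le_univ _
        rw [Finset.card_union_of_disjoint, Finset.card_map] at this
        · omega
        · rw [Finset.disjoint_left]
          intro b hb hb'
          obtain ⟨c, hc, rfl⟩ := Finset.mem_map.1 hb'
          exact hd c hc hb
      · rw [Nat.choose_eq_zero_of_lt (by omega : Fintype.card β - 2 * h < m - h), mul_zero] at h3
        have := Nat.choose_pos hhm
        by_contra hne
        exact absurd h3 (not_le.2 (Nat.mul_pos (Nat.pos_of_ne_zero hne) this))
    rw [this]; simp; positivity
  have h1 := card_disjoint_mul_choose_le σ m h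
  set D := ((Finset.univ.powersetCard m).filter fun B : Finset β => ∀ b ∈ B, σ b ∉ B).card
  set n := Fintype.card β
  have h1' : (D : ℝ) * (m.choose h : ℕ) ≤ (n.choose h : ℕ) * ((n - 2 * h).choose (m - h) : ℕ) := by
    exact_mod_cast h1
  have h2' : ((n.choose m : ℕ) : ℝ) * (m.choose h : ℕ)
      = (n.choose h : ℕ) * ((n - h).choose (m - h) : ℕ) := by
    exact_mod_cast Nat.choose_mul (n := n) hhm
  have h3 := choose_sub_div_choose_le (a := n - h) (h := h) (j := m - h) (by omega) (by omega)
    (by omega)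
  have p1 : (0 : ℝ) < (n.choose m : ℕ) := by exact_mod_cast Nat.choose_pos hm
  have p2 : (0 : ℝ) < (m.choose h : ℕ) := by exact_mod_cast Nat.choose_pos hhm
  have p3 : (0 : ℝ) < (n.choose h : ℕ) := by exact_mod_cast Nat.choose_pos hh.le
  have p4 : (0 : ℝ) < ((n - h).choose (m - h) : ℕ) := by
    exact_mod_cast Nat.choose_pos (by omega)
  have p5 : (0 : ℝ) < ((n - h : ℕ) : ℝ) := by exact_mod_cast (by omega : 0 < n - h)
  calc (D : ℝ) / (n.choose m : ℕ)
        = D * (m.choose h : ℕ) / ((n.choose m : ℕ) * (m.choose h : ℕ)) := by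
        field_simp
    _ ≤ (n.choose h : ℕ) * ((n - 2 * h).choose (m - h) : ℕ)
          / ((n.choose h : ℕ) * ((n - h).choose (m - h) : ℕ)) := by rw [h2']; gcongr
    _ = ((n - h - h).choose (m - h) : ℕ) / ((n - h).choose (m - h) : ℕ) := by
        rw [show n - h - h = n - 2 * h by omega]; field_simp
    _ ≤ _ := h3
    _ ≤ _ := by
        apply Real.exp_le_exp.2
        rw [neg_le_neg_iff, Nat.cast_sub hhm]
        have : (0 : ℝ) ≤ (m : ℝ) - h := by rw [← Nat.cast_sub hhm]; positivity
        gcongr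
        exact Nat.sub_le n h

theorem le_choose_self {m r : ℕ} (hr : 0 < r) (hm : r < m) : m ≤ m.choose r := by
  induction m generalizing r with
  | zero => omega
  | succ m ih =>
    obtain ⟨r, rfl⟩ := Nat.exists_eq_succ_of_ne_zero hr.ne'
    rw [Nat.succ_eq_add_one, Nat.choose_succ_succ]
    rcases Nat.lt_or_ge (r + 1) m with h | h
    · have h1 := ih hr h
      have h2 := Nat.choose_pos (by omega : r ≤ m)
      simp only [Nat.succ_eq_add_one] at *
      omega
    · obtain rfl : m = r + 1 := by omega
      simp

theorem inv_choose_le_one_div {m r : ℕ} (hr : r ≤ m) (hm : 0 < m) :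
    1 / ((m.choose r : ℕ) : ℝ) ≤ 1 / m + (1 / 2) ^ r + if r = m then 1 else 0 := by
  have p0 : (0 : ℝ) ≤ 1 / (m : ℝ) := by positivity
  have p1 : (0 : ℝ) ≤ (1 / 2 : ℝ) ^ r := by positivity
  by_cases h1 : r = m
  · subst h1; simp; positivity
  rw [if_neg h1, add_zero]
  by_cases h0 : r = 0
  · subst h0; simp
  · have := le_choose_self (by omega : 0 < r) (by omega : r < m)
    have : 1 / ((m.choose r : ℕ) : ℝ) ≤ 1 / m := by
      apply one_div_le_one_div_of_le
      · exact_mod_cast hm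
      · exact_mod_cast this
    linarith

theorem peelWeight_le_of_le {k m h : ℕ} (hkm : k + m = Fintype.card β) (hk : 0 < k) (hm : 0 < m)
    (hhm : h ≤ m) (σ : Perm β) :
    peelWeight k σ ≤ 1 / m + (Fintype.card β + 1)
        * Real.exp (-((k : ℝ) * m / (Fintype.card β) ^ 2 / 2) * (Fintype.card β - fixNum σ : ℕ))
      + Real.exp (-(h * (m - h) / Fintype.card β : ℝ)) := by
  have hC : (0 : ℝ) < ((Fintype.card β).choose m : ℕ) := by
    exact_mod_cast Nat.choose_pos (by omega)
  rw [peelWeight_eq hkm]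
  have h1 : ∑ B ∈ Finset.univ.powersetCard m, 1 / ((m.choose (leaveCount σ B) : ℕ) : ℝ)
      ≤ ∑ B ∈ Finset.univ.powersetCard m, (1 / (m : ℝ) + (1 / 2 : ℝ) ^ leaveCount σ B
        + if (∀ b ∈ B, σ b ∉ B) then 1 else 0) := by
    apply Finset.sum_le_sum
    intro B hB
    have hB := (Finset.mem_powersetCard.1 hB).2
    have h2 := leaveCount_le σ B
    rw [hB] at h2
    refine (inv_choose_le_one_div h2 hm).trans (le_of_eq ?_)
    congr 1
    have := leaveCount_eq_card_iff (σ := σ) (B := B)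
    rw [hB] at this
    simp only [this]
  refine (div_le_div_of_nonneg_right h1 hC.le).trans ?_
  rw [Finset.sum_add_distrib, Finset.sum_add_distrib, add_div, add_div, Finset.sum_boole]
  have e : (∑ B ∈ (Finset.univ : Finset β).powersetCard m, 1 / (m : ℝ))
      / ((Fintype.card β).choose m : ℕ) = 1 / m := by
    rw [Finset.sum_const, Finset.card_powersetCard, Finset.card_univ, nsmul_eq_mul]
    field_simp
  rw [e]
  gcongr
  · exact avg_half_pow_leaveCount_le hkm hk (by omega) σ
  · exact disjoint_div_choose_le σ hhm (by omega) (by omega)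

end Disjoint

theorem exists_peelWeight_le_nine_tenths : ∃ M₀ : ℕ, 1 ≤ M₀ ∧
    ∀ {β : Type} [DecidableEq β] [Fintype β] (σ : Perm β) (k m : ℕ),
    k + m = Fintype.card β → M₀ ≤ m → Fintype.card β ≤ m ^ 2 → Fintype.card β ≤ 2 * k →
    2 * fixNum σ ≤ Fintype.card β → peelWeight k σ ≤ 9 / 10 := by
  have h := isLittleO_pow_exp_pos_mul_atTop 2 (b := 1 / 8) (by norm_num)
  have h1 := (h.comp_tendsto tendsto_natCast_atTop_atTop).bound (c := 1 / 100) (by norm_num)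
  obtain ⟨Q, hQ⟩ := Filter.eventually_atTop.1 h1
  refine ⟨max Q 50, by simp, fun {β} _ _ σ k m hkm hm hn2 hk hf => ?_⟩
  have hm50 : 50 ≤ m := le_trans (le_max_right _ _) hm
  have h2 := hQ m (le_trans (le_max_left _ _) hm)
  simp only [Function.comp, Real.norm_eq_abs] at h2
  rw [abs_of_nonneg (by positivity), abs_of_nonneg (by positivity)] at h2
  set n := Fintype.card β with hn
  have hm' : (50 : ℝ) ≤ m := by exact_mod_cast hm50
  have hn2' : (n : ℝ) ≤ m ^ 2 := by exact_mod_cast hn2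
  have hk' : (n : ℝ) ≤ 2 * k := by exact_mod_cast hk
  have hn0 : (0 : ℝ) < n := by exact_mod_cast (by omega : 0 < n)
  have hnm : (m : ℝ) ≤ n := by exact_mod_cast (by omega : m ≤ n)
  have hmain := peelWeight_le_of_le (h := m / 2) (hkm.trans hn) (by omega) (by omega) (by omega) σ
  rw [← hn] at hmain
  have hnf : (n : ℝ) / 2 ≤ ((n - fixNum σ : ℕ) : ℝ) := by
    rw [Nat.cast_sub (by omega)]
    have : (2 : ℝ) * fixNum σ ≤ n := by exact_mod_cast hf
    linarith
  have t1 : (m : ℝ) / 8 ≤ (k : ℝ) * m / n ^ 2 / 2 * (n - fixNum σ : ℕ) := by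
    calc (m : ℝ) / 8 ≤ (m / 8) * ((2 * k) / n) := by
          apply le_mul_of_one_le_right (by positivity)
          rw [one_le_div hn0]; exact hk'
      _ = (k : ℝ) * m / n ^ 2 / 2 * (n / 2) := by field_simp; ring
      _ ≤ _ := by gcongr
  have s1 : (n + 1) * Real.exp (-((k : ℝ) * m / n ^ 2 / 2 * (n - fixNum σ : ℕ))) ≤ 1 / 50 := by
    have e1 : Real.exp (-((k : ℝ) * m / n ^ 2 / 2 * (n - fixNum σ : ℕ))) ≤ Real.exp (-(1 / 8 *
        m)) :=
      Real.exp_le_exp.2 (by linarith)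
    have e2 : Real.exp (-(1 / 8 * (m : ℝ))) * Real.exp (1 / 8 * m) = 1 := by
      rw [← Real.exp_add]; simp
    have e3 := Real.exp_pos (-(1 / 8 * (m : ℝ)))
    calc _ ≤ (2 * (m : ℝ) ^ 2) * Real.exp (-(1 / 8 * m)) := by gcongr; nlinarith
      _ ≤ 2 * (1 / 100 * Real.exp (1 / 8 * m)) * Real.exp (-(1 / 8 * m)) := by gcongr
      _ = 1 / 50 * (Real.exp (-(1 / 8 * (m : ℝ))) * Real.exp (1 / 8 * m)) := by ring
      _ = _ := by rw [e2, mul_one]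
  have s2 : Real.exp (-(((m / 2 : ℕ) : ℝ) * (m - (m / 2 : ℕ)) / n)) ≤ 4 / 5 := by
    have e1 : (m : ℝ) ≤ 2 * ((m / 2 : ℕ) : ℝ) + 1 := by
      exact_mod_cast (by omega : m ≤ 2 * (m / 2) + 1)
    have e2 : 2 * ((m / 2 : ℕ) : ℝ) ≤ m := by
      exact_mod_cast (by omega : 2 * (m / 2) ≤ m)
    have e3 : (1 / 4 - 1 / 10000 : ℝ) ≤ ((m / 2 : ℕ) : ℝ) * (m - (m / 2 : ℕ)) / n := by
      rw [le_div_iff₀ hn0]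
      nlinarith
    have e4 : (1.25 : ℝ) ≤ Real.exp (((m / 2 : ℕ) : ℝ) * (m - (m / 2 : ℕ)) / n) := by
      refine le_trans ?_ (Real.exp_le_exp.2 e3)
      have := Real.quadratic_le_exp_of_nonneg (x := 1 / 4 - 1 / 10000) (by norm_num)
      refine le_trans ?_ this
      norm_num
    rw [Real.exp_neg, inv_le_comm₀ (Real.exp_pos _) (by norm_num)]
    norm_num at e4 ⊢; exact e4
  have s0 : 1 / (m : ℝ) ≤ 1 / 50 := one_div_le_one_div_of_le (by norm_num) hm'
  rw [neg_mul] at hmain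
  linarith

section Fix

variable {β : Type} [DecidableEq β] [Fintype β]

theorem fixNum_eq_card (σ : Perm β) : fixNum σ = (Finset.univ.filter fun a => σ a = a).card := by
  have h1 := fixNum_add_sum σ
  rw [Perm.sum_cycleType] at h1
  have h2 : σ.support = (Finset.univ.filter fun a => σ a = a)ᶜ := by
    ext a; simp
  rw [h2, Finset.card_compl] at h1
  have := Finset.card_le_univ (Finset.univ.filter fun a => σ a = a)
  omega

theorem fixNum_le_of_mem_extSet {S : Finset β} {π : Perm β} {φ : Perm {a // a ∉ S}}
    (h : Perm.ofSubtype φ ∈ extSet S π) : fixNum φ ≤ fixNum π + S.card := by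
  rw [mem_extSet] at h
  refine le_trans ?_ (Nat.add_le_add_left (exitCount_le S π) _)
  rw [fixNum_eq_card, fixNum_eq_card, exitCount,
    ← Finset.card_map (Function.Embedding.subtype fun a => a ∉ S)]
  refine le_trans (Finset.card_le_card ?_) (Finset.card_union_le _ _)
  intro a ha
  simp only [Finset.mem_map, Finset.mem_filter, Finset.mem_univ, true_and,
    Function.Embedding.subtype_apply, Finset.mem_union] at ha ⊢
  obtain ⟨⟨a, haS⟩, hφ, rfl⟩ := ha
  by_cases hπ : π a ∈ S
  · exact Or.inr ⟨haS, hπ⟩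
  · left
    rw [← h.2 a haS hπ, Perm.ofSubtype_apply_of_mem (p := fun a => a ∉ S) _ haS, hφ]

theorem fixNum_conj (σ h : Perm β) : fixNum (h⁻¹ * σ * h) = fixNum σ := by
  have : h⁻¹ * σ * h = h⁻¹ * σ * (h⁻¹)⁻¹ := by simp
  rw [fixNum, fixNum, this, Perm.cycleType_conj]

end Fix

namespace UnitaryRep

variable {V : Type*} [AddCommGroup V] [Module ℝ V]

/-- One step of the recursion bounding matrix coefficients. -/
theorem abs_classAvg_le_of_restrict {β : Type} [DecidableEq β] [Fintype β] (U : UnitaryRep β V)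
    {S : Finset β} (hS : U.sym S ≠ ⊥) (hmax : ∀ S' : Finset β, S.card < S'.card → U.sym S' = ⊥)
    {f : ℕ} {b : ℝ} {v : V} (hv : v ∈ U.sym S)
    (hb : ∀ φ : Perm {a // a ∉ S}, fixNum φ ≤ f + S.card →
      |classAvg ((U.restrict S hS).coeff v) φ| ≤ b)
    (σ : Perm β) (hσ : fixNum σ ≤ f) :
    |classAvg (U.coeff v) σ| ≤ b * peelWeight Sᶜ.card σ := by
  rw [← classAvg_fixAvg S (U.coeff v)]
  refine (U.isPeel_of_max hv hmax).fixAvg.abs_classAvg_le σ fun h ψ hψ => ?_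
  obtain ⟨φ, rfl⟩ := exists_ofSubtype_of_mem_extSet hψ
  rw [fixAvg_ofSubtype U S hS]
  apply hb
  have h1 := fixNum_le_of_mem_extSet hψ
  rw [fixNum_conj] at h1
  omega

theorem exists_unit_abs_classAvg_le_pow {M₀ : ℕ}
    (hM₀ : ∀ {β : Type} [DecidableEq β] [Fintype β] (σ : Perm β) (k m : ℕ),
      k + m = Fintype.card β → M₀ ≤ m → Fintype.card β ≤ m ^ 2 → Fintype.card β ≤ 2 * k →
      2 * fixNum σ ≤ Fintype.card β → peelWeight k σ ≤ 9 / 10)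
    {M N : ℕ} (hN : M₀ ^ 2 < N) (hMN : 2 * M ≤ N) (t : ℕ) :
    ∀ {β : Type} [DecidableEq β] [Fintype β] (U : UnitaryRep β V),
      (∀ S : Finset β, M < S.card → U.sym S = ⊥) →
      (∀ S : Finset β, M < S.card → U.twist.sym S = ⊥) →
      N + t * M ≤ Fintype.card β → ∀ f, 2 * (f + t * M) ≤ N →
      ∃ v ∈ U.W, U.B v v = 1 ∧ ∀ σ : Perm β, fixNum σ ≤ f →
        |classAvg (U.coeff v) σ| ≤ (9 / 10) ^ t := by
  induction t with
  | zero =>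
    intro β _ _ U _ _ _ f _
    obtain ⟨v, hv, h1⟩ := U.exists_unit U.ne_bot
    refine ⟨v, hv, h1, fun σ _ => ?_⟩
    rw [pow_zero, classAvg, abs_div, Nat.abs_cast, div_le_one (by positivity)]
    refine (Finset.abs_sum_le_sum_abs _ _).trans ?_
    refine (Finset.sum_le_card_nsmul _ _ 1 fun g _ => ?_).trans (by simp)
    rw [← h1]; exact U.abs_coeff_le v _
  | succ t ih =>
    have key : ∀ {β : Type} [DecidableEq β] [Fintype β] (U : UnitaryRep β V),
        (∀ S : Finset β, M < S.card → U.sym S = ⊥) →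
        (∀ S : Finset β, M < S.card → U.twist.sym S = ⊥) →
        N + (t + 1) * M ≤ Fintype.card β → ∀ f, 2 * (f + (t + 1) * M) ≤ N →
        ∀ S : Finset β, U.sym S ≠ ⊥ → (∀ S' : Finset β, S.card < S'.card → U.sym S' = ⊥) →
        Fintype.card β ≤ S.card ^ 2 →
        ∃ v ∈ U.W, U.B v v = 1 ∧ ∀ σ : Perm β, fixNum σ ≤ f →
          |classAvg (U.coeff v) σ| ≤ (9 / 10) ^ (t + 1) := by
      intro β _ _ U hU hU' hcard f hf S hS hmax hn
      have hSM : S.card ≤ M := by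
        by_contra h
        exact hS (hU S (by omega))
      rw [Nat.add_mul, one_mul] at hcard hf
      have hcardS : Fintype.card {a // a ∉ S} + S.card = Fintype.card β := by
        rw [Fintype.card_subtype_compl, Fintype.card_coe]
        have := Finset.card_le_univ S
        omega
      obtain ⟨v, hv, hv1, hb⟩ := ih (U.restrict S hS) (U.restrict_sym_eq_bot hS hU)
        (U.restrict_twist_sym_eq_bot hS hU') (by omega) (f + S.card) (by omega)
      refine ⟨v, hv.1, hv1, fun σ hσ => ?_⟩
      refine (U.abs_classAvg_le_of_restrict hS hmax hv hb σ hσ).trans ?_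
      rw [pow_succ]
      gcongr
      have hc := Finset.card_add_card_compl S
      refine hM₀ σ Sᶜ.card S.card (by omega) ?_ hn (by omega) (by omega)
      by_contra h
      have : S.card ^ 2 ≤ M₀ ^ 2 := Nat.pow_le_pow_left (by omega) 2
      omega
    intro β _ _ U hU hU' hcard f hf
    obtain ⟨S, hS, hmax⟩ := U.exists_max_sym
    obtain ⟨S', hS', hmax'⟩ := U.twist.exists_max_sym
    obtain ⟨T, hT, hTc⟩ := U.exists_twist_sym_ne_bot hmax
    have hT' : T.card ≤ S'.card := by
      by_contra h
      exact hT (hmax' T (by omega))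
    rcases le_total S'.card S.card with h | h
    · refine key U hU hU' hcard f hf S hS hmax (hTc.trans ?_)
      rw [sq]; exact Nat.mul_le_mul_left _ (hT'.trans h)
    · obtain ⟨v, hv, hv1, hb⟩ := key U.twist hU' (by rwa [twist_twist]) hcard f hf S' hS' hmax'
        (hTc.trans (by rw [sq]; exact Nat.mul_le_mul h hT'))
      refine ⟨v, hv, hv1, fun σ hσ => ?_⟩
      have h1 := hb σ hσ
      rw [classAvg_twist, abs_mul] at h1
      have h2 : |((Perm.sign σ : ℤ) : ℝ)| = 1 := by
        rcases Int.units_eq_one_or (Perm.sign σ) with h | h <;> simp [h]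
      rwa [h2, one_mul] at h1

end UnitaryRep

theorem exists_nine_tenths_pow_le : ∃ Q : ℕ, ∀ q : ℕ, Q ≤ q →
    (9 / 10 : ℝ) ^ (q ^ 2) * (q + 1) ^ 24 ≤ 1 := by
  have h := tendsto_pow_const_mul_const_pow_of_abs_lt_one 24 (r := 9 / 10)
    (by rw [abs_of_pos] <;> norm_num)
  have h1 := h.eventually (gt_mem_nhds (show (0 : ℝ) < 9 / 10 by norm_num))
  obtain ⟨Q, hQ⟩ := Filter.eventually_atTop.1 h1
  refine ⟨Q + 2, fun q hq => ?_⟩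
  have h2 := hQ (q + 1) (by omega)
  have h3 : (9 / 10 : ℝ) ^ (q ^ 2) ≤ (9 / 10) ^ (q + 1) :=
    pow_le_pow_of_le_one (by norm_num) (by norm_num) (by nlinarith)
  push_cast at h2
  have : (9 / 10 : ℝ) ^ (q ^ 2) * (q + 1) ^ 24 ≤ (9 / 10) ^ (q + 1) * (q + 1) ^ 24 := by gcongr
  linarith

/-- If every Young subgroup block fixing (up to sign) a vector is small, then the matrix
coefficients average out. -/
theorem UnitaryRep.exists_abs_classAvg_le : ∃ Q : ℕ, ∀ q : ℕ, Q ≤ q →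
    ∀ {β : Type} [DecidableEq β] [Fintype β] {V : Type*} [AddCommGroup V] [Module ℝ V]
      (U : UnitaryRep β V),
      q ^ 8 ≤ Fintype.card β → Fintype.card β < (q + 1) ^ 8 →
      (∀ S : Finset β, q ^ 5 < S.card → U.sym S = ⊥) →
      (∀ S : Finset β, q ^ 5 < S.card → U.twist.sym S = ⊥) →
      ∃ v ∈ U.W, U.B v v = 1 ∧ ∀ σ : Perm β, fixNum σ ≤ 1 →
        |classAvg (U.coeff v) σ| ≤ 1 / (Fintype.card β : ℝ) ^ 3 := by
  obtain ⟨M₀, -, hM₀⟩ := exists_peelWeight_le_nine_tenths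
  obtain ⟨Q, hQ⟩ := exists_nine_tenths_pow_le
  refine ⟨max Q (max M₀ 10), fun q hq β _ _ V _ _ U hn1 hn2 hU hU' => ?_⟩
  have hqQ : Q ≤ q := le_trans (le_max_left _ _) hq
  have hqM : M₀ ≤ q := le_trans ((le_max_left _ _).trans (le_max_right _ _)) hq
  have hq10 : 10 ≤ q := le_trans ((le_max_right _ _).trans (le_max_right _ _)) hq
  have e7 : q ^ 2 * q ^ 5 = q ^ 7 := by ring
  have h1 : 10 * q ^ 7 ≤ q ^ 8 := by
    calc 10 * q ^ 7 ≤ q * q ^ 7 := Nat.mul_le_mul_right _ hq10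
      _ = q ^ 8 := by ring
  have h2 : q ^ 5 ≤ q ^ 7 := Nat.pow_le_pow_right (by omega) (by norm_num)
  have h3 : M₀ ^ 2 ≤ q ^ 2 := Nat.pow_le_pow_left hqM 2
  have h4 : q ^ 2 ≤ q ^ 7 := Nat.pow_le_pow_right (by omega) (by norm_num)
  have h5 : 1 ≤ q ^ 7 := Nat.one_le_pow _ _ (by omega)
  obtain ⟨v, hv, hv1, hb⟩ := UnitaryRep.exists_unit_abs_classAvg_le_pow (M := q ^ 5)
    (N := 4 * q ^ 7) hM₀ (by omega) (by omega) (q ^ 2) U hU hU' (by omega) 1 (by omega)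
  refine ⟨v, hv, hv1, fun σ hσ => (hb σ hσ).trans ?_⟩
  have hn0 : (0 : ℝ) < Fintype.card β := by exact_mod_cast (by omega : 0 < Fintype.card β)
  rw [le_div_iff₀ (by positivity)]
  refine le_trans ?_ (hQ q hqQ)
  have : (Fintype.card β : ℝ) ≤ (q + 1) ^ 8 := by exact_mod_cast hn2.le
  calc (9 / 10 : ℝ) ^ (q ^ 2) * (Fintype.card β : ℝ) ^ 3
      ≤ (9 / 10 : ℝ) ^ (q ^ 2) * ((q + 1 : ℝ) ^ 8) ^ 3 := by gcongr
    _ = _ := by ring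

section

variable {β : Type} [DecidableEq β] [Fintype β]

/-- The injective partial map of `Fin k` induced by `σ` on the points `y 0, …, y (k - 1)`. -/
def pattern {k : ℕ} (σ : Perm β) (y : Fin k ↪ β) (i : Fin k) : Option (Fin k) :=
  (List.finRange k).find? fun j => σ (y i) = y j

theorem pattern_eq_some {k : ℕ} {σ : Perm β} {y : Fin k ↪ β} {i j : Fin k} :
    pattern σ y i = some j ↔ σ (y i) = y j := by
  constructor
  · intro h
    simpa using List.find?_some h
  · intro h
    rcases hp : pattern σ y i with _ | j'
    · rw [pattern, List.find?_eq_none] at hp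
      exact absurd h (by simpa using hp j (by simp))
    · have := List.find?_some hp
      have h' : σ (y i) = y j' := by simpa using this
      rw [y.injective (h'.symm.trans h)]

theorem pattern_eq_none {k : ℕ} {σ : Perm β} {y : Fin k ↪ β} {i : Fin k} :
    pattern σ y i = none ↔ ∀ j, σ (y i) ≠ y j := by
  rw [Option.eq_none_iff_forall_ne_some]
  simp [pattern_eq_some]

/-- The value of a peeled function at a permutation with the given pattern outside a set of
size `m`, where `w` gives the values at the permutations supported outside this set. -/
noncomputable def patternValue {k : ℕ} (m : ℕ) (w : Perm (Fin k) → ℝ)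
    (p : Fin k → Option (Fin k)) : ℝ :=
  (-1) ^ (Finset.univ.filter fun i => p i = none).card
    * (m - (Finset.univ.filter fun i => p i = none).card).factorial / m.factorial
    * ∑ g ∈ Finset.univ.filter (fun g : Perm (Fin k) => ∀ i j, p i = some j → g i = j), w g

theorem IsPeel.classAvg_eq_sum_embedding {S : Finset β} {X : Perm β → ℝ} (hX : IsPeel S X)
    {k : ℕ} (e : Fin k ≃ {a // a ∉ S}) {w : Perm (Fin k) → ℝ}
    (hw : ∀ g, X (Perm.ofSubtype (e.permCongr g)) = w g) (σ : Perm β) :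
    UnitaryRep.classAvg X σ
      = (∑ y : Fin k ↪ β, patternValue S.card w (pattern σ y)) / Fintype.card (Fin k ↪ β) := by
  have hT : MulAction.IsPretransitive (Perm β) (Fin k ↪ β) :=
    Equiv.Perm.isMultiplyPretransitive β k
  set y₀ : Fin k ↪ β := e.toEmbedding.trans (Function.Embedding.subtype _) with hy₀
  have hy₀S : ∀ i, y₀ i ∉ S := fun i => (e i).2
  have hy₀e : ∀ a (ha : a ∉ S), y₀ (e.symm ⟨a, ha⟩) = a := fun a ha => by simp [hy₀]
  rw [UnitaryRep.classAvg_eq_inv, ← avg_smul_of_isPretransitive (G := Perm β) _ y₀]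
  congr 1
  refine Finset.sum_congr rfl fun h _ => ?_
  set π := h⁻¹ * σ * h with hπ
  have hpat : ∀ i j, pattern σ (h • y₀) i = some j ↔ π (y₀ i) = y₀ j := by
    intro i j
    rw [pattern_eq_some, hπ, Perm.mul_apply, Perm.mul_apply, Perm.inv_eq_iff_eq]
    simp [Function.Embedding.smul_apply]
  have hnone : ∀ i, pattern σ (h • y₀) i = none ↔ π (y₀ i) ∈ S := by
    intro i
    rw [Option.eq_none_iff_forall_ne_some]
    simp only [ne_eq, hpat]
    constructor
    · intro h'
      by_contra hc
      exact h' _ (hy₀e _ hc).symm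
    · intro h' j hj
      rw [hj] at h'
      exact hy₀S j h'
  have hr : (Finset.univ.filter fun i => pattern σ (h • y₀) i = none).card = exitCount S π := by
    rw [exitCount]
    apply Finset.card_bij (fun i _ => y₀ i)
    · intro i hi
      simp only [Finset.mem_filter, Finset.mem_univ, true_and, hnone] at hi ⊢
      exact ⟨hy₀S i, hi⟩
    · intro i _ j _ hij; exact y₀.injective hij
    · intro a ha
      simp only [Finset.mem_filter, Finset.mem_univ, true_and] at ha
      refine ⟨e.symm ⟨a, ha.1⟩, ?_, hy₀e a ha.1⟩
      simp only [Finset.mem_filter, Finset.mem_univ, true_and, hnone]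
      rw [hy₀e]; exact ha.2
  have hsum : ∑ ψ ∈ extSet S π, X ψ = ∑ g ∈ Finset.univ.filter (fun g : Perm (Fin k) =>
      ∀ i j, pattern σ (h • y₀) i = some j → g i = j), w g := by
    symm
    have hval : ∀ (g : Perm (Fin k)) i, Perm.ofSubtype (e.permCongr g) (y₀ i) = y₀ (g i) := by
      intro g i
      rw [Perm.ofSubtype_apply_of_mem (p := fun a => a ∉ S) _ (hy₀S i)]
      simp [hy₀]
    apply Finset.sum_bij (fun g _ => Perm.ofSubtype (e.permCongr g))
    · intro g hg
      simp only [Finset.mem_filter, Finset.mem_univ, true_and, hpat] at hg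
      rw [mem_extSet]
      refine ⟨fun b hb => UnitaryRep.ofSubtype_apply_mem _ hb, fun a ha hπa => ?_⟩
      obtain ⟨i, rfl⟩ : ∃ i, y₀ i = a := ⟨_, hy₀e a ha⟩
      obtain ⟨j, hj⟩ : ∃ j, y₀ j = π (y₀ i) := ⟨_, hy₀e _ hπa⟩
      rw [hval, hg i j hj.symm, hj]
    · intro g _ g' _ hgg
      exact e.permCongr.injective (Perm.ofSubtype_injective hgg)
    · intro ψ hψ
      obtain ⟨φ, rfl⟩ := UnitaryRep.exists_ofSubtype_of_mem_extSet hψ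
      refine ⟨e.permCongr.symm φ, ?_, by rw [Equiv.apply_symm_apply]⟩
      rw [mem_extSet] at hψ
      simp only [Finset.mem_filter, Finset.mem_univ, true_and, hpat]
      intro i j hij
      apply y₀.injective
      rw [← hval, ← hij, Equiv.apply_symm_apply]
      exact hψ.2 _ (hy₀S i) (by rw [hij]; exact hy₀S j)
    · intro g _; exact (hw g).symm
  have hf := hX.formula π
  rw [patternValue, hr, ← hsum, div_mul_eq_mul_div, eq_div_iff (by positivity)]
  exact hf

end

section

variable {β : Type} [DecidableEq β] [Fintype β]

theorem sum_embedding_fin_three (C : β → β → β → Prop) [∀ a b c, Decidable (C a b c)] :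
    (∑ y : Fin 3 ↪ β, if C (y 0) (y 1) (y 2) then (1 : ℝ) else 0)
      = ∑ a, ∑ b, ∑ c, if (a ≠ b ∧ a ≠ c ∧ b ≠ c) ∧ C a b c then (1 : ℝ) else 0 := by
  rw [← Fintype.sum_prod_type' (f := fun a b => ∑ c, if (a ≠ b ∧ a ≠ c ∧ b ≠ c) ∧ C a b c
    then (1 : ℝ) else 0), ← Fintype.sum_prod_type' (f := fun (p : β × β) c =>
    if (p.1 ≠ p.2 ∧ p.1 ≠ c ∧ p.2 ≠ c) ∧ C p.1 p.2 c then (1 : ℝ) else 0)]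
  rw [Finset.sum_boole, Finset.sum_boole]
  congr 1
  apply Finset.card_bij (fun y _ => ((y 0, y 1), y 2))
  · intro y hy
    simp only [Finset.mem_filter, Finset.mem_univ, true_and] at hy ⊢
    exact ⟨⟨y.injective.ne (by decide), y.injective.ne (by decide), y.injective.ne (by decide)⟩, hy⟩
  · intro y _ y' _ h
    simp only [Prod.mk.injEq] at h
    ext i
    fin_cases i
    · exact h.1.1
    · exact h.1.2
    · exact h.2
  · rintro ⟨⟨a, b⟩, c⟩ h
    simp only [Finset.mem_filter, Finset.mem_univ, true_and] at h
    refine ⟨⟨![a, b, c], ?_⟩, ?_, ?_⟩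
    · intro i j hij
      fin_cases i <;> fin_cases j <;> simp_all [eq_comm]
    · simp only [Finset.mem_filter, Finset.mem_univ, true_and]
      exact h.2
    · rfl

theorem sum_ite_ne_two {a b : β} (hab : a ≠ b) :
    (∑ c, if a ≠ c ∧ b ≠ c then (1 : ℝ) else 0) = Fintype.card β - 2 := by
  rw [Finset.sum_boole]
  have h1 : (Finset.univ.filter fun c => a ≠ c ∧ b ≠ c) = ({a, b} : Finset β)ᶜ := by
    ext c; simp [eq_comm]
  rw [h1, Finset.card_compl, Finset.card_pair hab, Nat.cast_sub]
  · simp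
  · rw [← Finset.card_pair hab]; exact Finset.card_le_univ _

theorem sum_ite_ne_one (a : β) :
    (∑ c, if a ≠ c then (1 : ℝ) else 0) = Fintype.card β - 1 := by
  rw [Finset.sum_boole]
  have h1 : (Finset.univ.filter fun c => a ≠ c) = ({a} : Finset β)ᶜ := by
    ext c; simp [eq_comm]
  rw [h1, Finset.card_compl, Finset.card_singleton, Nat.cast_sub]
  · simp
  · exact Fintype.card_pos_iff.2 ⟨a⟩

theorem sum_ite_and_eq (v : β) (Q : β → Prop) [DecidablePred Q] :
    (∑ c, if Q c ∧ v = c then (1 : ℝ) else 0) = if Q v then 1 else 0 := by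
  rw [Finset.sum_eq_single v]
  · simp
  · intro c _ hc; rw [if_neg]; exact fun h => hc h.2.symm
  · simp

theorem sum_ite_const_and (A : Prop) [Decidable A] (Q : β → Prop) [DecidablePred Q] :
    (∑ c, if A ∧ Q c then (1 : ℝ) else 0) = if A then ∑ c, (if Q c then (1 : ℝ) else 0) else 0 := by
  by_cases h : A <;> simp [h]

/-- The number of points on cycles of length two. -/
def twoCycleNum (σ : Perm β) : ℕ := (Finset.univ.filter fun a => σ (σ a) = a ∧ σ a ≠ a).card

/-- The number of points on cycles of length three. -/
def threeCycleNum (σ : Perm β) : ℕ :=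
  (Finset.univ.filter fun a => σ (σ (σ a)) = a ∧ σ a ≠ a).card

theorem sum_ite_fixed (σ : Perm β) : (∑ a, if σ a = a then (1 : ℝ) else 0) = fixNum σ := by
  rw [Finset.sum_boole, fixNum_eq_card]

theorem sum_ite_moved (σ : Perm β) :
    (∑ a, if σ a ≠ a then (1 : ℝ) else 0) = Fintype.card β - fixNum σ := by
  rw [← sum_ite_fixed σ, eq_sub_iff_add_eq, ← Finset.sum_add_distrib, ← Finset.card_univ,
    ← nsmul_one, ← Finset.sum_const]
  refine Finset.sum_congr rfl fun a _ => ?_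
  by_cases h : σ a = a <;> simp [h]

theorem sum_ite_twoCycle (σ : Perm β) :
    (∑ a, if σ (σ a) = a ∧ σ a ≠ a then (1 : ℝ) else 0) = twoCycleNum σ := by
  rw [Finset.sum_boole, twoCycleNum]

theorem sum_ite_threeCycle (σ : Perm β) :
    (∑ a, if σ (σ (σ a)) = a ∧ σ a ≠ a then (1 : ℝ) else 0) = threeCycleNum σ := by
  rw [Finset.sum_boole, threeCycleNum]

theorem sum_ite_path_three (σ : Perm β) :
    (∑ a, if σ (σ a) ≠ a ∧ σ a ≠ a then (1 : ℝ) else 0)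
      = Fintype.card β - fixNum σ - twoCycleNum σ := by
  rw [← sum_ite_moved, ← sum_ite_twoCycle, eq_sub_iff_add_eq, ← Finset.sum_add_distrib]
  refine Finset.sum_congr rfl fun a _ => ?_
  by_cases h : σ a = a <;> by_cases h' : σ (σ a) = a <;> simp [h, h']

section triples

variable (σ : Perm β)

theorem sum_embedding_three_true :
    (∑ _y : Fin 3 ↪ β, (1 : ℝ))
      = Fintype.card β * (Fintype.card β - 1) * (Fintype.card β - 2) := by
  have h := sum_embedding_fin_three (β := β) (fun _ _ _ => True)
  simp only [if_true, and_true] at h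
  rw [h]
  have h1 : ∀ a b : β, (∑ c, if a ≠ b ∧ a ≠ c ∧ b ≠ c then (1 : ℝ) else 0)
      = (if a ≠ b then 1 else 0) * (Fintype.card β - 2) := by
    intro a b
    rw [sum_ite_const_and]
    by_cases hab : a = b
    · simp [hab]
    · rw [sum_ite_ne_two hab]; simp [hab]
  simp_rw [h1, ← Finset.sum_mul, sum_ite_ne_one]
  rw [Finset.sum_const, nsmul_eq_mul, Finset.card_univ]

theorem sum_embedding_three_fix :
    (∑ y : Fin 3 ↪ β, if σ (y 0) = y 0 then (1 : ℝ) else 0)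
      = fixNum σ * (Fintype.card β - 1) * (Fintype.card β - 2) := by
  rw [sum_embedding_fin_three (fun a _ _ => σ a = a)]
  have h1 : ∀ a b : β, (∑ c, if (a ≠ b ∧ a ≠ c ∧ b ≠ c) ∧ σ a = a then (1 : ℝ) else 0)
      = (if σ a = a then 1 else 0) * ((if a ≠ b then 1 else 0) * (Fintype.card β - 2)) := by
    intro a b
    by_cases ha : σ a = a
    · simp only [ha, and_true]
      rw [sum_ite_const_and]
      by_cases hab : a = b
      · simp [hab]
      · rw [sum_ite_ne_two hab]; simp [hab]
    · simp [ha]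
  simp_rw [h1, ← Finset.mul_sum, ← Finset.sum_mul, sum_ite_ne_one, ← Finset.sum_mul,
    sum_ite_fixed]
  ring

theorem sum_embedding_three_path :
    (∑ y : Fin 3 ↪ β, if σ (y 0) = y 1 then (1 : ℝ) else 0)
      = (Fintype.card β - fixNum σ) * (Fintype.card β - 2) := by
  rw [sum_embedding_fin_three (fun a b _ => σ a = b)]
  have h1 : ∀ a b : β, (∑ c, if (a ≠ b ∧ a ≠ c ∧ b ≠ c) ∧ σ a = b then (1 : ℝ) else 0)
      = (if a ≠ b ∧ σ a = b then 1 else 0) * (Fintype.card β - 2) := by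
    intro a b
    by_cases ha : a ≠ b ∧ σ a = b
    · rw [← sum_ite_ne_two ha.1]
      simp [ha]
    · rw [if_neg ha, zero_mul]
      apply Finset.sum_eq_zero
      intro c _
      rw [if_neg]; tauto
  simp_rw [h1, ← Finset.sum_mul, sum_ite_and_eq, ← sum_ite_moved]
  simp only [ne_comm]

theorem sum_embedding_three_fix_path :
    (∑ y : Fin 3 ↪ β, if σ (y 0) = y 0 ∧ σ (y 1) = y 2 then (1 : ℝ) else 0)
      = fixNum σ * (Fintype.card β - fixNum σ) := by
  rw [sum_embedding_fin_three (fun a b c => σ a = a ∧ σ b = c)]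
  simp_rw [← and_assoc, sum_ite_and_eq]
  have h1 : ∀ a b : β, (((a ≠ b ∧ a ≠ σ b) ∧ b ≠ σ b) ∧ σ a = a) ↔ (σ a = a ∧ σ b ≠ b) := by
    intro a b
    constructor
    · intro h; exact ⟨h.2, h.1.2.symm⟩
    · rintro ⟨h, h'⟩
      refine ⟨⟨⟨?_, ?_⟩, h'.symm⟩, h⟩
      · rintro rfl; exact h' h
      · intro h2; rw [← h] at h2; exact h' (by rw [← σ.injective h2, h])
  simp_rw [and_assoc] at h1 ⊢
  simp_rw [h1, sum_ite_const_and, sum_ite_moved]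
  rw [← sum_ite_fixed σ, Finset.sum_mul]
  refine Finset.sum_congr rfl fun a _ => ?_
  split_ifs <;> simp

theorem sum_embedding_three_two_cycle :
    (∑ y : Fin 3 ↪ β, if σ (y 1) = y 0 ∧ σ (y 0) = y 1 then (1 : ℝ) else 0)
      = twoCycleNum σ * (Fintype.card β - 2) := by
  rw [sum_embedding_fin_three (fun a b _ => σ b = a ∧ σ a = b)]
  have h1 : ∀ a b : β, (∑ c, if (a ≠ b ∧ a ≠ c ∧ b ≠ c) ∧ σ b = a ∧ σ a = b then (1 : ℝ) else 0)
      = (if (σ b = a ∧ a ≠ b) ∧ σ a = b then 1 else 0) * (Fintype.card β - 2) := by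
    intro a b
    by_cases ha : (σ b = a ∧ a ≠ b) ∧ σ a = b
    · rw [← sum_ite_ne_two ha.1.2]
      simp [ha]
    · rw [if_neg ha, zero_mul]
      apply Finset.sum_eq_zero
      intro c _
      rw [if_neg]; tauto
  simp_rw [h1, ← Finset.sum_mul, sum_ite_and_eq, ← sum_ite_twoCycle]
  simp only [ne_comm]

theorem sum_embedding_three_path_path :
    (∑ y : Fin 3 ↪ β, if σ (y 0) = y 1 ∧ σ (y 1) = y 2 then (1 : ℝ) else 0)
      = Fintype.card β - fixNum σ - twoCycleNum σ := by
  rw [sum_embedding_fin_three (fun a b c => σ a = b ∧ σ b = c)]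
  simp_rw [← and_assoc, sum_ite_and_eq]
  rw [← sum_ite_path_three]
  refine Finset.sum_congr rfl fun a _ => ?_
  congr 1
  rw [eq_iff_iff]
  constructor
  · rintro ⟨⟨h1, h2⟩, h3⟩; exact ⟨h2.symm, h1.symm⟩
  · rintro ⟨h1, h2⟩; exact ⟨⟨h2.symm, h1.symm⟩, fun h => h2 (σ.injective h.symm)⟩

theorem sum_embedding_three_fix_two_cycle :
    (∑ y : Fin 3 ↪ β, if σ (y 0) = y 0 ∧ σ (y 2) = y 1 ∧ σ (y 1) = y 2 then (1 : ℝ) else 0)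
      = fixNum σ * twoCycleNum σ := by
  rw [sum_embedding_fin_three (fun a b c => σ a = a ∧ σ c = b ∧ σ b = c)]
  simp_rw [← and_assoc, sum_ite_and_eq]
  have h1 : ∀ a b : β, ((((a ≠ b ∧ a ≠ σ b) ∧ b ≠ σ b) ∧ σ a = a) ∧ σ (σ b) = b)
      ↔ (σ a = a ∧ σ (σ b) = b ∧ σ b ≠ b) := by
    intro a b
    constructor
    · intro h; exact ⟨h.1.2, h.2, h.1.1.2.symm⟩
    · rintro ⟨h, h'', h'⟩
      refine ⟨⟨⟨⟨?_, ?_⟩, h'.symm⟩, h⟩, h''⟩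
      · rintro rfl; exact h' h
      · intro h2; rw [← h] at h2; exact h' (by rw [← σ.injective h2, h])
  simp_rw [and_assoc] at h1 ⊢
  simp_rw [h1, sum_ite_const_and, sum_ite_twoCycle]
  rw [← sum_ite_fixed σ, Finset.sum_mul]
  refine Finset.sum_congr rfl fun a _ => ?_
  split_ifs <;> simp

theorem sum_embedding_three_three_cycle :
    (∑ y : Fin 3 ↪ β, if σ (y 2) = y 0 ∧ σ (y 0) = y 1 ∧ σ (y 1) = y 2 then (1 : ℝ) else 0)
      = threeCycleNum σ := by
  rw [sum_embedding_fin_three (fun a b c => σ c = a ∧ σ a = b ∧ σ b = c)]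
  simp_rw [← and_assoc, sum_ite_and_eq]
  rw [← sum_ite_threeCycle]
  refine Finset.sum_congr rfl fun a _ => ?_
  congr 1
  rw [eq_iff_iff]
  constructor
  · rintro ⟨⟨⟨h1, h2⟩, h3⟩, h4⟩; exact ⟨h4, h1.symm⟩
  · rintro ⟨h1, h2⟩
    refine ⟨⟨⟨h2.symm, fun h => h2 ?_⟩, fun h => h2 (σ.injective h.symm)⟩, h1⟩
    rw [← h] at h1
    exact h1

end triples

theorem sum_embedding_fin_two (C : β → β → Prop) [∀ a b, Decidable (C a b)] :
    (∑ y : Fin 2 ↪ β, if C (y 0) (y 1) then (1 : ℝ) else 0)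
      = ∑ a, ∑ b, if a ≠ b ∧ C a b then (1 : ℝ) else 0 := by
  rw [← Fintype.sum_prod_type' (f := fun a b => if a ≠ b ∧ C a b then (1 : ℝ) else 0)]
  rw [Finset.sum_boole, Finset.sum_boole]
  congr 1
  apply Finset.card_bij (fun y _ => (y 0, y 1))
  · intro y hy
    simp only [Finset.mem_filter, Finset.mem_univ, true_and] at hy ⊢
    exact ⟨y.injective.ne (by decide), hy⟩
  · intro y _ y' _ h
    simp only [Prod.mk.injEq] at h
    ext i
    fin_cases i
    · exact h.1
    · exact h.2
  · rintro ⟨a, b⟩ h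
    simp only [Finset.mem_filter, Finset.mem_univ, true_and] at h
    refine ⟨⟨![a, b], ?_⟩, ?_, ?_⟩
    · intro i j hij
      fin_cases i <;> fin_cases j <;> simp_all [eq_comm]
    · simp only [Finset.mem_filter, Finset.mem_univ, true_and]
      exact h.2
    · rfl

section pairs

variable (σ : Perm β)

theorem sum_embedding_two_true :
    (∑ _y : Fin 2 ↪ β, (1 : ℝ)) = Fintype.card β * (Fintype.card β - 1) := by
  have h := sum_embedding_fin_two (β := β) (fun _ _ => True)
  simp only [if_true, and_true] at h
  rw [h]
  simp_rw [sum_ite_ne_one]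
  rw [Finset.sum_const, nsmul_eq_mul, Finset.card_univ]

theorem sum_embedding_two_fix :
    (∑ y : Fin 2 ↪ β, if σ (y 0) = y 0 then (1 : ℝ) else 0)
      = fixNum σ * (Fintype.card β - 1) := by
  rw [sum_embedding_fin_two (fun a _ => σ a = a)]
  have h1 : ∀ a b : β, (a ≠ b ∧ σ a = a) ↔ (σ a = a ∧ a ≠ b) := fun a b => and_comm
  simp_rw [h1, sum_ite_const_and, sum_ite_ne_one]
  rw [← sum_ite_fixed σ, Finset.sum_mul]
  refine Finset.sum_congr rfl fun a _ => ?_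
  split_ifs <;> simp

theorem sum_embedding_two_path :
    (∑ y : Fin 2 ↪ β, if σ (y 0) = y 1 then (1 : ℝ) else 0)
      = Fintype.card β - fixNum σ := by
  rw [sum_embedding_fin_two (fun a b => σ a = b)]
  simp_rw [sum_ite_and_eq, ← sum_ite_moved]
  simp only [ne_comm]

theorem sum_embedding_two_two_cycle :
    (∑ y : Fin 2 ↪ β, if σ (y 1) = y 0 ∧ σ (y 0) = y 1 then (1 : ℝ) else 0)
      = twoCycleNum σ := by
  rw [sum_embedding_fin_two (fun a b => σ b = a ∧ σ a = b)]
  simp_rw [← and_assoc, sum_ite_and_eq, ← sum_ite_twoCycle]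
  simp only [ne_comm, and_comm]

end pairs

end

/-- The number of unmatched points of a pattern, the numbers of compatible permutations by cycle
type, and the numbers of occurrences of the seven nonempty patterns. -/
def patternFeatures (p : Fin 3 → Option (Fin 3)) : List ℕ :=
  [(Finset.univ.filter fun i => p i = none).card,
   (Finset.univ.filter fun g : Perm (Fin 3) => (∀ i j, p i = some j → g i = j) ∧ g = 1).card,
   (Finset.univ.filter fun g : Perm (Fin 3) =>
      (∀ i j, p i = some j → g i = j) ∧ Perm.sign g = -1).card,
   (Finset.univ.filter fun g : Perm (Fin 3) =>
      (∀ i j, p i = some j → g i = j) ∧ g ≠ 1 ∧ Perm.sign g ≠ -1).card,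
   (Finset.univ.filter fun g : Perm (Fin 3) => p (g 0) = some (g 0)).card,
   (Finset.univ.filter fun g : Perm (Fin 3) => p (g 0) = some (g 1)).card,
   (Finset.univ.filter fun g : Perm (Fin 3) => p (g 0) = some (g 0) ∧ p (g 1) = some (g 2)).card,
   (Finset.univ.filter fun g : Perm (Fin 3) => p (g 1) = some (g 0) ∧ p (g 0) = some (g 1)).card,
   (Finset.univ.filter fun g : Perm (Fin 3) => p (g 0) = some (g 1) ∧ p (g 1) = some (g 2)).card,
   (Finset.univ.filter fun g : Perm (Fin 3) =>
      p (g 0) = some (g 0) ∧ p (g 2) = some (g 1) ∧ p (g 1) = some (g 2)).card,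
   (Finset.univ.filter fun g : Perm (Fin 3) =>
      p (g 2) = some (g 0) ∧ p (g 0) = some (g 1) ∧ p (g 1) = some (g 2)).card]

set_option maxRecDepth 100000 in
set_option maxHeartbeats 4000000 in
theorem patternFeatures_mem : ∀ p : Fin 3 → Option (Fin 3),
    (∀ i i' j, p i = some j → p i' = some j → i = i') →
    (∀ i j, p i = some i → p j = some j → i = j) →
    patternFeatures p = [3, 1, 3, 2, 0, 0, 0, 0, 0, 0, 0] ∨
    patternFeatures p = [2, 1, 1, 0, 2, 0, 0, 0, 0, 0, 0] ∨
    patternFeatures p = [2, 0, 1, 1, 0, 1, 0, 0, 0, 0, 0] ∨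
    patternFeatures p = [1, 0, 1, 0, 2, 1, 1, 0, 0, 0, 0] ∨
    patternFeatures p = [1, 0, 1, 0, 0, 2, 0, 2, 0, 0, 0] ∨
    patternFeatures p = [1, 0, 0, 1, 0, 2, 0, 0, 1, 0, 0] ∨
    patternFeatures p = [0, 0, 1, 0, 2, 2, 2, 2, 0, 2, 0] ∨
    patternFeatures p = [0, 0, 0, 1, 0, 3, 0, 0, 3, 0, 3] := by
  decide

/-- Coefficients expressing the values of a peeled function through pattern counts. -/
structure PatternCoeffs (m w u : ℝ) (a : Fin 8 → ℝ) : Prop where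
  points : a 0 = -(1 + 3 * w + 2 * u) / (m * (m - 1) * (m - 2))
  fix_points : a 0 + 2 * a 1 = (1 + w) / (m * (m - 1))
  path_point : a 0 + a 2 = (w + u) / (m * (m - 1))
  fix_path : a 0 + 2 * a 1 + a 2 + a 3 = -w / m
  two_cycle_point : a 0 + 2 * a 2 + 2 * a 4 = -w / m
  path : a 0 + 2 * a 2 + a 5 = -u / m
  fix_two_cycle : a 0 + 2 * a 1 + 2 * a 2 + 2 * a 3 + 2 * a 4 + 2 * a 6 = w
  three_cycle : a 0 + 3 * a 2 + 3 * a 5 + 3 * a 7 = u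

section

variable {β : Type} [DecidableEq β] [Fintype β]

theorem pattern_injective {k : ℕ} {σ : Perm β} {y : Fin k ↪ β} {i i' j : Fin k}
    (h : pattern σ y i = some j) (h' : pattern σ y i' = some j) : i = i' := by
  rw [pattern_eq_some] at h h'
  exact y.injective (σ.injective (h.trans h'.symm))

theorem pattern_fixed {k : ℕ} {σ : Perm β} (hf : fixNum σ ≤ 1) {y : Fin k ↪ β} {i j : Fin k}
    (h : pattern σ y i = some i) (h' : pattern σ y j = some j) : i = j := by
  rw [pattern_eq_some] at h h'
  rw [fixNum_eq_card, Finset.card_le_one] at hf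
  exact y.injective (hf _ (by simpa using h) _ (by simpa using h'))

theorem sum_sum_perm_embedding {k : ℕ} (f : (Fin k ↪ β) → ℝ) :
    ∑ y : Fin k ↪ β, ∑ g : Perm (Fin k), f (g.toEmbedding.trans y)
      = k.factorial * ∑ y, f y := by
  rw [Finset.sum_comm]
  have : ∀ g : Perm (Fin k), ∑ y : Fin k ↪ β, f (g.toEmbedding.trans y) = ∑ y, f y := by
    intro g
    have := Equiv.sum_comp (Equiv.embeddingCongr g.symm (Equiv.refl β)) f
    rw [← this]
    rfl
  simp [this, Fintype.card_perm]

theorem patternValue_three {m : ℕ} (hm : 3 ≤ m) {w : Perm (Fin 3) → ℝ} {w₂ w₃ : ℝ}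
    (hw : ∀ g, w g = if g = 1 then 1 else if Perm.sign g = -1 then w₂ else w₃) {a : Fin 8 → ℝ}
    (ha : PatternCoeffs m w₂ w₃ a) {p : Fin 3 → Option (Fin 3)}
    (h₁ : ∀ i i' j, p i = some j → p i' = some j → i = i')
    (h₂ : ∀ i j, p i = some i → p j = some j → i = j) :
    patternValue m w p = a 0
      + a 1 * (∑ g : Perm (Fin 3), if p (g 0) = some (g 0) then (1 : ℝ) else 0)
      + a 2 * (∑ g : Perm (Fin 3), if p (g 0) = some (g 1) then (1 : ℝ) else 0)
      + a 3 * (∑ g : Perm (Fin 3),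
          if p (g 0) = some (g 0) ∧ p (g 1) = some (g 2) then (1 : ℝ) else 0)
      + a 4 * (∑ g : Perm (Fin 3),
          if p (g 1) = some (g 0) ∧ p (g 0) = some (g 1) then (1 : ℝ) else 0)
      + a 5 * (∑ g : Perm (Fin 3),
          if p (g 0) = some (g 1) ∧ p (g 1) = some (g 2) then (1 : ℝ) else 0)
      + a 6 * (∑ g : Perm (Fin 3), if p (g 0) = some (g 0) ∧ p (g 2) = some (g 1)
          ∧ p (g 1) = some (g 2) then (1 : ℝ) else 0)
      + a 7 * (∑ g : Perm (Fin 3), if p (g 2) = some (g 0) ∧ p (g 0) = some (g 1)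
          ∧ p (g 1) = some (g 2) then (1 : ℝ) else 0) := by
  have hs : ∑ g ∈ Finset.univ.filter (fun g : Perm (Fin 3) => ∀ i j, p i = some j → g i = j), w g
      = (Finset.univ.filter fun g : Perm (Fin 3) =>
          (∀ i j, p i = some j → g i = j) ∧ g = 1).card
        + w₂ * (Finset.univ.filter fun g : Perm (Fin 3) =>
          (∀ i j, p i = some j → g i = j) ∧ Perm.sign g = -1).card
        + w₃ * (Finset.univ.filter fun g : Perm (Fin 3) =>
          (∀ i j, p i = some j → g i = j) ∧ g ≠ 1 ∧ Perm.sign g ≠ -1).card := by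
    rw [← Finset.sum_boole, ← Finset.sum_boole, ← Finset.sum_boole, Finset.mul_sum,
      Finset.mul_sum, ← Finset.sum_add_distrib, ← Finset.sum_add_distrib, Finset.sum_filter]
    refine Finset.sum_congr rfl fun g _ => ?_
    rw [hw]
    by_cases hg : g = 1
    · subst hg; simp
    · by_cases hg' : Perm.sign g = -1 <;> simp [hg, hg']
  rw [patternValue, hs]
  simp only [Finset.sum_boole]
  obtain ⟨e0, e1, e2, e3, e4, e5, e6, e7⟩ := ha
  have hm3 : (3 : ℝ) ≤ m := by exact_mod_cast hm
  obtain ⟨t, rfl⟩ : ∃ t, m = t + 3 := ⟨m - 3, by omega⟩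
  have hf : ((t + 3).factorial : ℝ) = (t + 3) * (t + 2) * (t + 1) * t.factorial := by
    rw [Nat.factorial_succ, Nat.factorial_succ, Nat.factorial_succ]; push_cast; ring
  have hf2 : ((t + 2).factorial : ℝ) = (t + 2) * (t + 1) * t.factorial := by
    rw [Nat.factorial_succ, Nat.factorial_succ]; push_cast; ring
  have hf1 : ((t + 1).factorial : ℝ) = (t + 1) * t.factorial := by
    rw [Nat.factorial_succ]; push_cast; ring
  have ht : (t.factorial : ℝ) ≠ 0 := by positivity
  push_cast at e0 e1 e2 e3 e4 e5 e6 e7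
  have q1 : (t : ℝ) + 3 - 1 = t + 2 := by ring
  have q2 : (t : ℝ) + 3 - 2 = t + 1 := by ring
  rw [q1] at e0 e1 e2
  rw [q2] at e0
  have hp := patternFeatures_mem p h₁ h₂
  simp only [patternFeatures, List.cons.injEq, and_true] at hp
  rcases hp with hp | hp | hp | hp | hp | hp | hp | hp <;>
    obtain ⟨f0, f1, f2, f3, f4, f5, f6, f7, f8, f9, f10⟩ := hp <;>
    rw [f0, f1, f2, f3, f4, f5, f6, f7, f8, f9, f10]
  · rw [show t + 3 - 3 = t by omega, hf]
    push_cast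
    rw [e0]
    field_simp
    ring
  · rw [show t + 3 - 2 = t + 1 by omega, hf, hf1]
    push_cast
    rw [show (1 : ℝ) + w₂ * 1 + w₃ * 0 = 1 + w₂ by ring]
    trans a 0 + 2 * a 1
    · rw [e1]; field_simp
    · ring
  · rw [show t + 3 - 2 = t + 1 by omega, hf, hf1]
    push_cast
    trans a 0 + a 2
    · rw [e2]; field_simp; ring
    · ring
  · rw [show t + 3 - 1 = t + 2 by omega, hf, hf2]
    push_cast
    trans a 0 + 2 * a 1 + a 2 + a 3
    · rw [e3]; field_simp; ring
    · ring
  · rw [show t + 3 - 1 = t + 2 by omega, hf, hf2]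
    push_cast
    trans a 0 + 2 * a 2 + 2 * a 4
    · rw [e4]; field_simp; ring
    · ring
  · rw [show t + 3 - 1 = t + 2 by omega, hf, hf2]
    push_cast
    trans a 0 + 2 * a 2 + a 5
    · rw [e5]; field_simp; ring
    · ring
  · rw [show t + 3 - 0 = t + 3 by omega, hf]
    push_cast
    trans a 0 + 2 * a 1 + 2 * a 2 + 2 * a 3 + 2 * a 4 + 2 * a 6
    · rw [e6]; field_simp; ring
    · ring
  · rw [show t + 3 - 0 = t + 3 by omega, hf]
    push_cast
    trans a 0 + 3 * a 2 + 3 * a 5 + 3 * a 7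
    · rw [e7]; field_simp; ring
    · ring

theorem IsPeel.classAvg_three {S : Finset β} {X : Perm β → ℝ} (hX : IsPeel S X)
    (hS : 3 ≤ S.card) (e : Fin 3 ≃ {a // a ∉ S}) {w₂ w₃ : ℝ}
    (hw : ∀ g : Perm (Fin 3), X (Perm.ofSubtype (e.permCongr g))
      = if g = 1 then 1 else if Perm.sign g = -1 then w₂ else w₃) {a : Fin 8 → ℝ}
    (ha : PatternCoeffs S.card w₂ w₃ a) {σ : Perm β} (hf : fixNum σ ≤ 1) {n f d₂ d₃ : ℝ}
    (hn : (Fintype.card β : ℝ) = n) (hf' : (fixNum σ : ℝ) = f) (hd₂ : (twoCycleNum σ : ℝ) = d₂)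
    (hd₃ : (threeCycleNum σ : ℝ) = d₃) :
    UnitaryRep.classAvg X σ = (a 0 * (n * (n - 1) * (n - 2)) + 6 * (a 1 * (f * (n - 1) * (n - 2))
      + a 2 * ((n - f) * (n - 2)) + a 3 * (f * (n - f)) + a 4 * (d₂ * (n - 2))
      + a 5 * (n - f - d₂) + a 6 * (f * d₂) + a 7 * d₃)) / (n * (n - 1) * (n - 2)) := by
  rw [hX.classAvg_eq_sum_embedding e hw]
  have hc : (Fintype.card (Fin 3 ↪ β) : ℝ) = n * (n - 1) * (n - 2) := by
    rw [← hn, ← sum_embedding_three_true, Finset.sum_const, Finset.card_univ, nsmul_one]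
  rw [hc]
  congr 1
  have hval : ∀ y : Fin 3 ↪ β, patternValue S.card
      (fun g => if g = 1 then 1 else if Perm.sign g = -1 then w₂ else w₃) (pattern σ y) = _ :=
    fun y => patternValue_three hS (fun g => rfl) ha (fun i i' j => pattern_injective)
      (fun i j => pattern_fixed hf)
  simp only [pattern_eq_some] at hval
  rw [Finset.sum_congr rfl fun y _ => hval y]
  have t1 := sum_sum_perm_embedding (β := β) (fun y : Fin 3 ↪ β =>
    if σ (y 0) = y 0 then (1 : ℝ) else 0)
  have t2 := sum_sum_perm_embedding (β := β) (fun y : Fin 3 ↪ β =>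
    if σ (y 0) = y 1 then (1 : ℝ) else 0)
  have t3 := sum_sum_perm_embedding (β := β) (fun y : Fin 3 ↪ β =>
    if σ (y 0) = y 0 ∧ σ (y 1) = y 2 then (1 : ℝ) else 0)
  have t4 := sum_sum_perm_embedding (β := β) (fun y : Fin 3 ↪ β =>
    if σ (y 1) = y 0 ∧ σ (y 0) = y 1 then (1 : ℝ) else 0)
  have t5 := sum_sum_perm_embedding (β := β) (fun y : Fin 3 ↪ β =>
    if σ (y 0) = y 1 ∧ σ (y 1) = y 2 then (1 : ℝ) else 0)
  have t6 := sum_sum_perm_embedding (β := β) (fun y : Fin 3 ↪ β =>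
    if σ (y 0) = y 0 ∧ σ (y 2) = y 1 ∧ σ (y 1) = y 2 then (1 : ℝ) else 0)
  have t7 := sum_sum_perm_embedding (β := β) (fun y : Fin 3 ↪ β =>
    if σ (y 2) = y 0 ∧ σ (y 0) = y 1 ∧ σ (y 1) = y 2 then (1 : ℝ) else 0)
  rw [sum_embedding_three_fix, hn, hf'] at t1
  rw [sum_embedding_three_path, hn, hf'] at t2
  rw [sum_embedding_three_fix_path, hn, hf'] at t3
  rw [sum_embedding_three_two_cycle, hn, hd₂] at t4
  rw [sum_embedding_three_path_path, hn, hf', hd₂] at t5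
  rw [sum_embedding_three_fix_two_cycle, hf', hd₂] at t6
  rw [sum_embedding_three_three_cycle, hd₃] at t7
  simp only [Function.Embedding.trans_apply, Equiv.coe_toEmbedding] at t1 t2 t3 t4 t5 t6 t7
  simp only [Finset.sum_add_distrib, ← Finset.mul_sum, t1, t2, t3, t4, t5, t6, t7]
  rw [Finset.sum_const, Finset.card_univ, nsmul_eq_mul, hc]
  norm_num [Nat.factorial]
  ring

end

theorem exists_patternCoeffs (m w u : ℝ) : ∃ a : Fin 8 → ℝ, PatternCoeffs m w u a ∧
    a 0 = -(1 + 3 * w + 2 * u) / (m * (m - 1) * (m - 2)) ∧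
    a 1 = ((1 + w) / (m * (m - 1)) - a 0) / 2 ∧
    a 2 = (w + u) / (m * (m - 1)) - a 0 ∧
    a 3 = -w / m - a 0 - 2 * a 1 - a 2 ∧
    a 4 = (-w / m - a 0 - 2 * a 2) / 2 ∧
    a 5 = -u / m - a 0 - 2 * a 2 ∧
    a 6 = (w - (a 0 + 2 * a 1 + 2 * a 2 + 2 * a 3 + 2 * a 4)) / 2 ∧
    a 7 = (u - (a 0 + 3 * a 2 + 3 * a 5)) / 3 := by
  let a0 := -(1 + 3 * w + 2 * u) / (m * (m - 1) * (m - 2))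
  let a1 := ((1 + w) / (m * (m - 1)) - a0) / 2
  let a2 := (w + u) / (m * (m - 1)) - a0
  let a3 := -w / m - a0 - 2 * a1 - a2
  let a4 := (-w / m - a0 - 2 * a2) / 2
  let a5 := -u / m - a0 - 2 * a2
  let a6 := (w - (a0 + 2 * a1 + 2 * a2 + 2 * a3 + 2 * a4)) / 2
  let a7 := (u - (a0 + 3 * a2 + 3 * a5)) / 3
  refine ⟨![a0, a1, a2, a3, a4, a5, a6, a7], ?_, rfl, rfl, rfl, rfl, rfl, rfl, rfl, rfl⟩
  constructor
  · rfl
  · change a0 + 2 * a1 = _; simp only [a1]; ring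
  · change a0 + a2 = _; simp only [a2]; ring
  · change a0 + 2 * a1 + a2 + a3 = _; simp only [a3]; ring
  · change a0 + 2 * a2 + 2 * a4 = _; simp only [a4]; ring
  · change a0 + 2 * a2 + a5 = _; simp only [a5]; ring
  · change a0 + 2 * a1 + 2 * a2 + 2 * a3 + 2 * a4 + 2 * a6 = _; simp only [a6]; ring
  · change a0 + 3 * a2 + 3 * a5 + 3 * a7 = _; simp only [a7]; ring

section

variable {β : Type} [DecidableEq β] [Fintype β]

theorem card_eq_of_equiv {S : Finset β} {k : ℕ} (e : Fin k ≃ {a // a ∉ S}) :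
    (Fintype.card β : ℝ) = S.card + k := by
  have := Fintype.card_congr e
  rw [Fintype.card_fin, Fintype.card_subtype_compl] at this
  simp only [Fintype.card_coe] at this
  have h2 := Finset.card_le_univ S
  norm_cast
  omega

theorem fixNum_eq_zero_or_one {σ : Perm β} (hf : fixNum σ ≤ 1) {c₁ : ℝ}
    (h₁ : (fixNum σ : ℝ) = c₁) : c₁ = 0 ∨ c₁ = 1 := by
  rw [← h₁]
  interval_cases h : fixNum σ <;> simp

theorem IsPeel.classAvg_three_triv {S : Finset β} {X : Perm β → ℝ} (hX : IsPeel S X)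
    (hS : 3 ≤ S.card) (e : Fin 3 ≃ {a // a ∉ S})
    (hw : ∀ g : Perm (Fin 3), X (Perm.ofSubtype (e.permCongr g))
      = if g = 1 then 1 else if Perm.sign g = -1 then 1 else 1) {σ : Perm β}
    (hf : fixNum σ ≤ 1) {n c₁ c₂ c₃ : ℝ} (hn : (Fintype.card β : ℝ) = n)
    (h₁ : (fixNum σ : ℝ) = c₁) (h₂ : (twoCycleNum σ : ℝ) = 2 * c₂)
    (h₃ : (threeCycleNum σ : ℝ) = 3 * c₃) :
    UnitaryRep.classAvg X σ = (c₁ * (c₁ - 1) * (c₁ - 5) / 6 + (c₁ - 1) * c₂ + c₃)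
      / (n * (n - 1) * (n - 5) / 6) := by
  obtain ⟨a, ha, a0, a1, a2, a3, a4, a5, a6, a7⟩ := exists_patternCoeffs S.card (1) (1)
  rw [hX.classAvg_three hS e hw ha hf hn h₁ h₂ h₃]
  have hm := card_eq_of_equiv e
  rw [hn] at hm
  have hm3 : (3 : ℝ) ≤ S.card := by exact_mod_cast hS
  have hc := fixNum_eq_zero_or_one hf h₁
  generalize (S.card : ℝ) = m at *
  clear hw ha
  push_cast at hm
  subst hm
  rw [a7, a6, a5, a4, a3, a2, a1, a0]
  clear a7 a6 a5 a4 a3 a2 a1 a0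
  have p0 : m ≠ 0 := by intro h; linarith
  have p1 : m - 1 ≠ 0 := by intro h; linarith
  have p2 : m - 2 ≠ 0 := by intro h; linarith
  have p3 : m + 3 ≠ 0 := by intro h; linarith
  have p4 : m + 2 ≠ 0 := by intro h; linarith
  have p5 : m + 1 ≠ 0 := by intro h; linarith
  rw [show m + 3 - 1 = m + 2 by ring, show m + 3 - 2 = m + 1 by ring, show m + 3 - 5 = m - 2 by
      ring]
  rcases hc with rfl | rfl
  · field_simp
    ring
  · field_simp
    ring

theorem IsPeel.classAvg_three_sign {S : Finset β} {X : Perm β → ℝ} (hX : IsPeel S X)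
    (hS : 3 ≤ S.card) (e : Fin 3 ≃ {a // a ∉ S})
    (hw : ∀ g : Perm (Fin 3), X (Perm.ofSubtype (e.permCongr g))
      = if g = 1 then 1 else if Perm.sign g = -1 then -1 else 1) {σ : Perm β}
    (hf : fixNum σ ≤ 1) {n c₁ c₂ c₃ : ℝ} (hn : (Fintype.card β : ℝ) = n)
    (h₁ : (fixNum σ : ℝ) = c₁) (h₂ : (twoCycleNum σ : ℝ) = 2 * c₂)
    (h₃ : (threeCycleNum σ : ℝ) = 3 * c₃) :
    UnitaryRep.classAvg X σ = ((c₁ - 1) * (c₁ - 2) * (c₁ - 3) / 6 - (c₁ - 1) * c₂ + c₃)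
      / ((n - 1) * (n - 2) * (n - 3) / 6) := by
  obtain ⟨a, ha, a0, a1, a2, a3, a4, a5, a6, a7⟩ := exists_patternCoeffs S.card (-1) (1)
  rw [hX.classAvg_three hS e hw ha hf hn h₁ h₂ h₃]
  have hm := card_eq_of_equiv e
  rw [hn] at hm
  have hm3 : (3 : ℝ) ≤ S.card := by exact_mod_cast hS
  have hc := fixNum_eq_zero_or_one hf h₁
  generalize (S.card : ℝ) = m at *
  clear hw ha
  push_cast at hm
  subst hm
  rw [a7, a6, a5, a4, a3, a2, a1, a0]
  clear a7 a6 a5 a4 a3 a2 a1 a0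
  have p0 : m ≠ 0 := by intro h; linarith
  have p1 : m - 1 ≠ 0 := by intro h; linarith
  have p2 : m - 2 ≠ 0 := by intro h; linarith
  have p3 : m + 3 ≠ 0 := by intro h; linarith
  have p4 : m + 2 ≠ 0 := by intro h; linarith
  have p5 : m + 1 ≠ 0 := by intro h; linarith
  rw [show m + 3 - 1 = m + 2 by ring, show m + 3 - 2 = m + 1 by ring, show m + 3 - 3 = m by ring]
  rcases hc with rfl | rfl
  · field_simp
    ring
  · field_simp
    ring

theorem IsPeel.classAvg_three_std {S : Finset β} {X : Perm β → ℝ} (hX : IsPeel S X)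
    (hS : 3 ≤ S.card) (e : Fin 3 ≃ {a // a ∉ S})
    (hw : ∀ g : Perm (Fin 3), X (Perm.ofSubtype (e.permCongr g))
      = if g = 1 then 1 else if Perm.sign g = -1 then 0 else -1 / 2) {σ : Perm β}
    (hf : fixNum σ ≤ 1) {n c₁ c₂ c₃ : ℝ} (hn : (Fintype.card β : ℝ) = n)
    (h₁ : (fixNum σ : ℝ) = c₁) (h₂ : (twoCycleNum σ : ℝ) = 2 * c₂)
    (h₃ : (threeCycleNum σ : ℝ) = 3 * c₃) :
    UnitaryRep.classAvg X σ = (c₁ * (c₁ - 2) * (c₁ - 4) / 3 - c₃)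
      / (n * (n - 2) * (n - 4) / 3) := by
  obtain ⟨a, ha, a0, a1, a2, a3, a4, a5, a6, a7⟩ := exists_patternCoeffs S.card (0) (-1 / 2)
  rw [hX.classAvg_three hS e hw ha hf hn h₁ h₂ h₃]
  have hm := card_eq_of_equiv e
  rw [hn] at hm
  have hm3 : (3 : ℝ) ≤ S.card := by exact_mod_cast hS
  have hc := fixNum_eq_zero_or_one hf h₁
  generalize (S.card : ℝ) = m at *
  clear hw ha
  push_cast at hm
  subst hm
  rw [a7, a6, a5, a4, a3, a2, a1, a0]
  clear a7 a6 a5 a4 a3 a2 a1 a0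
  have p0 : m ≠ 0 := by intro h; linarith
  have p1 : m - 1 ≠ 0 := by intro h; linarith
  have p2 : m - 2 ≠ 0 := by intro h; linarith
  have p3 : m + 3 ≠ 0 := by intro h; linarith
  have p4 : m + 2 ≠ 0 := by intro h; linarith
  have p5 : m + 1 ≠ 0 := by intro h; linarith
  rw [show m + 3 - 1 = m + 2 by ring, show m + 3 - 2 = m + 1 by ring, show m + 3 - 4 = m - 1 by
      ring]
  rcases hc with rfl | rfl
  · field_simp
    ring
  · field_simp
    ring

end

section

variable {β : Type} [DecidableEq β] [Fintype β]

/-- The number of unmatched points of a pattern, the numbers of compatible permutations, and the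
numbers of occurrences of the nonempty patterns. -/
def patternFeaturesTwo (p : Fin 2 → Option (Fin 2)) : List ℕ :=
  [(Finset.univ.filter fun i => p i = none).card,
   (Finset.univ.filter fun g : Perm (Fin 2) => (∀ i j, p i = some j → g i = j) ∧ g = 1).card,
   (Finset.univ.filter fun g : Perm (Fin 2) => (∀ i j, p i = some j → g i = j) ∧ g ≠ 1).card,
   (Finset.univ.filter fun g : Perm (Fin 2) => p (g 0) = some (g 0)).card,
   (Finset.univ.filter fun g : Perm (Fin 2) => p (g 0) = some (g 1)).card,
   (Finset.univ.filter fun g : Perm (Fin 2) => p (g 1) = some (g 0) ∧ p (g 0) = some (g 1)).card]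

set_option maxRecDepth 100000 in
theorem patternFeaturesTwo_mem : ∀ p : Fin 2 → Option (Fin 2),
    (∀ i i' j, p i = some j → p i' = some j → i = i') →
    (∀ i j, p i = some i → p j = some j → i = j) →
    patternFeaturesTwo p = [2, 1, 1, 0, 0, 0] ∨ patternFeaturesTwo p = [1, 1, 0, 1, 0, 0] ∨
    patternFeaturesTwo p = [1, 0, 1, 0, 1, 0] ∨ patternFeaturesTwo p = [0, 0, 1, 0, 2, 2] := by
  decide

theorem patternValue_two {m : ℕ} (hm : 2 ≤ m) {w : Perm (Fin 2) → ℝ} {w₂ : ℝ}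
    (hw : ∀ g, w g = if g = 1 then 1 else w₂) {p : Fin 2 → Option (Fin 2)}
    (h₁ : ∀ i i' j, p i = some j → p i' = some j → i = i')
    (h₂ : ∀ i j, p i = some i → p j = some j → i = j) {a₀ : ℝ}
    (ha : a₀ = (1 + w₂) / (m * (m - 1))) :
    patternValue m w p = a₀
      + (-1 / m - a₀) * (∑ g : Perm (Fin 2), if p (g 0) = some (g 0) then (1 : ℝ) else 0)
      + (-w₂ / m - a₀) * (∑ g : Perm (Fin 2), if p (g 0) = some (g 1) then (1 : ℝ) else 0)
      + (w₂ + 2 * w₂ / m + a₀) / 2 * (∑ g : Perm (Fin 2),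
          if p (g 1) = some (g 0) ∧ p (g 0) = some (g 1) then (1 : ℝ) else 0) := by
  have hs : ∑ g ∈ Finset.univ.filter (fun g : Perm (Fin 2) => ∀ i j, p i = some j → g i = j), w g
      = (Finset.univ.filter fun g : Perm (Fin 2) =>
          (∀ i j, p i = some j → g i = j) ∧ g = 1).card
        + w₂ * (Finset.univ.filter fun g : Perm (Fin 2) =>
          (∀ i j, p i = some j → g i = j) ∧ g ≠ 1).card := by
    rw [← Finset.sum_boole, ← Finset.sum_boole, Finset.mul_sum, ← Finset.sum_add_distrib,
      Finset.sum_filter]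
    refine Finset.sum_congr rfl fun g _ => ?_
    rw [hw]
    by_cases hg : g = 1 <;> simp [hg]
  rw [patternValue, hs]
  simp only [Finset.sum_boole]
  have hm3 : (2 : ℝ) ≤ m := by exact_mod_cast hm
  obtain ⟨t, rfl⟩ : ∃ t, m = t + 2 := ⟨m - 2, by omega⟩
  have hf : ((t + 2).factorial : ℝ) = (t + 2) * (t + 1) * t.factorial := by
    rw [Nat.factorial_succ, Nat.factorial_succ]; push_cast; ring
  have hf1 : ((t + 1).factorial : ℝ) = (t + 1) * t.factorial := by
    rw [Nat.factorial_succ]; push_cast; ring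
  have ht : (t.factorial : ℝ) ≠ 0 := by positivity
  push_cast at ha ⊢
  have q1 : (t : ℝ) + 2 - 1 = t + 1 := by ring
  rw [q1] at ha
  have hp := patternFeaturesTwo_mem p h₁ h₂
  simp only [patternFeaturesTwo, List.cons.injEq, and_true] at hp
  rcases hp with hp | hp | hp | hp <;>
    obtain ⟨f0, f1, f2, f3, f4, f5⟩ := hp <;>
    rw [f0, f1, f2, f3, f4, f5]
  · rw [show t + 2 - 2 = t by omega, hf, ha]
    push_cast
    field_simp
    ring
  · rw [show t + 2 - 1 = t + 1 by omega, hf, hf1]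
    push_cast
    field_simp
    ring
  · rw [show t + 2 - 1 = t + 1 by omega, hf, hf1]
    push_cast
    field_simp
    ring
  · rw [show t + 2 - 0 = t + 2 by omega, hf]
    push_cast
    field_simp
    ring

theorem IsPeel.classAvg_two {S : Finset β} {X : Perm β → ℝ} (hX : IsPeel S X)
    (hS : 2 ≤ S.card) (e : Fin 2 ≃ {a // a ∉ S}) {w₂ : ℝ}
    (hw : ∀ g : Perm (Fin 2), X (Perm.ofSubtype (e.permCongr g)) = if g = 1 then 1 else w₂)
    {σ : Perm β} (hf : fixNum σ ≤ 1) {n f d₂ a₀ : ℝ}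
    (hn : (Fintype.card β : ℝ) = n) (hf' : (fixNum σ : ℝ) = f) (hd₂ : (twoCycleNum σ : ℝ) = d₂)
    (ha : a₀ = (1 + w₂) / (S.card * (S.card - 1))) :
    UnitaryRep.classAvg X σ = (a₀ * (n * (n - 1)) + 2 * ((-1 / S.card - a₀) * (f * (n - 1))
      + (-w₂ / S.card - a₀) * (n - f) + (w₂ + 2 * w₂ / S.card + a₀) / 2 * d₂))
        / (n * (n - 1)) := by
  rw [hX.classAvg_eq_sum_embedding e hw]
  have hc : (Fintype.card (Fin 2 ↪ β) : ℝ) = n * (n - 1) := by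
    rw [← hn, ← sum_embedding_two_true, Finset.sum_const, Finset.card_univ, nsmul_one]
  rw [hc]
  congr 1
  have hval : ∀ y : Fin 2 ↪ β, patternValue S.card
      (fun g => if g = 1 then 1 else w₂) (pattern σ y) = _ :=
    fun y => patternValue_two hS (fun g => rfl) (fun i i' j => pattern_injective)
      (fun i j => pattern_fixed hf) ha
  simp only [pattern_eq_some] at hval
  rw [Finset.sum_congr rfl fun y _ => hval y]
  have t1 := sum_sum_perm_embedding (β := β) (fun y : Fin 2 ↪ β =>
    if σ (y 0) = y 0 then (1 : ℝ) else 0)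
  have t2 := sum_sum_perm_embedding (β := β) (fun y : Fin 2 ↪ β =>
    if σ (y 0) = y 1 then (1 : ℝ) else 0)
  have t3 := sum_sum_perm_embedding (β := β) (fun y : Fin 2 ↪ β =>
    if σ (y 1) = y 0 ∧ σ (y 0) = y 1 then (1 : ℝ) else 0)
  rw [sum_embedding_two_fix, hn, hf'] at t1
  rw [sum_embedding_two_path, hn, hf'] at t2
  rw [sum_embedding_two_two_cycle, hd₂] at t3
  simp only [Function.Embedding.trans_apply, Equiv.coe_toEmbedding] at t1 t2 t3
  simp only [Finset.sum_add_distrib, ← Finset.mul_sum, t1, t2, t3]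
  rw [Finset.sum_const, Finset.card_univ, nsmul_eq_mul, hc]
  norm_num [Nat.factorial]
  ring

theorem IsPeel.classAvg_two_triv {S : Finset β} {X : Perm β → ℝ} (hX : IsPeel S X)
    (hS : 2 ≤ S.card) (e : Fin 2 ≃ {a // a ∉ S})
    (hw : ∀ g : Perm (Fin 2), X (Perm.ofSubtype (e.permCongr g)) = if g = 1 then 1 else 1)
    {σ : Perm β} (hf : fixNum σ ≤ 1) {n c₁ c₂ : ℝ} (hn : (Fintype.card β : ℝ) = n)
    (h₁ : (fixNum σ : ℝ) = c₁) (h₂ : (twoCycleNum σ : ℝ) = 2 * c₂) :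
    UnitaryRep.classAvg X σ = (c₁ * (c₁ - 3) / 2 + c₂)
      / (n * (n - 3) / 2) := by
  rw [hX.classAvg_two hS e hw hf hn h₁ h₂ rfl]
  have hm := card_eq_of_equiv e
  rw [hn] at hm
  have hm3 : (2 : ℝ) ≤ S.card := by exact_mod_cast hS
  have hc := fixNum_eq_zero_or_one hf h₁
  generalize (S.card : ℝ) = m at *
  clear hw
  push_cast at hm
  subst hm
  have p0 : m ≠ 0 := by intro h; linarith
  have p1 : m - 1 ≠ 0 := by intro h; linarith
  have p3 : m + 2 ≠ 0 := by intro h; linarith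
  have p4 : m + 1 ≠ 0 := by intro h; linarith
  rw [show m + 2 - 1 = m + 1 by ring, show m + 2 - 3 = m - 1 by ring]
  rcases hc with rfl | rfl
  · field_simp
    ring
  · field_simp
    ring

theorem IsPeel.classAvg_two_sign {S : Finset β} {X : Perm β → ℝ} (hX : IsPeel S X)
    (hS : 2 ≤ S.card) (e : Fin 2 ≃ {a // a ∉ S})
    (hw : ∀ g : Perm (Fin 2), X (Perm.ofSubtype (e.permCongr g)) = if g = 1 then 1 else -1)
    {σ : Perm β} (hf : fixNum σ ≤ 1) {n c₁ c₂ : ℝ} (hn : (Fintype.card β : ℝ) = n)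
    (h₁ : (fixNum σ : ℝ) = c₁) (h₂ : (twoCycleNum σ : ℝ) = 2 * c₂) :
    UnitaryRep.classAvg X σ = ((c₁ - 1) * (c₁ - 2) / 2 - c₂)
      / ((n - 1) * (n - 2) / 2) := by
  rw [hX.classAvg_two hS e hw hf hn h₁ h₂ rfl]
  have hm := card_eq_of_equiv e
  rw [hn] at hm
  have hm3 : (2 : ℝ) ≤ S.card := by exact_mod_cast hS
  have hc := fixNum_eq_zero_or_one hf h₁
  generalize (S.card : ℝ) = m at *
  clear hw
  push_cast at hm
  subst hm
  have p0 : m ≠ 0 := by intro h; linarith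
  have p1 : m - 1 ≠ 0 := by intro h; linarith
  have p3 : m + 2 ≠ 0 := by intro h; linarith
  have p4 : m + 1 ≠ 0 := by intro h; linarith
  rw [show m + 2 - 1 = m + 1 by ring, show m + 2 - 2 = m by ring]
  rcases hc with rfl | rfl
  · field_simp
    ring
  · field_simp
    ring

theorem sum_embedding_fin_one (F : β → ℝ) : ∑ y : Fin 1 ↪ β, F (y 0) = ∑ a, F a := by
  apply Fintype.sum_bijective (fun y : Fin 1 ↪ β => y 0) _ _ _ fun _ => rfl
  constructor
  · intro y y' h
    ext i
    rw [Subsingleton.elim i 0]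
    exact h
  · intro a
    exact ⟨⟨fun _ => a, fun i j _ => Subsingleton.elim i j⟩, rfl⟩

theorem IsPeel.classAvg_one {S : Finset β} {X : Perm β → ℝ} (hX : IsPeel S X)
    (hS : 1 ≤ S.card) (e : Fin 1 ≃ {a // a ∉ S}) (hX1 : X 1 = 1) {σ : Perm β} :
    UnitaryRep.classAvg X σ = ((fixNum σ : ℝ) - 1) / (Fintype.card β - 1) := by
  have hw : ∀ g : Perm (Fin 1), X (Perm.ofSubtype (e.permCongr g)) = (fun _ => (1 : ℝ)) g := by
    intro g
    rw [Subsingleton.elim g 1]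
    have : e.permCongr (1 : Perm (Fin 1)) = 1 := by ext a; simp
    rw [this, map_one, hX1]
  rw [hX.classAvg_eq_sum_embedding e hw]
  have hm := card_eq_of_equiv e
  have hm1 : (1 : ℝ) ≤ S.card := by exact_mod_cast hS
  have hc : (Fintype.card (Fin 1 ↪ β) : ℝ) = S.card + 1 := by
    have := sum_embedding_fin_one (β := β) (fun _ => 1)
    rw [Finset.sum_const, Finset.sum_const, Finset.card_univ, Finset.card_univ, nsmul_one,
      nsmul_one] at this
    rw [this, hm]; simp
  have hval : ∀ y : Fin 1 ↪ β, patternValue S.card (fun _ => (1 : ℝ)) (pattern σ y)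
      = (fun a => if σ a = a then (1 : ℝ) else -1 / S.card) (y 0) := by
    intro y
    rw [patternValue]
    have hc1 : ∀ g : Perm (Fin 1), ∀ i j, pattern σ y i = some j → g i = j :=
      fun g i j _ => Subsingleton.elim _ _
    rw [Finset.filter_true_of_mem fun g _ => hc1 g]
    obtain ⟨t, ht⟩ : ∃ t, S.card = t + 1 := ⟨S.card - 1, by omega⟩
    have hf : ((t + 1).factorial : ℝ) = (t + 1) * t.factorial := by
      rw [Nat.factorial_succ]; push_cast; ring
    by_cases h : σ (y 0) = y 0
    · have : pattern σ y 0 = some 0 := pattern_eq_some.2 h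
      simp [Finset.filter_singleton, this, h, div_self (show (S.card.factorial : ℝ) ≠ 0 by
          positivity)]
    · have : pattern σ y 0 = none := by
        rw [pattern_eq_none]; intro j; rw [Subsingleton.elim j 0]; exact h
      simp [Finset.filter_singleton, this, h, ht, hf]
      field_simp
  rw [Finset.sum_congr rfl fun y _ => hval y,
    sum_embedding_fin_one (fun a => if σ a = a then (1 : ℝ) else -1 / S.card), hc]
  have : ∀ a, (if σ a = a then (1 : ℝ) else -1 / S.card)
      = (1 + 1 / S.card) * (if σ a = a then (1 : ℝ) else 0) - 1 / S.card := by
    intro a; split_ifs <;> ring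
  simp_rw [this]
  rw [Finset.sum_sub_distrib, ← Finset.mul_sum, sum_ite_fixed, Finset.sum_const, Finset.card_univ,
    nsmul_eq_mul, hm]
  push_cast
  have p1 : (S.card : ℝ) ≠ 0 := by positivity
  rw [add_sub_cancel_right]
  field_simp

end

namespace UnitaryRep

variable {β : Type} [DecidableEq β] [Fintype β] {V : Type*} [AddCommGroup V] [Module ℝ V]

theorem classAvg_coeff_one (U : UnitaryRep β V) (v : V) : classAvg (U.coeff v) 1 = U.B v v := by
  simp [classAvg, coeff]

theorem classAvg_of_mem_sym_univ (U : UnitaryRep β V) {v : V} (hv : v ∈ U.sym Finset.univ)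
    (h1 : U.B v v = 1) (σ : Perm β) : classAvg (U.coeff v) σ = 1 := by
  have : ∀ π, U.coeff v π = 1 := fun π => by
    rw [coeff, hv.2 π fun a ha => absurd (Finset.mem_univ a) ha, h1]
  simp [classAvg, this]

theorem classAvg_of_mem_twist_sym_univ (U : UnitaryRep β V) {v : V}
    (hv : v ∈ U.twist.sym Finset.univ) (h1 : U.B v v = 1) (σ : Perm β) :
    classAvg (U.coeff v) σ = ((Perm.sign σ : ℤ) : ℝ) := by
  have h := U.twist.classAvg_of_mem_sym_univ hv h1 σ
  rw [classAvg_twist] at h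
  have h2 := sign_mul_self σ
  calc classAvg (U.coeff v) σ
      = ((Perm.sign σ : ℤ) : ℝ) * ((Perm.sign σ : ℤ) : ℝ) * classAvg (U.coeff v) σ := by
        rw [h2, one_mul]
    _ = _ := by rw [mul_assoc, h, mul_one]

theorem sum_coeff_eq_zero (U : UnitaryRep β V) (h : U.sym Finset.univ = ⊥) {v : V}
    (hv : v ∈ U.W) : ∑ g, U.coeff v g = 0 := by
  have hm : ∑ g, U.ρ g v ∈ U.sym Finset.univ := by
    refine ⟨U.W.sum_mem fun g _ => U.stable g v hv, fun τ _ => ?_⟩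
    rw [map_sum]
    simp only [← Module.End.mul_apply, ← map_mul]
    exact Equiv.sum_comp (Equiv.mulLeft τ) fun g => U.ρ g v
  rw [h, Submodule.mem_bot] at hm
  have := congrArg (U.B v) hm
  simpa [coeff] using this

theorem sum_classAvg (x : Perm β → ℝ) : ∑ g, classAvg x g = ∑ g, x g := by
  simp only [classAvg]
  rw [← Finset.sum_div, Finset.sum_comm]
  have : ∀ h : Perm β, ∑ g, x (h * g * h⁻¹) = ∑ g, x g := fun h =>
    (MulAut.conj h).toEquiv.sum_comp x
  simp only [this, Finset.sum_const, Finset.card_univ, nsmul_eq_mul]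
  rw [mul_div_cancel_left₀]
  exact_mod_cast Fintype.card_ne_zero

theorem sum_classAvg_eq_zero (U : UnitaryRep β V) (h : U.sym Finset.univ = ⊥) {v : V}
    (hv : v ∈ U.W) {k : ℕ} (e : Fin k ≃ β) :
    ∑ g : Perm (Fin k), classAvg (U.coeff v) (e.permCongr g) = 0 := by
  rw [e.permCongr.sum_comp fun g => classAvg (U.coeff v) g, sum_classAvg,
    U.sum_coeff_eq_zero h hv]

theorem sum_sign_mul_classAvg_eq_zero (U : UnitaryRep β V) (h : U.twist.sym Finset.univ = ⊥)
    {v : V} (hv : v ∈ U.W) {k : ℕ} (e : Fin k ≃ β) :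
    ∑ g : Perm (Fin k), ((Perm.sign g : ℤ) : ℝ) * classAvg (U.coeff v) (e.permCongr g) = 0 := by
  have := U.twist.sum_classAvg_eq_zero h hv e
  simpa only [classAvg_twist, Perm.sign_permCongr] using this

theorem classAvg_permCongr_conj (x : Perm β → ℝ) {k : ℕ} (e : Fin k ≃ β) (h g : Perm (Fin k)) :
    classAvg x (e.permCongr (h * g * h⁻¹)) = classAvg x (e.permCongr g) := by
  have : e.permCongr (h * g * h⁻¹) = e.permCongr h * e.permCongr g * (e.permCongr h)⁻¹ := by
    ext a
    change e (h (g (h.symm (e.symm a))))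
      = e (h (e.symm (e (g (e.symm (e (h.symm (e.symm a))))))))
    simp only [Equiv.symm_apply_apply]
  rw [this, classAvg_conj]

theorem classAvg_permCongr_one (U : UnitaryRep β V) {v : V} (h1 : U.B v v = 1) {k : ℕ}
    (e : Fin k ≃ β) : classAvg (U.coeff v) (e.permCongr 1) = 1 := by
  have : e.permCongr (1 : Perm (Fin k)) = 1 := by ext a; simp
  rw [this, classAvg_coeff_one, h1]

theorem exists_classAvg_two (U : UnitaryRep β V) (e : Fin 2 ≃ β) :
    ∃ v ∈ U.W, U.B v v = 1 ∧
      ((∀ g : Perm (Fin 2), classAvg (U.coeff v) (e.permCongr g) = if g = 1 then 1 else 1) ∨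
        ∀ g : Perm (Fin 2), classAvg (U.coeff v) (e.permCongr g) = if g = 1 then 1 else -1) := by
  by_cases h : U.sym Finset.univ = ⊥
  · obtain ⟨v, hv, h1⟩ := U.exists_unit U.ne_bot
    refine ⟨v, hv, h1, Or.inr ?_⟩
    have hs := U.sum_classAvg_eq_zero h hv e
    have hu : (Finset.univ : Finset (Perm (Fin 2))) = {1, swap 0 1} := by decide
    have h01 : (1 : Perm (Fin 2)) ≠ swap 0 1 := by decide
    rw [hu, Finset.sum_pair h01, U.classAvg_permCongr_one h1] at hs
    intro g
    have hg : ∀ g : Perm (Fin 2), g = 1 ∨ g = swap 0 1 := by decide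
    rcases hg g with rfl | rfl
    · simp [U.classAvg_permCongr_one h1]
    · rw [if_neg h01.symm]; linarith
  · obtain ⟨v, hv, h1⟩ := U.exists_unit h
    exact ⟨v, hv.1, h1, Or.inl fun g => by simp [U.classAvg_of_mem_sym_univ hv h1]⟩

set_option maxRecDepth 100000 in
set_option maxHeartbeats 1000000 in
theorem perm_fin_three_cases : ∀ g : Perm (Fin 3), g = 1 ∨
    (g ≠ 1 ∧ Perm.sign g = -1 ∧ ∃ h : Perm (Fin 3), g = h * swap 0 1 * h⁻¹) ∨
    (g ≠ 1 ∧ Perm.sign g = 1 ∧ ∃ h : Perm (Fin 3), g = h * finRotate 3 * h⁻¹) := by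
  decide

set_option maxRecDepth 100000 in
theorem sum_perm_fin_three (w u : ℝ) : ∑ g : Perm (Fin 3),
    (if g = 1 then 1 else if Perm.sign g = -1 then w else u) = 1 + 3 * w + 2 * u := by
  rw [Finset.sum_ite, Finset.sum_ite]
  simp only [Finset.sum_const, nsmul_eq_mul]
  have h1 : (Finset.univ.filter fun g : Perm (Fin 3) => g = 1).card = 1 := by decide
  have h2 : ((Finset.univ.filter fun g : Perm (Fin 3) => ¬ g = 1).filter
    fun g => Perm.sign g = -1).card = 3 := by decide
  have h3 : ((Finset.univ.filter fun g : Perm (Fin 3) => ¬ g = 1).filter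
    fun g => ¬ Perm.sign g = -1).card = 2 := by decide
  rw [h1, h2, h3]
  push_cast
  ring

theorem exists_classAvg_three (U : UnitaryRep β V) (e : Fin 3 ≃ β) :
    ∃ v ∈ U.W, U.B v v = 1 ∧
      ((∀ g : Perm (Fin 3), classAvg (U.coeff v) (e.permCongr g)
          = if g = 1 then 1 else if Perm.sign g = -1 then 1 else 1) ∨
        (∀ g : Perm (Fin 3), classAvg (U.coeff v) (e.permCongr g)
          = if g = 1 then 1 else if Perm.sign g = -1 then -1 else 1) ∨
        ∀ g : Perm (Fin 3), classAvg (U.coeff v) (e.permCongr g)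
          = if g = 1 then 1 else if Perm.sign g = -1 then 0 else -1 / 2) := by
  by_cases h : U.sym Finset.univ = ⊥
  · by_cases h' : U.twist.sym Finset.univ = ⊥
    · obtain ⟨v, hv, h1⟩ := U.exists_unit U.ne_bot
      refine ⟨v, hv, h1, Or.inr (Or.inr ?_)⟩
      have hs := U.sum_classAvg_eq_zero h hv e
      have hs' := U.sum_sign_mul_classAvg_eq_zero h' hv e
      have hz : ∀ g : Perm (Fin 3), classAvg (U.coeff v) (e.permCongr g)
          = if g = 1 then 1 else if Perm.sign g = -1
            then classAvg (U.coeff v) (e.permCongr (swap 0 1))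
            else classAvg (U.coeff v) (e.permCongr (finRotate 3)) := by
        intro g
        rcases perm_fin_three_cases g with rfl | ⟨hg, hg', κ, hκ⟩ | ⟨hg, hg', κ, hκ⟩
        · rw [if_pos rfl, U.classAvg_permCongr_one h1]
        · rw [if_neg hg, if_pos hg', hκ, classAvg_permCongr_conj]
        · rw [if_neg hg, if_neg (by rw [hg']; decide), hκ, classAvg_permCongr_conj]
      generalize classAvg (U.coeff v) (e.permCongr (swap 0 1)) = w at hz
      generalize classAvg (U.coeff v) (e.permCongr (finRotate 3)) = u at hz
      simp only [hz] at hs hs'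
      rw [sum_perm_fin_three] at hs
      have hs'' : ∑ g : Perm (Fin 3), ((Perm.sign g : ℤ) : ℝ)
          * (if g = 1 then 1 else if Perm.sign g = -1 then w else u) = 1 + 3 * (-w) + 2 * u := by
        rw [← sum_perm_fin_three]
        refine Finset.sum_congr rfl fun g _ => ?_
        rcases perm_fin_three_cases g with rfl | ⟨hg, hg', -⟩ | ⟨hg, hg', -⟩
        · simp
        · simp [hg, hg']
        · simp [hg, hg']
      rw [hs''] at hs'
      have hw : w = 0 := by linarith
      have hu : u = -1 / 2 := by linarith
      subst hw hu
      exact hz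
    · obtain ⟨v, hv, h1⟩ := U.exists_unit h'
      refine ⟨v, hv.1, h1, Or.inr (Or.inl fun g => ?_)⟩
      rw [U.classAvg_of_mem_twist_sym_univ hv h1, Perm.sign_permCongr]
      rcases perm_fin_three_cases g with rfl | ⟨hg, hg', -⟩ | ⟨hg, hg', -⟩
      · simp
      · simp [hg, hg']
      · simp [hg, hg']
  · obtain ⟨v, hv, h1⟩ := U.exists_unit h
    exact ⟨v, hv.1, h1, Or.inl fun g => by simp [U.classAvg_of_mem_sym_univ hv h1]⟩

theorem exists_equiv_of_card {S : Finset β} {k : ℕ} (hk : S.card + k = Fintype.card β) :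
    Nonempty (Fin k ≃ {a // a ∉ S}) := by
  refine ⟨(Fintype.equivFinOfCardEq ?_).symm⟩
  rw [Fintype.card_subtype_compl, Fintype.card_coe]
  omega

section Levels

variable (U : UnitaryRep β V) {S : Finset β} {σ : Perm β}

theorem isPeel_fixAvg (hS : U.sym S ≠ ⊥)
    (hmax : ∀ S' : Finset β, S.card < S'.card → U.sym S' = ⊥)
    {v : V} (hv : v ∈ (U.restrict S hS).W) :
    IsPeel S (fixAvg S (U.coeff v)) :=
  (U.isPeel_of_max hv hmax).fixAvg

theorem exists_classAvg_of_one (hS : U.sym S ≠ ⊥)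
    (hmax : ∀ S' : Finset β, S.card < S'.card → U.sym S' = ⊥)
    (hk : S.card + 1 = Fintype.card β) (hm : 1 ≤ S.card) :
    ∃ v ∈ U.W, U.B v v = 1 ∧
      classAvg (U.coeff v) σ = ((fixNum σ : ℝ) - 1) / (Fintype.card β - 1) := by
  obtain ⟨e⟩ := exists_equiv_of_card hk
  obtain ⟨v, hv, h1⟩ := U.exists_unit hS
  refine ⟨v, hv.1, h1, ?_⟩
  rw [← classAvg_fixAvg S]
  refine (U.isPeel_fixAvg hS hmax hv).classAvg_one hm e ?_
  have := U.fixAvg_ofSubtype S hS v 1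
  rw [map_one] at this
  rw [this, classAvg_coeff_one]
  exact h1

theorem exists_classAvg_of_two (hS : U.sym S ≠ ⊥)
    (hmax : ∀ S' : Finset β, S.card < S'.card → U.sym S' = ⊥)
    (hk : S.card + 2 = Fintype.card β) (hm : 2 ≤ S.card)
    (hf : fixNum σ ≤ 1) {n c₁ c₂ : ℝ} (hn : (Fintype.card β : ℝ) = n)
    (h₁ : (fixNum σ : ℝ) = c₁) (h₂ : (twoCycleNum σ : ℝ) = 2 * c₂) :
    ∃ v ∈ U.W, U.B v v = 1 ∧
      (classAvg (U.coeff v) σ = (c₁ * (c₁ - 3) / 2 + c₂) / (n * (n - 3) / 2) ∨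
        classAvg (U.coeff v) σ = ((c₁ - 1) * (c₁ - 2) / 2 - c₂) / ((n - 1) * (n - 2) / 2)) := by
  obtain ⟨e⟩ := exists_equiv_of_card hk
  obtain ⟨v, hv, h1, h⟩ := (U.restrict S hS).exists_classAvg_two e
  refine ⟨v, hv.1, h1, ?_⟩
  rw [← classAvg_fixAvg S]
  simp only [← fixAvg_ofSubtype] at h
  have hX := U.isPeel_fixAvg hS hmax hv
  rcases h with h | h
  · exact Or.inl (hX.classAvg_two_triv hm e h hf hn h₁ h₂)
  · exact Or.inr (hX.classAvg_two_sign hm e h hf hn h₁ h₂)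

theorem exists_classAvg_of_three (hS : U.sym S ≠ ⊥)
    (hmax : ∀ S' : Finset β, S.card < S'.card → U.sym S' = ⊥)
    (hk : S.card + 3 = Fintype.card β) (hm : 3 ≤ S.card)
    (hf : fixNum σ ≤ 1) {n c₁ c₂ c₃ : ℝ} (hn : (Fintype.card β : ℝ) = n)
    (h₁ : (fixNum σ : ℝ) = c₁) (h₂ : (twoCycleNum σ : ℝ) = 2 * c₂)
    (h₃ : (threeCycleNum σ : ℝ) = 3 * c₃) :
    ∃ v ∈ U.W, U.B v v = 1 ∧
      (classAvg (U.coeff v) σ = (c₁ * (c₁ - 1) * (c₁ - 5) / 6 + (c₁ - 1) * c₂ + c₃)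
          / (n * (n - 1) * (n - 5) / 6) ∨
        classAvg (U.coeff v) σ = ((c₁ - 1) * (c₁ - 2) * (c₁ - 3) / 6 - (c₁ - 1) * c₂ + c₃)
          / ((n - 1) * (n - 2) * (n - 3) / 6) ∨
        classAvg (U.coeff v) σ = (c₁ * (c₁ - 2) * (c₁ - 4) / 3 - c₃)
          / (n * (n - 2) * (n - 4) / 3)) := by
  obtain ⟨e⟩ := exists_equiv_of_card hk
  obtain ⟨v, hv, h1, h⟩ := (U.restrict S hS).exists_classAvg_three e
  refine ⟨v, hv.1, h1, ?_⟩
  rw [← classAvg_fixAvg S]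
  simp only [← fixAvg_ofSubtype] at h
  have hX := U.isPeel_fixAvg hS hmax hv
  rcases h with h | h | h
  · exact Or.inl (hX.classAvg_three_triv hm e h hf hn h₁ h₂ h₃)
  · exact Or.inr (Or.inl (hX.classAvg_three_sign hm e h hf hn h₁ h₂ h₃))
  · exact Or.inr (Or.inr (hX.classAvg_three_std hm e h hf hn h₁ h₂ h₃))

end Levels

end UnitaryRep

section

variable {β : Type} [DecidableEq β] [Fintype β]

theorem card_support_cycleOf_eq_prime_iff {p : ℕ} [hp : Fact p.Prime] (σ : Perm β) {a : β}
    (ha : σ a ≠ a) : (σ.cycleOf a).support.card = p ↔ (σ ^ p) a = a := by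
  have hc : (σ.cycleOf a).IsCycle := Perm.isCycle_cycleOf σ ha
  have ha' : σ.cycleOf a a ≠ a := by rwa [Perm.cycleOf_apply_self]
  rw [← hc.orderOf, ← Perm.cycleOf_pow_apply_self, ← hc.pow_eq_one_iff' ha']
  constructor
  · intro h; rw [← h]; exact pow_orderOf_eq_one _
  · intro h; exact orderOf_eq_prime h hc.ne_one

theorem card_pow_prime_fixed {p : ℕ} [hp : Fact p.Prime] (σ : Perm β) :
    (Finset.univ.filter fun a => (σ ^ p) a = a ∧ σ a ≠ a).card = p * σ.cycleType.count p := by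
  have h1 : (Finset.univ.filter fun a => (σ ^ p) a = a ∧ σ a ≠ a)
      = (σ.cycleFactorsFinset.filter fun c => c.support.card = p).biUnion Perm.support := by
    ext a
    simp only [Finset.mem_filter, Finset.mem_univ, true_and, Finset.mem_biUnion]
    constructor
    · rintro ⟨h, ha⟩
      refine ⟨σ.cycleOf a, ⟨Perm.cycleOf_mem_cycleFactorsFinset_iff.2 (by simpa using ha),
        (card_support_cycleOf_eq_prime_iff σ ha).2 h⟩, ?_⟩
      rw [Perm.mem_support, Perm.cycleOf_apply_self]
      exact ha
    · rintro ⟨c, ⟨hc, hc'⟩, hac⟩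
      have hσ : σ a ≠ a := by
        have := Perm.mem_cycleFactorsFinset_support_le hc hac
        simpa using this
      have he := Perm.cycle_is_cycleOf hac hc
      rw [he] at hc'
      exact ⟨(card_support_cycleOf_eq_prime_iff σ hσ).1 hc', hσ⟩
  rw [h1, Finset.card_biUnion]
  · rw [Finset.sum_congr rfl fun c hc => (Finset.mem_filter.1 hc).2, Finset.sum_const,
      smul_eq_mul, mul_comm, Perm.cycleType_def, Multiset.count_map]
    congr 1
    rw [Finset.card_def, Finset.filter_val]
    congr 1
    exact Multiset.filter_congr fun c _ => eq_comm
  · intro c hc d hd hcd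
    exact (Perm.cycleFactorsFinset_pairwise_disjoint σ (Finset.mem_filter.1 hc).1
      (Finset.mem_filter.1 hd).1 hcd).disjoint_support

theorem twoCycleNum_eq (σ : Perm β) : twoCycleNum σ = 2 * σ.cycleType.count 2 := by
  rw [← card_pow_prime_fixed]
  rfl

theorem threeCycleNum_eq (σ : Perm β) : threeCycleNum σ = 3 * σ.cycleType.count 3 := by
  rw [← card_pow_prime_fixed]
  rfl

end

section

theorem isConj_finRotate_of_fixedPointFree {g : Perm (Fin 4)} (h1 : ∀ i, g i ≠ i)
    (h2 : ¬ ∀ i, g (g i) = i) : ∃ h, g = h * finRotate 4 * h⁻¹ := by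
  have key : ∀ a b c d : Fin 4, a ≠ 0 → b ≠ 1 → c ≠ 2 → d ≠ 3 → [a, b, c, d].Nodup →
    ¬ (![a, b, c, d] a = 0 ∧ ![a, b, c, d] b = 1 ∧ ![a, b, c, d] c = 2 ∧ ![a, b, c, d] d = 3) →
    [0, a, ![a, b, c, d] a, ![a, b, c, d] (![a, b, c, d] a)].Nodup ∧
      ![a, b, c, d] (![a, b, c, d] (![a, b, c, d] a)) = 0 := by decide
  have hg : ∀ i, g i = ![g 0, g 1, g 2, g 3] i := by
    intro i; fin_cases i <;> rfl
  have hinj : [g 0, g 1, g 2, g 3].Nodup := by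
    exact (List.nodup_map_iff g.injective).2 (show [(0 : Fin 4), 1, 2, 3].Nodup by decide)
  have hk := key (g 0) (g 1) (g 2) (g 3) (h1 0) (h1 1) (h1 2) (h1 3) hinj (by
    rintro ⟨q0, q1, q2, q3⟩
    rw [← hg] at q0 q1 q2 q3
    exact h2 fun i => by fin_cases i <;> assumption)
  rw [← hg, ← hg, ← hg] at hk
  obtain ⟨hn, hc⟩ := hk
  have hb : Function.Bijective ![0, g 0, g (g 0), g (g (g 0))] := by
    rw [← Finite.injective_iff_bijective]
    have := List.nodup_ofFn.1 (show (List.ofFn ![0, g 0, g (g 0), g (g (g 0))]).Nodup from hn)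
    exact this
  refine ⟨Equiv.ofBijective _ hb, ?_⟩
  rw [eq_mul_inv_iff_mul_eq]
  ext i
  rw [Perm.mul_apply, Perm.mul_apply]
  fin_cases i
  · rfl
  · rfl
  · rfl
  · exact congrArg _ hc

end

namespace UnitaryRep

variable {β : Type} [DecidableEq β] [Fintype β] {V : Type*} [AddCommGroup V] [Module ℝ V]

theorem exists_classAvg_finRotate_le (U : UnitaryRep β V) (e : Fin 4 ≃ β)
    (h : U.sym Finset.univ = ⊥) :
    ∃ v ∈ U.W, U.B v v = 1 ∧ classAvg (U.coeff v) (e.permCongr (finRotate 4)) ≤ 1 / 3 := by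
  have hcard : Fintype.card β = 4 := by rw [← Fintype.card_congr e, Fintype.card_fin]
  have hf : fixNum (e.permCongr (finRotate 4)) = 0 := by
    rw [fixNum_eq_card, Finset.card_eq_zero, Finset.filter_eq_empty_iff]
    intro a _
    have : ∀ i : Fin 4, finRotate 4 i ≠ i := by decide
    rw [Equiv.permCongr_apply]
    intro h
    exact this (e.symm a) (e.injective (by rw [Equiv.apply_symm_apply]; exact h))
  have hd : twoCycleNum (e.permCongr (finRotate 4)) = 0 := by
    rw [twoCycleNum, Finset.card_eq_zero, Finset.filter_eq_empty_iff]
    rintro a _ ⟨h, -⟩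
    have : ∀ i : Fin 4, finRotate 4 (finRotate 4 i) ≠ i := by decide
    rw [Equiv.permCongr_apply, Equiv.permCongr_apply, Equiv.symm_apply_apply] at h
    exact this (e.symm a) (e.injective (by rw [Equiv.apply_symm_apply]; exact h))
  have hsg : Perm.sign (e.permCongr (finRotate 4)) = -1 := by
    rw [Perm.sign_permCongr]; decide
  obtain ⟨S, hS, hmax⟩ := U.exists_max_sym
  have hS4 : S.card ≠ 4 := fun h4 => hS (by
    rw [(Finset.card_eq_iff_eq_univ S).1 (by rw [h4, hcard]), h])
  have hS3 : S.card ≤ 4 := hcard ▸ Finset.card_le_univ S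
  generalize e.permCongr (finRotate 4) = σ at *
  by_cases h3 : S.card = 3
  · obtain ⟨v, hv, h1, hc⟩ := U.exists_classAvg_of_one hS hmax (σ := σ) (by omega) (by omega)
    refine ⟨v, hv, h1, ?_⟩
    rw [hc, hf, hcard]; norm_num
  by_cases h2 : S.card = 2
  · obtain ⟨v, hv, h1, hc⟩ := U.exists_classAvg_of_two hS hmax (σ := σ) (by omega) (by omega)
      (by omega) (n := 4) (c₁ := 0) (c₂ := 0) (by rw [hcard]; norm_num) (by rw [hf]; norm_num)
      (by rw [hd]; norm_num)
    refine ⟨v, hv, h1, ?_⟩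
    rcases hc with hc | hc <;> rw [hc] <;> norm_num
  · obtain ⟨T, hT, hT4⟩ := U.exists_twist_sym_ne_bot (a := 1) fun S' hS' => hmax S' (by omega)
    have hTu : T = Finset.univ := (Finset.card_eq_iff_eq_univ T).1
      (le_antisymm (Finset.card_le_univ T) (by omega))
    rw [hTu] at hT
    obtain ⟨v, hv, h1⟩ := U.twist.exists_unit hT
    refine ⟨v, hv.1, h1, ?_⟩
    rw [U.classAvg_of_mem_twist_sym_univ hv h1]
    rw [hsg]; norm_num

end UnitaryRep

section

variable {β : Type} [DecidableEq β] [Fintype β]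

theorem classAvg_le_sum_powersetCard {x : Perm β → ℝ} {S : Finset β} {σ : Perm β}
    {F : Finset β → ℝ} (h : ∀ g : Perm β, x (g⁻¹ * σ * g) ≤ F (Sᶜ.map g.toEmbedding)) :
    UnitaryRep.classAvg x σ ≤ (∑ A ∈ Finset.univ.powersetCard Sᶜ.card, F A)
      / ((Fintype.card β).choose Sᶜ.card) := by
  rw [UnitaryRep.classAvg_eq_inv, ← sum_map_perm]
  exact div_le_div_of_nonneg_right (Finset.sum_le_sum fun g _ => h g) (Nat.cast_nonneg _)

theorem classAvg_eq_sum_powersetCard {x : Perm β → ℝ} {S : Finset β} {σ : Perm β}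
    {F : Finset β → ℝ} (h : ∀ g : Perm β, x (g⁻¹ * σ * g) = F (Sᶜ.map g.toEmbedding)) :
    UnitaryRep.classAvg x σ = (∑ A ∈ Finset.univ.powersetCard Sᶜ.card, F A)
      / ((Fintype.card β).choose Sᶜ.card) := by
  rw [UnitaryRep.classAvg_eq_inv, ← sum_map_perm, Finset.sum_congr rfl fun g _ => h g]

theorem IsPeel.apply_of_forall_eq_one {S : Finset β} {x : Perm β → ℝ} (hx : IsPeel S x)
    {π : Perm β} (h : ∀ ψ ∈ extSet S π, x ψ = 1) :
    x π = (-1) ^ exitCount S π / (S.card.choose (exitCount S π)) := by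
  have h1 := hx.formula π
  rw [Finset.sum_congr rfl h, Finset.sum_const, card_extSet, nsmul_one] at h1
  have h2 := Nat.choose_mul_factorial_mul_factorial (exitCount_le S π)
  have h3 : (S.card.choose (exitCount S π) : ℝ) ≠ 0 := by
    exact_mod_cast (Nat.choose_pos (exitCount_le S π)).ne'
  have h4 : (S.card.factorial : ℝ) ≠ 0 := by exact_mod_cast Nat.factorial_ne_zero _
  rw [eq_div_iff h3]
  apply mul_right_cancel₀ h4
  calc x π * (S.card.choose (exitCount S π)) * S.card.factorial
      = x π * S.card.factorial * (S.card.choose (exitCount S π)) := by ring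
    _ = _ := by rw [h1, ← h2]; push_cast; ring

theorem IsPeel.exists_apply_eq_of_exitCount_eq_zero {S : Finset β} {x : Perm β → ℝ}
    (hx : IsPeel S x) {π : Perm β} (h : exitCount S π = 0) : ∃ ψ ∈ extSet S π, x π = x ψ := by
  have h1 := hx.formula π
  have hc := card_extSet S π
  rw [h, Nat.factorial_zero, Finset.card_eq_one] at hc
  obtain ⟨ψ, hψ⟩ := hc
  refine ⟨ψ, by rw [hψ]; simp, ?_⟩
  rw [h, hψ, Finset.sum_singleton, pow_zero, one_mul, Nat.sub_zero, mul_comm] at h1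
  exact mul_left_cancel₀ (by exact_mod_cast Nat.factorial_ne_zero _) h1

end

namespace UnitaryRep

variable {β : Type} [DecidableEq β] [Fintype β] {V : Type*} [AddCommGroup V] [Module ℝ V]

theorem abs_classAvg_coeff_le (U : UnitaryRep β V) (v : V) (σ : Perm β) :
    |classAvg (U.coeff v) σ| ≤ U.B v v := by
  rw [classAvg, abs_div, Nat.abs_cast, div_le_iff₀ (by exact_mod_cast Fintype.card_pos)]
  refine (Finset.abs_sum_le_sum_abs _ _).trans ?_
  refine (Finset.sum_le_sum fun h _ => U.abs_coeff_le v _).trans ?_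
  rw [Finset.sum_const, Finset.card_univ, nsmul_eq_mul, mul_comm]

section

variable (U : UnitaryRep β V) {S : Finset β} {σ : Perm β}

theorem classAvg_eq_of_mem_restrict_sym (hS : U.sym S ≠ ⊥)
    (hmax : ∀ S' : Finset β, S.card < S'.card → U.sym S' = ⊥)
    {v : V}
    (hv : v ∈ (U.restrict S hS).sym Finset.univ) (h1 : U.B v v = 1) :
    classAvg (U.coeff v) σ = (∑ A ∈ Finset.univ.powersetCard Sᶜ.card,
      (-1) ^ leaveCount σ A / (S.card.choose (leaveCount σ A) : ℝ))
        / ((Fintype.card β).choose Sᶜ.card) := by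
  refine classAvg_eq_sum_powersetCard fun g => ?_
  rw [← exitCount_conj]
  refine (U.isPeel_of_max hv.1 hmax).apply_of_forall_eq_one fun ψ hψ => ?_
  obtain ⟨φ, rfl⟩ := exists_ofSubtype_of_mem_extSet hψ
  have := hv.2 φ fun a ha => absurd (Finset.mem_univ a) ha
  rw [restrict_ρ] at this
  rw [coeff, this, h1]

theorem classAvg_le_of_finRotate (hS : U.sym S ≠ ⊥)
    (hmax : ∀ S' : Finset β, S.card < S'.card → U.sym S' = ⊥)
    (e : Fin 4 ≃ {a // a ∉ S}) {v : V} (hv : v ∈ U.sym S)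
    (h1 : U.B v v = 1)
    (h3 : classAvg ((U.restrict S hS).coeff v) (e.permCongr (finRotate 4)) ≤ 1 / 3)
    (hσ : σ.cycleType.count 2 ≤ 1) :
    classAvg (U.coeff v) σ ≤ (∑ A ∈ Finset.univ.powersetCard Sᶜ.card,
      if leaveCount σ A = 0 then (if ∀ a ∈ A, σ a ≠ a then 1 / 3 else 1)
        else 1 / (S.card.choose (leaveCount σ A) : ℝ))
        / ((Fintype.card β).choose Sᶜ.card) := by
  rw [← classAvg_fixAvg S]
  have hX := U.isPeel_fixAvg hS hmax hv
  have hle : ∀ φ : Perm {a // a ∉ S}, |fixAvg S (U.coeff v) (Perm.ofSubtype φ)| ≤ 1 := by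
    intro φ
    rw [U.fixAvg_ofSubtype S hS]
    exact ((U.restrict S hS).abs_classAvg_coeff_le v φ).trans h1.le
  refine classAvg_le_sum_powersetCard fun g => ?_
  rw [← exitCount_conj]
  by_cases h0 : exitCount S (g⁻¹ * σ * g) = 0
  · rw [if_pos h0]
    obtain ⟨ψ, hψ, he⟩ := hX.exists_apply_eq_of_exitCount_eq_zero h0
    obtain ⟨φ, rfl⟩ := exists_ofSubtype_of_mem_extSet hψ
    rw [he]
    split_ifs with hA
    · have hstay : ∀ a ∉ S, (g⁻¹ * σ * g) a ∉ S := by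
        intro a ha ha'
        rw [exitCount, Finset.card_eq_zero, Finset.filter_eq_empty_iff] at h0
        exact h0 (Finset.mem_univ a) ⟨ha, ha'⟩
      have hφ : ∀ a : {a // a ∉ S}, g (φ a) = σ (g a) := by
        intro a
        have := (mem_extSet.1 hψ).2 a a.2 (hstay a a.2)
        rw [Perm.ofSubtype_apply_coe] at this
        rw [this]
        simp [Perm.mul_apply]
      have hfree : ∀ a, φ a ≠ a := by
        intro a ha
        have := hφ a
        rw [ha] at this
        exact hA (g a) (by simpa using a.2) this.symm
      have hsq : ¬ ∀ a, φ (φ a) = a := by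
        intro hsq
        have hle4 : 4 ≤ twoCycleNum σ := by
          have hc : Fintype.card {a // a ∉ S} = 4 := by
            rw [← Fintype.card_congr e, Fintype.card_fin]
          rw [← hc, twoCycleNum, ← Finset.card_univ]
          refine Finset.card_le_card_of_injOn (fun a => g a) ?_ ?_
          · intro a _
            simp only [Finset.coe_filter, Finset.mem_univ, true_and, Set.mem_ofPred_eq]
            rw [← hφ, ← hφ, hsq]
            refine ⟨rfl, fun h => hfree a ?_⟩
            exact Subtype.ext (g.injective h)
          · intro a _ b _ hab
            exact Subtype.ext (g.injective hab)
        rw [twoCycleNum_eq] at hle4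
        omega
      obtain ⟨κ, hκ⟩ := isConj_finRotate_of_fixedPointFree (g := e.symm.permCongr φ)
        (fun i hi => hfree (e i) (by
          rw [Equiv.permCongr_apply, Equiv.symm_apply_eq] at hi
          exact hi)) (fun hi => hsq fun a => by
          have := hi (e.symm a)
          rw [Equiv.permCongr_apply, Equiv.permCongr_apply, Equiv.symm_apply_eq] at this
          simpa using this)
      have hφe : φ = e.permCongr (κ * finRotate 4 * κ⁻¹) := by
        rw [← hκ]; ext a; simp
      rw [U.fixAvg_ofSubtype S hS, hφe, classAvg_permCongr_conj]
      exact h3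
    · exact (le_abs_self _).trans (hle φ)
  · rw [if_neg h0]
    refine (le_abs_self _).trans (hX.abs_le _ fun ψ hψ => ?_)
    obtain ⟨φ, rfl⟩ := exists_ofSubtype_of_mem_extSet hψ
    exact hle φ

end

end UnitaryRep

section

variable {β : Type} [DecidableEq β] [Fintype β]

/-- The number of sets of size `k` which exactly `r` of their points leave. -/
def leaveNum (k r : ℕ) (σ : Perm β) : ℕ :=
  ((Finset.univ.powersetCard k).filter fun A => leaveCount σ A = r).card

theorem sum_powersetCard_leaveCount {M : Type*} [CommSemiring M] (k : ℕ) (σ : Perm β) (g : ℕ → M) :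
    ∑ A ∈ Finset.univ.powersetCard k, g (leaveCount σ A)
      = ∑ r ∈ Finset.range (k + 1), (leaveNum k r σ : M) * g r := by
  rw [← Finset.sum_fiberwise_of_maps_to (t := Finset.range (k + 1)) (g := leaveCount σ)]
  · refine Finset.sum_congr rfl fun r _ => ?_
    rw [Finset.sum_congr rfl fun A hA => congrArg g (Finset.mem_filter.1 hA).2, Finset.sum_const,
      nsmul_eq_mul, leaveNum]
  · intro A hA
    have := leaveCount_le σ A
    rw [(Finset.mem_powersetCard.1 hA).2] at this
    exact Finset.mem_range.2 (by omega)

theorem card_filter_subset_powersetCard (D : Finset β) (k : ℕ) :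
    ((Finset.univ.powersetCard k).filter fun A => D ⊆ A).card
      = if D.card ≤ k then (Fintype.card β - D.card).choose (k - D.card) else 0 := by
  split_ifs with h
  · rw [← Finset.card_compl, ← Finset.card_powersetCard]
    refine Finset.card_nbij' (fun A => A \ D) (fun B => B ∪ D) ?_ ?_ ?_ ?_
    · intro A hA
      simp only [Finset.coe_filter, Finset.mem_powersetCard, Set.mem_ofPred_eq,
          Finset.mem_coe] at hA ⊢
      refine ⟨fun a ha => by simpa using (Finset.mem_sdiff.1 ha).2, ?_⟩
      rw [Finset.card_sdiff_of_subset hA.2, hA.1.2]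
    · intro B hB
      simp only [Finset.coe_filter, Finset.mem_powersetCard, Set.mem_ofPred_eq,
          Finset.mem_coe] at hB ⊢
      refine ⟨⟨Finset.subset_univ _, ?_⟩, Finset.subset_union_right⟩
      rw [Finset.card_union_of_disjoint (Finset.disjoint_left.2 fun a ha =>
        Finset.mem_compl.1 (hB.1 ha)), hB.2]
      omega
    · intro A hA
      exact Finset.sdiff_union_of_subset (Finset.mem_filter.1 hA).2
    · intro B hB
      exact Finset.union_sdiff_cancel_right (Finset.disjoint_left.2 fun a ha =>
        Finset.mem_compl.1 ((Finset.mem_powersetCard.1 hB).1 ha))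
  · rw [Finset.card_eq_zero, Finset.filter_eq_empty_iff]
    intro A hA hD
    exact h ((Finset.card_le_card hD).trans (Finset.mem_powersetCard.1 hA).2.le)

theorem card_union_map (σ : Perm β) (C : Finset β) :
    (C ∪ C.map σ.toEmbedding).card = C.card + leaveCount σ C := by
  rw [← Finset.union_sdiff_self_eq_union, Finset.card_union_of_disjoint Finset.disjoint_sdiff]
  congr 1
  refine Eq.trans ?_ (Finset.card_map σ.toEmbedding)
  congr 1
  ext a
  simp only [Finset.mem_sdiff, Finset.mem_map_equiv, Finset.mem_filter, Equiv.apply_symm_apply]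

theorem sum_choose_sub_leaveCount (k j : ℕ) (σ : Perm β) :
    ∑ A ∈ Finset.univ.powersetCard k, (k - leaveCount σ A).choose j
      = ∑ C ∈ Finset.univ.powersetCard j, if j + leaveCount σ C ≤ k
          then (Fintype.card β - (j + leaveCount σ C)).choose (k - (j + leaveCount σ C))
          else 0 := by
  have h1 : ∀ A ∈ Finset.univ.powersetCard k, (k - leaveCount σ A).choose j
      = ((Finset.univ.powersetCard j).filter fun C => C ∪ C.map σ.toEmbedding ⊆ A).card := by
    intro A hA
    have hs : (A.filter fun a => σ a ∈ A).card = k - leaveCount σ A := by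
      have := Finset.card_filter_add_card_filter_not (s := A) fun a => σ a ∈ A
      rw [(Finset.mem_powersetCard.1 hA).2] at this
      rw [leaveCount]
      omega
    rw [← hs, ← Finset.card_powersetCard]
    congr 1
    ext C
    simp only [Finset.mem_powersetCard, Finset.mem_filter, Finset.subset_univ, true_and,
      Finset.union_subset_iff]
    rw [and_comm]
    refine and_congr_right fun _ => ?_
    constructor
    · intro h
      refine ⟨fun a ha => (Finset.mem_filter.1 (h ha)).1, fun a ha => ?_⟩
      rw [Finset.mem_map_equiv] at ha
      simpa using (Finset.mem_filter.1 (h ha)).2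
    · rintro ⟨h, h'⟩ a ha
      exact Finset.mem_filter.2 ⟨h ha, h' (Finset.mem_map_of_mem σ.toEmbedding ha)⟩
  have h2 : ∀ C ∈ Finset.univ.powersetCard j, (if j + leaveCount σ C ≤ k
      then (Fintype.card β - (j + leaveCount σ C)).choose (k - (j + leaveCount σ C)) else 0)
      = ((Finset.univ.powersetCard k).filter fun A => C ∪ C.map σ.toEmbedding ⊆ A).card := by
    intro C hC
    rw [card_filter_subset_powersetCard, card_union_map, (Finset.mem_powersetCard.1 hC).2]
  rw [Finset.sum_congr rfl h1, Finset.sum_congr rfl h2]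
  have := Finset.sum_card_bipartiteAbove_eq_sum_card_bipartiteBelow
    (s := Finset.univ.powersetCard k) (t := Finset.univ.powersetCard j)
    fun A C : Finset β => C ∪ C.map σ.toEmbedding ⊆ A
  simpa only [Finset.bipartiteAbove, Finset.bipartiteBelow] using this

theorem sum_leaveNum_mul_choose (k j : ℕ) (σ : Perm β) :
    ∑ r ∈ Finset.range (k + 1), leaveNum k r σ * (k - r).choose j
      = ∑ r ∈ Finset.range (j + 1), leaveNum j r σ * if j + r ≤ k
          then (Fintype.card β - (j + r)).choose (k - (j + r)) else 0 := by
  have h1 := sum_powersetCard_leaveCount k σ fun r => (k - r).choose j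
  have h2 := sum_powersetCard_leaveCount j σ fun r => if j + r ≤ k
          then (Fintype.card β - (j + r)).choose (k - (j + r)) else 0
  simp only [Nat.cast_id] at h1 h2
  rw [← h1, ← h2]
  exact sum_choose_sub_leaveCount k j σ

open Polynomial in
theorem leaveNum_zero_eq_coeff (k : ℕ) (σ : Perm β) :
    (leaveNum k 0 σ : ℤ)
      = ((1 + X) ^ fixNum σ * (σ.cycleType.map fun l => (1 + X ^ l : ℤ[X])).prod).coeff k := by
  have h1 := transferSum_eq (leaveWeight (X : ℤ[X]) 0) (a := 1) (b := X)
    (by simp [leaveWeight, add_comm]) (by simp [leaveWeight]) σ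
  rw [← sum_finset_eq_transferSum] at h1
  simp only [prod_leaveWeight, one_pow] at h1
  rw [fixNum, ← h1, Polynomial.finsetSum_coeff, leaveNum, Finset.card_eq_sum_ones, Nat.cast_sum,
    Finset.sum_filter, Finset.powersetCard_eq_filter, Finset.sum_filter, Finset.powerset_univ]
  refine Finset.sum_congr rfl fun A _ => ?_
  by_cases h0 : leaveCount σ A = 0
  · simp [h0, Polynomial.coeff_X_pow, eq_comm]
  · simp [h0]

open Polynomial in
theorem exists_prod_one_add_X_pow (s : Multiset ℕ) (hs : ∀ l ∈ s, 2 ≤ l) :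
    ∃ r : ℤ[X], (s.map fun l => (1 + X ^ l : ℤ[X])).prod = (1 + X ^ 2) ^ s.count 2
      * (1 + X ^ 3) ^ s.count 3 * (1 + X ^ 4) ^ s.count 4 * (1 + X ^ 5 * r) := by
  induction s using Multiset.induction with
  | empty => exact ⟨0, by simp⟩
  | cons l s ih =>
    obtain ⟨r, hr⟩ := ih fun l hl => hs l (Multiset.mem_cons_of_mem hl)
    have hl := hs l (Multiset.mem_cons_self l s)
    rw [Multiset.map_cons, Multiset.prod_cons, hr]
    by_cases h2 : l = 2
    · subst h2
      refine ⟨r, ?_⟩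
      rw [Multiset.count_cons_self, Multiset.count_cons_of_ne (by decide),
        Multiset.count_cons_of_ne (by decide)]
      ring
    by_cases h3 : l = 3
    · subst h3
      refine ⟨r, ?_⟩
      rw [Multiset.count_cons_self, Multiset.count_cons_of_ne (by decide),
        Multiset.count_cons_of_ne (by decide)]
      ring
    by_cases h4 : l = 4
    · subst h4
      refine ⟨r, ?_⟩
      rw [Multiset.count_cons_self, Multiset.count_cons_of_ne (by decide),
        Multiset.count_cons_of_ne (by decide)]
      ring
    obtain ⟨t, rfl⟩ : ∃ t, l = 5 + t := ⟨l - 5, by omega⟩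
    refine ⟨r + X ^ t * (1 + X ^ 5 * r), ?_⟩
    rw [Multiset.count_cons_of_ne (by omega), Multiset.count_cons_of_ne (by omega),
      Multiset.count_cons_of_ne (by omega)]
    ring

theorem exists_one_add_pow {R : Type*} [CommRing R] (y : R) (c : ℕ) :
    ∃ q, (1 + y) ^ c = 1 + c * y + y ^ 2 * q := by
  induction c with
  | zero => exact ⟨0, by simp⟩
  | succ c ih =>
    obtain ⟨q, hq⟩ := ih
    refine ⟨q + y * q + c, ?_⟩
    rw [pow_succ, hq]
    push_cast
    ring

open Polynomial in
theorem leaveNum_zero_of_fixNum_eq_one (σ : Perm β) (hf : fixNum σ = 1)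
    (hc : σ.cycleType.count 2 ≤ 1) : leaveNum 0 0 σ = 1 ∧ leaveNum 1 0 σ = 1 ∧
      leaveNum 2 0 σ = σ.cycleType.count 2 ∧
      leaveNum 3 0 σ = σ.cycleType.count 2 + σ.cycleType.count 3 ∧
      leaveNum 4 0 σ = σ.cycleType.count 3 + σ.cycleType.count 4 := by
  obtain ⟨r, hr⟩ := exists_prod_one_add_X_pow σ.cycleType fun l hl =>
    Perm.two_le_of_mem_cycleType hl
  obtain ⟨q₃, h₃⟩ := exists_one_add_pow (X ^ 3 : ℤ[X]) (σ.cycleType.count 3)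
  obtain ⟨q₄, h₄⟩ := exists_one_add_pow (X ^ 4 : ℤ[X]) (σ.cycleType.count 4)
  have h₂ : (1 + X ^ 2 : ℤ[X]) ^ σ.cycleType.count 2 = 1 + ((σ.cycleType.count 2 : ℕ) : ℤ[X]) * X
      ^ 2 := by
    generalize σ.cycleType.count 2 = c at hc
    interval_cases c <;> simp
  rw [h₂, h₃, h₄] at hr
  have key : ∃ R : ℤ[X], (1 + X) ^ fixNum σ * (σ.cycleType.map fun l => (1 + X ^ l : ℤ[X])).prod
      = 1 + X + (σ.cycleType.count 2 : ℤ[X]) * X ^ 2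
        + ((σ.cycleType.count 2 + σ.cycleType.count 3 : ℕ) : ℤ[X]) * X ^ 3
        + ((σ.cycleType.count 3 + σ.cycleType.count 4 : ℕ) : ℤ[X]) * X ^ 4 + R * X ^ 5 := by
    rw [hf, hr]
    generalize (σ.cycleType.count 2 : ℕ) = c₂
    generalize (σ.cycleType.count 3 : ℕ) = c₃
    generalize (σ.cycleType.count 4 : ℕ) = c₄
    refine ⟨(1 + X) * (1 + (c₂ : ℤ[X]) * X ^ 2) * (1 + (c₃ : ℤ[X]) * X ^ 3 + (X ^ 3) ^ 2 * q₃)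
        * (1 + (c₄ : ℤ[X]) * X ^ 4 + (X ^ 4) ^ 2 * q₄) * r
      + (1 + X) * (1 + (c₂ : ℤ[X]) * X ^ 2) * ((1 + (c₃ : ℤ[X]) * X ^ 3) * (X ^ 3 * q₄)
        + X * q₃ * (1 + (c₄ : ℤ[X]) * X ^ 4 + (X ^ 4) ^ 2 * q₄) + (c₃ : ℤ[X]) * (c₄ : ℤ[X]) * X ^ 2)
      + (c₂ : ℤ[X]) * (c₃ : ℤ[X]) + (c₄ : ℤ[X]) + (c₂ : ℤ[X]) * (c₄ : ℤ[X]) * X + (c₂ : ℤ[X]) *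
          (c₃ : ℤ[X]) * X + (c₂ : ℤ[X]) * (c₄ : ℤ[X]) * X ^ 2, ?_⟩
    push_cast
    ring
  obtain ⟨R, hR⟩ := key
  have hcoeff : ∀ k, (leaveNum k 0 σ : ℤ) = _ := fun k => leaveNum_zero_eq_coeff k σ
  rw [hR] at hcoeff
  simp only [Polynomial.coeff_add,
    Polynomial.coeff_mul_X_pow', Polynomial.coeff_one, Polynomial.coeff_X] at hcoeff
  have i0 := hcoeff 0
  have i1 := hcoeff 1
  have i2 := hcoeff 2
  have i3 := hcoeff 3
  have i4 := hcoeff 4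
  norm_num at i0 i1 i2 i3 i4
  refine ⟨?_, ?_, ?_, ?_, ?_⟩ <;>
    first
    | assumption
    | exact_mod_cast i0
    | exact_mod_cast i1
    | exact_mod_cast i2
    | exact_mod_cast i3
    | exact_mod_cast i4

end

theorem cast_choose_three (n : ℕ) : (n.choose 3 : ℝ) = n * (n - 1) * (n - 2) / 6 := by
  induction n with
  | zero => simp
  | succ n ih =>
    rw [Nat.choose_succ_succ' n 2, Nat.cast_add, ih, Nat.cast_choose_two]
    push_cast
    ring

theorem cast_choose_four (n : ℕ) :
    (n.choose 4 : ℝ) = n * (n - 1) * (n - 2) * (n - 3) / 24 := by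
  induction n with
  | zero => simp
  | succ n ih =>
    rw [Nat.choose_succ_succ' n 3, Nat.cast_add, ih, cast_choose_three]
    push_cast
    ring

theorem prod_add_le_two_mul_prod_sub {m : ℝ} (hm : 996 ≤ m) :
    (m + 4) * (m + 3) * (m + 2) * (m + 1) ≤ 2 * (m * (m - 1) * (m - 2) * (m - 3)) := by
  have h1 : (m + 4) * (m + 1) ≤ 1.1 * (m * (m - 3)) := by nlinarith
  have h2 : (m + 3) * (m + 2) ≤ 1.1 * ((m - 1) * (m - 2)) := by nlinarith
  have h3 := mul_le_mul h1 h2 (by nlinarith) (by nlinarith)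
  have h4 : 0 ≤ m * (m - 3) * ((m - 1) * (m - 2)) := mul_nonneg (by nlinarith) (by nlinarith)
  linarith

theorem leaveNum_four_sum_le {m c₂ c₃ c₄ e1 e2 e3 e4 : ℝ} (hm : 996 ≤ m) (c0 : 0 ≤ c₂)
    (c1 : c₂ ≤ 1) (c3 : 0 ≤ c₃) (c4 : 0 ≤ c₄) (p1 : 0 ≤ e1) (p2 : 0 ≤ e2) (p3 : 0 ≤ e3)
    (E1 : e1 = (c₃ + c₂) * (m + 1) + (c₂ * (m + 2) + (2 * (m + 3) - 2 * c₂)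
      - 3 * (c₃ + c₂)) - 4 * (c₃ + c₄))
    (E2 : e2 = c₂ * ((m + 2) * (m + 1) / 2) + (2 * (m + 3) - 2 * c₂) * (m + 1)
      + ((m + 4) * (m + 3) / 2 - (2 * (m + 3) - 2 * c₂) - c₂)
      - 6 * (c₃ + c₄) - 3 * e1)
    (E3 : e3 = (m + 3) * (m + 2) * (m + 1) * 2 / 3 - 4 * (c₃ + c₄) - 3 * e1 - 2 * e2)
    (E4 : e4 = (m + 4) * (m + 3) * (m + 2) * (m + 1) / 24 - (c₃ + c₄) - e1 - e2 - e3) :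
    e1 * (1 / m) + e2 * (1 / (m * (m - 1) / 2)) + e3 * (1 / (m * (m - 1) * (m - 2) / 6))
      + e4 * (1 / (m * (m - 1) * (m - 2) * (m - 3) / 24)) ≤ 2 * c₃ + 22 := by
  have q1 : e1 * (1 / m) ≤ 2 * c₃ + 8 := by
    rw [mul_one_div, div_le_iff₀ (by linarith)]
    nlinarith
  have q2 : e2 * (1 / (m * (m - 1) / 2)) ≤ 7 := by
    rw [mul_one_div, div_le_iff₀ (by nlinarith)]
    nlinarith
  have q3 : e3 * (1 / (m * (m - 1) * (m - 2) / 6)) ≤ 5 := by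
    rw [mul_one_div, div_le_iff₀ (by
      have : 0 < m * (m - 1) * (m - 2) := mul_pos (mul_pos (by linarith) (by linarith)) (by
          linarith)
      linarith)]
    nlinarith [mul_nonneg (by linarith : (0:ℝ) ≤ m) (by nlinarith : (0:ℝ) ≤ m * (m - 996))]
  have q4 : e4 * (1 / (m * (m - 1) * (m - 2) * (m - 3) / 24)) ≤ 2 := by
    rw [mul_one_div, div_le_iff₀ (by
      have : 0 < m * (m - 1) * (m - 2) * (m - 3) :=
        mul_pos (mul_pos (mul_pos (by linarith) (by linarith)) (by linarith)) (by linarith)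
      linarith)]
    linarith [prod_add_le_two_mul_prod_sub hm]
  linarith

section

variable {β : Type} [DecidableEq β] [Fintype β]

theorem leaveNum_four_of_fixNum_eq_one {m : ℕ} (hm : m + 4 = Fintype.card β) {σ : Perm β}
    (hf : fixNum σ = 1) (hc : σ.cycleType.count 2 ≤ 1) {c₂ c₃ c₄ : ℝ}
    (h₂ : (σ.cycleType.count 2 : ℝ) = c₂) (h₃ : (σ.cycleType.count 3 : ℝ) = c₃)
    (h₄ : (σ.cycleType.count 4 : ℝ) = c₄) :
    (leaveNum 4 0 σ : ℝ) = c₃ + c₄ ∧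
    (leaveNum 4 1 σ : ℝ) = (c₃ + c₂) * (m + 1) + (c₂ * (m + 2) + (2 * (m + 3) - 2 * c₂)
      - 3 * (c₃ + c₂)) - 4 * (c₃ + c₄) ∧
    (leaveNum 4 2 σ : ℝ) = c₂ * ((m + 2) * (m + 1) / 2) + (2 * (m + 3) - 2 * c₂) * (m + 1)
      + ((m + 4) * (m + 3) / 2 - (2 * (m + 3) - 2 * c₂) - c₂)
      - 6 * (c₃ + c₄) - 3 * leaveNum 4 1 σ ∧
    (leaveNum 4 3 σ : ℝ) = (m + 3) * (m + 2) * (m + 1) * 2 / 3 - 4 * (c₃ + c₄)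
      - 3 * leaveNum 4 1 σ - 2 * leaveNum 4 2 σ ∧
    (leaveNum 4 4 σ : ℝ) = (m + 4) * (m + 3) * (m + 2) * (m + 1) / 24 - (c₃ + c₄)
      - leaveNum 4 1 σ - leaveNum 4 2 σ - leaveNum 4 3 σ := by
  obtain ⟨z0, z1, z2, z3, z4⟩ := leaveNum_zero_of_fixNum_eq_one σ hf hc
  have a0 := sum_leaveNum_mul_choose 1 0 σ
  have b0 := sum_leaveNum_mul_choose 2 0 σ
  have b1 := sum_leaveNum_mul_choose 2 1 σ
  have d2 := sum_leaveNum_mul_choose 3 2 σ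
  have e0 := sum_leaveNum_mul_choose 4 0 σ
  have e1 := sum_leaveNum_mul_choose 4 1 σ
  have e2 := sum_leaveNum_mul_choose 4 2 σ
  have e3 := sum_leaveNum_mul_choose 4 3 σ
  rw [← hm] at a0 b0 b1 d2 e0 e1 e2 e3
  simp only [Finset.sum_range_succ, Finset.sum_range_zero, zero_add, z0, z1, z2, z3,
    z4] at a0 b0 b1 d2 e0 e1 e2 e3
  norm_num [Nat.choose_one_right, show Nat.choose 4 2 = 6 by decide,
    show Nat.choose 3 2 = 3 by decide, show Nat.choose 4 3 = 4 by decide] at a0 b0 b1 d2 e0 e1 e2 e3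
  have A0 := congrArg (Nat.cast : ℕ → ℝ) a0
  have B0 := congrArg (Nat.cast : ℕ → ℝ) b0
  have B1 := congrArg (Nat.cast : ℕ → ℝ) b1
  have D2 := congrArg (Nat.cast : ℕ → ℝ) d2
  have E0 := congrArg (Nat.cast : ℕ → ℝ) e0
  have E1 := congrArg (Nat.cast : ℕ → ℝ) e1
  have E2 := congrArg (Nat.cast : ℕ → ℝ) e2
  have E3 := congrArg (Nat.cast : ℕ → ℝ) e3
  push_cast [Nat.cast_choose_two, cast_choose_three, cast_choose_four, h₂, h₃,
      h₄] at A0 B0 B1 D2 E0 E1 E2 E3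
  have A : (leaveNum 1 1 σ : ℝ) = m + 3 := by linarith
  rw [A] at B1 E1
  have B : (leaveNum 2 1 σ : ℝ) = 2 * (m + 3) - 2 * c₂ := by linarith
  rw [B] at B0 D2 E2
  have B' : (leaveNum 2 2 σ : ℝ) = (m + 4) * (m + 3) / 2 - (2 * (m + 3) - 2 * c₂) - c₂ := by
    linarith
  rw [B'] at E2
  have D : (leaveNum 3 1 σ : ℝ) = c₂ * (m + 2) + (2 * (m + 3) - 2 * c₂) - 3 * (c₃ + c₂) := by
    linarith
  rw [D] at E3
  refine ⟨?_, ?_, ?_, ?_, ?_⟩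
  · rw [z4]; push_cast; linarith
  · linarith
  · linarith
  · linarith
  · linarith

theorem card_filter_leaveCount_eq_zero_le (k : ℕ) {σ : Perm β} (hf : fixNum σ ≤ 1) :
    ((Finset.univ.powersetCard (k + 1)).filter fun A => leaveCount σ A = 0 ∧
      ¬ ∀ a ∈ A, σ a ≠ a).card ≤ leaveNum k 0 σ := by
  rw [fixNum_eq_card, Finset.card_le_one] at hf
  by_cases hx : ∃ x, σ x = x
  swap
  · rw [Finset.filter_eq_empty_iff.2, Finset.card_empty]
    · exact Nat.zero_le _
    · exact fun A _ h => h.2 fun a _ ha => hx ⟨a, ha⟩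
  obtain ⟨x, hx⟩ := hx
  have key : ∀ A : Finset β, (¬ ∀ a ∈ A, σ a ≠ a) → x ∈ A := by
    intro A hA
    push Not at hA
    obtain ⟨a, ha, ha'⟩ := hA
    rwa [hf x (by simpa using hx) a (by simpa using ha')]
  refine Finset.card_le_card_of_injOn (fun A => A.erase x) ?_ ?_
  · intro A hA
    simp only [Finset.coe_filter, Finset.mem_powersetCard, Finset.subset_univ, true_and,
      Set.mem_ofPred_eq, leaveCount, Finset.card_eq_zero, Finset.filter_eq_empty_iff,
      not_not] at hA ⊢
    have hxA := key A hA.2.2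
    rw [Finset.card_erase_of_mem hxA, hA.1]
    refine ⟨rfl, fun a ha => ?_⟩
    rw [Finset.mem_erase] at ha ⊢
    exact ⟨fun h => ha.1 (σ.injective (h.trans hx.symm)), hA.2.1 ha.2⟩
  · intro A hA A' hA' h
    simp only [Finset.coe_filter, Set.mem_ofPred_eq] at hA hA'
    have h' : A.erase x = A'.erase x := h
    rw [← Finset.insert_erase (key A hA.2.2), h', Finset.insert_erase (key A' hA'.2.2)]

namespace UnitaryRep

variable {V : Type*} [AddCommGroup V] [Module ℝ V]

theorem exists_classAvg_of_four (U : UnitaryRep β V) {S : Finset β} (hS : U.sym S ≠ ⊥)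
    (hmax : ∀ S' : Finset β, S.card < S'.card → U.sym S' = ⊥) {σ : Perm β}
    (hk : S.card + 4 = Fintype.card β) (hcard : 1000 ≤ Fintype.card β)
    (hf : fixNum σ = 1) (hc : σ.cycleType.count 2 ≤ 1) {n c₂ c₃ c₄ : ℝ}
    (hn : (Fintype.card β : ℝ) = n)
    (h₂ : (σ.cycleType.count 2 : ℝ) = c₂) (h₃ : (σ.cycleType.count 3 : ℝ) = c₃)
    (h₄ : (σ.cycleType.count 4 : ℝ) = c₄) :
    ∃ v ∈ U.W, U.B v v = 1 ∧
      (classAvg (U.coeff v) σ = (c₄ - c₂) / (n * (n - 1) * (n - 2) * (n - 7) / 24) ∨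
       classAvg (U.coeff v) σ
         ≤ (c₄ / 3 + 3 * c₃ + 23) / (n * (n - 1) * (n - 2) * (n - 3) / 24)) := by
  obtain ⟨E0, E1, E2, E3, E4⟩ := leaveNum_four_of_fixNum_eq_one hk hf hc h₂ h₃ h₄
  have hSc : Sᶜ.card = 4 := by rw [Finset.card_compl]; omega
  have hm : (996 : ℝ) ≤ S.card := by exact_mod_cast (by omega : 996 ≤ S.card)
  have hnm : n = S.card + 4 := by rw [← hn, ← hk]; push_cast; rfl
  have c0 : 0 ≤ c₂ := by rw [← h₂]; positivity
  have c1 : c₂ ≤ 1 := by rw [← h₂]; exact_mod_cast hc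
  have c3 : 0 ≤ c₃ := by rw [← h₃]; positivity
  have c4 : 0 ≤ c₄ := by rw [← h₄]; positivity
  by_cases hU : (U.restrict S hS).sym Finset.univ = ⊥
  · obtain ⟨e⟩ := exists_equiv_of_card hk
    obtain ⟨v, hv, h1, h3⟩ := (U.restrict S hS).exists_classAvg_finRotate_le e hU
    have hW : v ∈ U.sym S := hv
    refine ⟨v, (U.mem_sym.1 hW).1, h1, Or.inr ?_⟩
    refine (U.classAvg_le_of_finRotate hS hmax e hW h1 h3 hc).trans ?_
    rw [hSc, cast_choose_four, hn]
    have hdiv : (0 : ℝ) ≤ n * (n - 1) * (n - 2) * (n - 3) / 24 := by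
      rw [hnm, show (S.card : ℝ) + 4 - 1 = S.card + 3 by ring,
        show (S.card : ℝ) + 4 - 2 = S.card + 2 by ring, show (S.card : ℝ) + 4 - 3 = S.card + 1 by
            ring]
      positivity
    refine div_le_div_of_nonneg_right ?_ hdiv
    have hsum : ∀ A : Finset β, (if leaveCount σ A = 0 then (if ∀ a ∈ A, σ a ≠ a then (1 / 3 : ℝ)
        else 1)
        else 1 / (S.card.choose (leaveCount σ A) : ℝ))
        = (if leaveCount σ A = 0 then 1 / 3 else 1 / (S.card.choose (leaveCount σ A) : ℝ))
          + 2 / 3 * if leaveCount σ A = 0 ∧ ¬ ∀ a ∈ A, σ a ≠ a then (1 : ℝ) else 0 := by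
      intro A
      by_cases h0 : leaveCount σ A = 0
      · by_cases h1 : ∀ a ∈ A, σ a ≠ a
        · rw [if_pos h0, if_pos h1, if_pos h0, if_neg (fun h => h.2 h1)]; norm_num
        · rw [if_pos h0, if_neg h1, if_pos h0, if_pos ⟨h0, h1⟩]; norm_num
      · rw [if_neg h0, if_neg h0, if_neg (fun h => h0 h.1)]; norm_num
    rw [Finset.sum_congr rfl fun A _ => hsum A, Finset.sum_add_distrib, ← Finset.mul_sum,
      Finset.sum_boole, sum_powersetCard_leaveCount 4 σ
        fun r => if r = 0 then (1 / 3 : ℝ) else 1 / (S.card.choose r : ℝ)]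
    have hfix : ((((Finset.univ.powersetCard (3 + 1)).filter fun A => leaveCount σ A = 0 ∧
      ¬ ∀ a ∈ A, σ a ≠ a).card : ℕ) : ℝ) ≤ c₂ + c₃ := by
      have := card_filter_leaveCount_eq_zero_le 3 hf.le
      rw [(leaveNum_zero_of_fixNum_eq_one σ hf hc).2.2.2.1] at this
      rw [← h₂, ← h₃]
      exact_mod_cast this
    simp only [Finset.sum_range_succ, Finset.sum_range_zero, zero_add]
    norm_num only [Nat.choose_one_right, Nat.cast_choose_two, cast_choose_three, cast_choose_four,
      if_true, if_false] at hfix ⊢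
    have p1 : (0 : ℝ) ≤ leaveNum 4 1 σ := Nat.cast_nonneg _
    have p2 : (0 : ℝ) ≤ leaveNum 4 2 σ := Nat.cast_nonneg _
    have p3 : (0 : ℝ) ≤ leaveNum 4 3 σ := Nat.cast_nonneg _
    rw [E0]
    generalize (leaveNum 4 1 σ : ℝ) = e1 at *
    generalize (leaveNum 4 2 σ : ℝ) = e2 at *
    generalize (leaveNum 4 3 σ : ℝ) = e3 at *
    generalize (leaveNum 4 4 σ : ℝ) = e4 at *
    generalize (S.card : ℝ) = m at *
    have := leaveNum_four_sum_le hm c0 c1 c3 c4 p1 p2 p3 E1 E2 E3 E4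
    linarith
  · obtain ⟨v, hv, h1⟩ := (U.restrict S hS).exists_unit hU
    have hW : v ∈ U.sym S := ((U.restrict S hS).mem_sym.1 hv).1
    refine ⟨v, (U.mem_sym.1 hW).1, h1, Or.inl ?_⟩
    have h1' : U.B v v = 1 := h1
    rw [U.classAvg_eq_of_mem_restrict_sym hS hmax hv h1', hSc, sum_powersetCard_leaveCount 4 σ
        fun r => (-1) ^ r / (S.card.choose r : ℝ)]
    simp only [Finset.sum_range_succ, Finset.sum_range_zero, zero_add]
    norm_num only [Nat.choose_zero_right, Nat.choose_one_right, Nat.cast_choose_two,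
        cast_choose_three,
      cast_choose_four]
    rw [hn]
    rw [E4, E3, E2, E1, E0]
    generalize (S.card : ℝ) = m at *
    subst hnm
    have p0 : m ≠ 0 := by intro h; linarith
    have p1 : m - 1 ≠ 0 := by intro h; linarith
    have p2 : m - 2 ≠ 0 := by intro h; linarith
    have p3 : m - 3 ≠ 0 := by intro h; linarith
    have p4 : m + 1 ≠ 0 := by intro h; linarith
    have p5 : m + 2 ≠ 0 := by intro h; linarith
    have p6 : m + 3 ≠ 0 := by intro h; linarith
    have p7 : m + 4 ≠ 0 := by intro h; linarith
    rw [show m + 4 - 1 = m + 3 by ring, show m + 4 - 2 = m + 2 by ring,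
      show m + 4 - 3 = m + 1 by ring, show m + 4 - 7 = m - 3 by ring]
    field_simp
    ring

end UnitaryRep

end

/-- The largest of the eight normalized characters, as a function of the cycle counts and the
sign. -/
noncomputable def eightMax (N c1 c2 c3 c4 e : ℝ) : ℝ :=
  let F1 := (c1 - 1) / (N - 1)
  let F2 := (c1 * (c1 - 3) / 2 + c2) / (N * (N - 3) / 2)
  let F3 := (c1 * (c1 - 1) * (c1 - 5) / 6 + (c1 - 1) * c2 + c3) / (N * (N - 1) * (N - 5) / 6)
  let F4 := (c1 * (c1 - 2) * (c1 - 4) / 3 - c3) / (N * (N - 2) * (N - 4) / 3)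
  let F5 := (c1 * (c1 - 1) * (c1 - 2) * (c1 - 7) / 24 + (c1 ^ 2 - 3 * c1 - 1) * c2 / 2
      + c2 ^ 2 / 2 + (c1 - 1) * c3 + c4) / (N * (N - 1) * (N - 2) * (N - 7) / 24)
  let F6 := e * F1
  let F7 := e * F2
  let F8 := e * ((c1 - 1) * (c1 - 2) / 2 - c2) / ((N - 1) * (N - 2) / 2)
  max (max (max F1 F2) (max F3 F4)) (max (max F5 F6) (max F7 F8))

theorem le_eightMax (N c1 c2 c3 c4 e : ℝ) :
    (c1 - 1) / (N - 1) ≤ eightMax N c1 c2 c3 c4 e ∧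
    (c1 * (c1 - 3) / 2 + c2) / (N * (N - 3) / 2) ≤ eightMax N c1 c2 c3 c4 e ∧
    (c1 * (c1 - 1) * (c1 - 5) / 6 + (c1 - 1) * c2 + c3) / (N * (N - 1) * (N - 5) / 6)
      ≤ eightMax N c1 c2 c3 c4 e ∧
    (c1 * (c1 - 2) * (c1 - 4) / 3 - c3) / (N * (N - 2) * (N - 4) / 3)
      ≤ eightMax N c1 c2 c3 c4 e ∧
    (c1 * (c1 - 1) * (c1 - 2) * (c1 - 7) / 24 + (c1 ^ 2 - 3 * c1 - 1) * c2 / 2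
      + c2 ^ 2 / 2 + (c1 - 1) * c3 + c4) / (N * (N - 1) * (N - 2) * (N - 7) / 24)
      ≤ eightMax N c1 c2 c3 c4 e ∧
    e * ((c1 - 1) / (N - 1)) ≤ eightMax N c1 c2 c3 c4 e ∧
    e * ((c1 * (c1 - 3) / 2 + c2) / (N * (N - 3) / 2)) ≤ eightMax N c1 c2 c3 c4 e ∧
    e * ((c1 - 1) * (c1 - 2) / 2 - c2) / ((N - 1) * (N - 2) / 2)
      ≤ eightMax N c1 c2 c3 c4 e := by
  simp only [eightMax, le_max_iff, le_refl, true_or, or_true, and_self]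

section

variable {N c1 c3 c4 e : ℝ} {c₂ : ℕ}

theorem one_div_sq_le_eightMax (hN : 10 ≤ N) (h1 : c1 = 0 ∨ c1 = 1) (he : e = 1 ∨ e = -1)
    (h : ¬ (c1 = 1 ∧ c₂ ≤ 1 ∧ e = 1)) : 1 / N ^ 2 ≤ eightMax N c1 c₂ c3 c4 e := by
  obtain ⟨-, F2, -, -, -, F6, F7, F8⟩ := le_eightMax N c1 c₂ c3 c4 e
  have d1 : 0 < N - 1 := by linarith
  have d2 : 0 < N * (N - 3) / 2 := by nlinarith
  have d8 : 0 < (N - 1) * (N - 2) / 2 := by nlinarith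
  have dN : 0 < N ^ 2 := by positivity
  have c2pos : (0 : ℝ) ≤ c₂ := Nat.cast_nonneg _
  rcases h1 with rfl | rfl
  · rcases he with rfl | rfl
    · rcases Nat.eq_zero_or_pos c₂ with h0 | h0
      · subst h0
        refine le_trans ?_ F8
        rw [div_le_div_iff₀ dN d8]
        push_cast
        nlinarith
      · have : (1 : ℝ) ≤ c₂ := by exact_mod_cast h0
        refine le_trans ?_ F2
        rw [div_le_div_iff₀ dN d2]
        nlinarith
    · refine le_trans ?_ F6
      rw [mul_div, div_le_div_iff₀ dN d1]
      nlinarith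
  · by_cases h2 : 2 ≤ c₂
    · have : (2 : ℝ) ≤ c₂ := by exact_mod_cast h2
      refine le_trans ?_ F2
      rw [div_le_div_iff₀ dN d2]
      nlinarith
    · have he' : e = -1 := he.resolve_left fun h' => h ⟨rfl, by omega, h'⟩
      subst he'
      rcases Nat.eq_zero_or_pos c₂ with h0 | h0
      · subst h0
        refine le_trans ?_ F7
        rw [mul_div, div_le_div_iff₀ dN d2]
        push_cast
        nlinarith
      · have h1 : c₂ = 1 := by omega
        subst h1
        refine le_trans ?_ F8
        rw [div_le_div_iff₀ dN d8]
        push_cast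
        nlinarith

theorem one_div_cube_le_eightMax {c₃ : ℕ} (hN : 10 ≤ N) (h1 : c1 = 0 ∨ c1 = 1)
    (he : e = 1 ∨ e = -1) : 1 / N ^ 3 ≤ eightMax N c1 c₂ c₃ c4 e := by
  by_cases h : c1 = 1 ∧ c₂ ≤ 1 ∧ e = 1
  · obtain ⟨rfl, h2, rfl⟩ := h
    obtain ⟨-, -, F3, F4, -⟩ := le_eightMax N 1 c₂ c₃ c4 1
    have dN : 0 < N ^ 3 := by positivity
    have d3 : 0 < N * (N - 1) * (N - 5) / 6 := by
      have := mul_pos (mul_pos (by linarith : 0 < N) (by linarith : 0 < N - 1))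
        (by linarith : 0 < N - 5)
      linarith
    have d4 : 0 < N * (N - 2) * (N - 4) / 3 := by
      have := mul_pos (mul_pos (by linarith : 0 < N) (by linarith : 0 < N - 2))
        (by linarith : 0 < N - 4)
      linarith
    rcases Nat.eq_zero_or_pos c₃ with h0 | h0
    · subst h0
      refine le_trans ?_ F4
      rw [div_le_div_iff₀ dN d4]
      push_cast
      nlinarith
    · have : (1 : ℝ) ≤ c₃ := by exact_mod_cast h0
      refine le_trans ?_ F3
      rw [div_le_div_iff₀ dN d3]
      nlinarith [mul_le_mul_of_nonneg_right this dN.le]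
  · refine le_trans ?_ (one_div_sq_le_eightMax hN h1 he h)
    gcongr
    · linarith
    · norm_num

theorem le_eightMax_of_count_two (hN : 10 ≤ N) (h1 : c1 = 0 ∨ c1 = 1) (hc : 700 ≤ c₂) :
    1296 / N ^ 2 ≤ eightMax N c1 c₂ c3 c4 e := by
  obtain ⟨-, F2, -⟩ := le_eightMax N c1 c₂ c3 c4 e
  have d2 : 0 < N * (N - 3) / 2 := by nlinarith
  have dN : 0 < N ^ 2 := by positivity
  have : (700 : ℝ) ≤ c₂ := by exact_mod_cast hc
  refine le_trans ?_ F2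
  rw [div_le_div_iff₀ dN d2]
  rcases h1 with rfl | rfl <;> nlinarith

/-- The level-one values are among the eight. -/
theorem level_one_le_eightMax :
    (c1 - 1) / (N - 1) ≤ eightMax N c1 c₂ c3 c4 e ∧
      e * ((c1 - 1) / (N - 1)) ≤ eightMax N c1 c₂ c3 c4 e :=
  ⟨(le_eightMax N c1 c₂ c3 c4 e).1, (le_eightMax N c1 c₂ c3 c4 e).2.2.2.2.2.1⟩

theorem level_two_le_eightMax (hN : 10 ≤ N) (h1 : c1 = 0 ∨ c1 = 1) (he : e = 1 ∨ e = -1) {x : ℝ}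
    (hx : x = (c1 * (c1 - 3) / 2 + c₂) / (N * (N - 3) / 2) ∨
      x = ((c1 - 1) * (c1 - 2) / 2 - c₂) / ((N - 1) * (N - 2) / 2)) :
    x ≤ eightMax N c1 c₂ c3 c4 e ∧ e * x ≤ eightMax N c1 c₂ c3 c4 e := by
  obtain ⟨F1, F2, -, -, -, F6, F7, F8⟩ := le_eightMax N c1 c₂ c3 c4 e
  have d1 : 0 < N - 1 := by linarith
  have d8 : 0 < (N - 1) * (N - 2) / 2 := by nlinarith
  have c2pos : (0 : ℝ) ≤ c₂ := Nat.cast_nonneg _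
  rcases hx with rfl | rfl
  · exact ⟨F2, F7⟩
  · refine ⟨?_, by rwa [mul_div]⟩
    rcases he with rfl | rfl
    · rwa [one_mul] at F8
    · rcases h1 with rfl | rfl
      · refine le_trans ?_ F6
        rw [mul_div, div_le_div_iff₀ d8 d1]
        nlinarith [mul_nonneg c2pos d1.le]
      · refine le_trans ?_ F1
        rw [sub_self, zero_div]
        exact div_nonpos_of_nonpos_of_nonneg (by linarith) d8.le

set_option maxHeartbeats 1000000 in
theorem level_three_le_eightMax {n c₃ f : ℕ} (hn : 10 ≤ n) (h1 : f = 0 ∨ f = 1)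
    (he : e = 1 ∨ e = -1) (hle : f + 2 * c₂ + 3 * c₃ ≤ n)
    (heven : f = 0 → e = 1 → c₂ = 1 → 3 * c₃ + 3 ≤ n) {x : ℝ}
    (hx : x = ((f : ℝ) * (f - 1) * (f - 5) / 6 + (f - 1) * c₂ + c₃)
          / ((n : ℝ) * (n - 1) * (n - 5) / 6) ∨
      x = (((f : ℝ) - 1) * (f - 2) * (f - 3) / 6 - (f - 1) * c₂ + c₃)
          / (((n : ℝ) - 1) * (n - 2) * (n - 3) / 6) ∨
      x = ((f : ℝ) * (f - 2) * (f - 4) / 3 - c₃) / ((n : ℝ) * (n - 2) * (n - 4) / 3)) :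
    x ≤ eightMax n f c₂ c₃ c4 e ∧ e * x ≤ eightMax n f c₂ c₃ c4 e := by
  obtain ⟨F1, F2, F3, F4, -, F6, F7, F8⟩ := le_eightMax n f c₂ c₃ c4 e
  have hN : (10 : ℝ) ≤ n := by exact_mod_cast hn
  have hle' : (f : ℝ) + 2 * c₂ + 3 * c₃ ≤ n := by exact_mod_cast hle
  have c2pos : (0 : ℝ) ≤ c₂ := Nat.cast_nonneg _
  have c3pos : (0 : ℝ) ≤ c₃ := Nat.cast_nonneg _
  generalize eightMax n f c₂ c₃ c4 e = M at *
  generalize hNn : (n : ℝ) = N at *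
  have d1 : 0 < N - 1 := by linarith
  have d2 : 0 < N * (N - 3) / 2 := by nlinarith
  have d8 : 0 < (N - 1) * (N - 2) / 2 := by nlinarith
  have p3 : 0 < N * (N - 1) * (N - 5) :=
    mul_pos (mul_pos (by linarith) (by linarith)) (by linarith)
  have p4 : 0 < N * (N - 2) * (N - 4) :=
    mul_pos (mul_pos (by linarith) (by linarith)) (by linarith)
  have p9 : 0 < (N - 1) * (N - 2) * (N - 3) :=
    mul_pos (mul_pos (by linarith) (by linarith)) (by linarith)
  have d3 : 0 < N * (N - 1) * (N - 5) / 6 := by linarith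
  have d4 : 0 < N * (N - 2) * (N - 4) / 3 := by linarith
  have d9 : 0 < (N - 1) * (N - 2) * (N - 3) / 6 := by linarith
  rcases h1 with rfl | rfl
  · rw [Nat.cast_zero] at *
    rcases he with rfl | rfl
    · rw [one_mul, and_self]
      rcases hx with rfl | rfl | rfl
      · exact F3
      · rcases Nat.eq_zero_or_pos c₂ with h0 | h0
        · subst h0
          refine le_trans ?_ F8
          rw [div_le_div_iff₀ d9 d8]
          push_cast at hle' ⊢
          nlinarith [mul_nonneg d8.le (by linarith : 0 ≤ N - 3 * c₃)]
        · refine le_trans ?_ F2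
          rw [div_le_div_iff₀ d9 d2]
          have key : 3 * N * (c₂ + c₃ - 1) ≤ c₂ * ((N - 1) * (N - 2)) := by
            rcases eq_or_ne c₂ 1 with h1 | h1
            · have h3 : (3 : ℝ) * c₃ + 3 ≤ N := by
                rw [← hNn]; exact_mod_cast heven rfl rfl h1
              subst h1
              push_cast
              nlinarith
            · have h2 : (2 : ℝ) ≤ c₂ := by exact_mod_cast (by omega : 2 ≤ c₂)
              nlinarith [mul_nonneg (by linarith : 0 ≤ N) (by linarith : 0 ≤ N - 2 * c₂ - 3 * c₃),
                mul_nonneg (by linarith : (0 : ℝ) ≤ c₂ - 2) (by nlinarith : 0 ≤ N * (N - 4))]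
          have := mul_le_mul_of_nonneg_right key (by linarith : 0 ≤ N - 3)
          linarith
      · exact F4
    · have habs : |x| ≤ 1 / (N - 1) := by
        rcases hx with rfl | rfl | rfl
        · rw [abs_div, abs_of_pos d3, div_le_div_iff₀ d3 d1]
          have : |(0 : ℝ) * (0 - 1) * (0 - 5) / 6 + (0 - 1) * c₂ + c₃| ≤ N / 2 := by
            rw [abs_le]; constructor <;> linarith
          refine (mul_le_mul_of_nonneg_right this d1.le).trans ?_
          nlinarith [mul_nonneg (by nlinarith : 0 ≤ N * (N - 1)) (by linarith : 0 ≤ N - 8)]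
        · rw [abs_div, abs_of_pos d9, div_le_div_iff₀ d9 d1]
          have : |((0 : ℝ) - 1) * (0 - 2) * (0 - 3) / 6 - (0 - 1) * c₂ + c₃| ≤ N / 2 := by
            rw [abs_le]; constructor <;> linarith
          refine (mul_le_mul_of_nonneg_right this d1.le).trans ?_
          nlinarith [mul_nonneg d1.le (by nlinarith : 0 ≤ N * (N - 8))]
        · rw [abs_div, abs_of_pos d4, div_le_div_iff₀ d4 d1]
          have : |(0 : ℝ) * (0 - 2) * (0 - 4) / 3 - c₃| ≤ N / 3 := by
            rw [abs_le]; constructor <;> linarith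
          refine (mul_le_mul_of_nonneg_right this d1.le).trans ?_
          nlinarith [mul_nonneg (by linarith : 0 ≤ N) (by nlinarith : 0 ≤ N * (N - 8))]
      have h6 : -1 * ((0 - 1) / (N - 1)) = 1 / (N - 1) := by ring
      rw [h6] at F6
      rw [abs_le] at habs
      constructor <;> linarith
  · rw [Nat.cast_one] at *
    have F1' : 0 ≤ M := by rwa [sub_self, zero_div] at F1
    have F3' : c₃ / (N * (N - 1) * (N - 5) / 6) ≤ M := by
      refine le_of_eq_of_le ?_ F3
      congr 1
      ring
    suffices h : x ≤ M ∧ -x ≤ M by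
      refine ⟨h.1, ?_⟩
      rcases he with rfl | rfl
      · rw [one_mul]; exact h.1
      · rw [neg_one_mul]; exact h.2
    rcases hx with rfl | rfl | rfl
    · refine ⟨F3, le_trans ?_ F1'⟩
      rw [neg_nonpos]
      exact div_nonneg (by linarith) d3.le
    · constructor
      · refine le_trans ?_ F3'
        rw [div_le_div_iff₀ d9 d3]
        nlinarith [mul_nonneg c3pos d1.le]
      · refine le_trans ?_ F1'
        rw [neg_nonpos]
        exact div_nonneg (by linarith) d9.le
    · refine ⟨F4, ?_⟩
      rcases Nat.eq_zero_or_pos c₃ with h0 | h0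
      · refine le_trans ?_ F1'
        rw [neg_nonpos]
        refine div_nonneg ?_ d4.le
        rw [h0]
        norm_num
      · refine le_trans ?_ F3'
        rw [← neg_div, div_le_div_iff₀ d4 d3]
        have h1 : N * (N - 1) * (N - 5) ≤ N * (N - 2) * (N - 4) := by nlinarith
        nlinarith [mul_le_mul_of_nonneg_left h1 c3pos]

theorem level_four_le_eightMax {n c₃ c₄ : ℕ} (hn : 1000 ≤ n) (hc : c₂ ≤ 1)
    (hle : 4 * c₄ ≤ n) {x : ℝ}
    (hx : x = ((c₄ : ℝ) - c₂) / ((n : ℝ) * (n - 1) * (n - 2) * (n - 7) / 24) ∨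
      x ≤ ((c₄ : ℝ) / 3 + 3 * c₃ + 23) / ((n : ℝ) * (n - 1) * (n - 2) * (n - 3) / 24)) :
    x ≤ eightMax n 1 c₂ c₃ c₄ e := by
  obtain ⟨-, -, F3, F4, F5, -⟩ := le_eightMax n 1 c₂ c₃ c₄ e
  have hN : (1000 : ℝ) ≤ n := by exact_mod_cast hn
  have hle' : 4 * (c₄ : ℝ) ≤ n := by exact_mod_cast hle
  have c3pos : (0 : ℝ) ≤ c₃ := Nat.cast_nonneg _
  generalize eightMax n 1 c₂ c₃ c₄ e = M at *
  generalize (n : ℝ) = N at *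
  rcases hx with rfl | hx
  · refine le_of_eq_of_le ?_ F5
    congr 1
    interval_cases c₂ <;> push_cast <;> ring
  · refine hx.trans ?_
    have p3 : 0 < N * (N - 1) * (N - 5) :=
      mul_pos (mul_pos (by linarith) (by linarith)) (by linarith)
    have p4 : 0 < N * (N - 2) * (N - 4) :=
      mul_pos (mul_pos (by linarith) (by linarith)) (by linarith)
    have p5 : 0 < N * (N - 1) * (N - 2) * (N - 3) :=
      mul_pos (mul_pos (mul_pos (by linarith) (by linarith)) (by linarith)) (by linarith)
    have d3 : 0 < N * (N - 1) * (N - 5) / 6 := by linarith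
    have d4 : 0 < N * (N - 2) * (N - 4) / 3 := by linarith
    have d5 : 0 < N * (N - 1) * (N - 2) * (N - 3) / 24 := by linarith
    rcases Nat.eq_zero_or_pos c₃ with h0 | h0
    · refine le_trans ?_ F4
      subst h0
      rw [div_le_div_iff₀ d5 d4]
      push_cast
      have key : (8 * (c₄ : ℝ) / 3 * 3 + 552) * (N - 4) ≤ 3 * ((N - 1) * (N - 3)) := by
        refine (mul_le_mul_of_nonneg_right (by linarith : 8 * (c₄ : ℝ) / 3 * 3 + 552 ≤ 2 * N + 552)
          (by linarith)).trans ?_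
        nlinarith
      have := mul_le_mul_of_nonneg_left key (by nlinarith : 0 ≤ N * (N - 2))
      linarith
    · refine le_trans ?_ F3
      have h1 : (1 : ℝ) ≤ c₃ := by exact_mod_cast h0
      rw [div_le_div_iff₀ d5 d3]
      have key : (8 * (c₄ : ℝ) + 72 * c₃ + 552) * (N - 5) ≤ 6 * c₃ * ((N - 2) * (N - 3)) := by
        refine (mul_le_mul_of_nonneg_right (by linarith : 8 * (c₄ : ℝ) + 72 * c₃ + 552
          ≤ 2 * N + 72 * c₃ + 552 * c₃) (by linarith)).trans ?_
        nlinarith [mul_nonneg (by linarith : (0 : ℝ) ≤ c₃ - 1)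
          (by nlinarith : 0 ≤ N * (N - 1000)), mul_nonneg c3pos (by nlinarith : 0 ≤ N * (N - 1000)),
          mul_nonneg c3pos (by linarith : 0 ≤ N - 1000)]
      have := mul_le_mul_of_nonneg_left key (by nlinarith : 0 ≤ N * (N - 1))
      linarith

end

theorem count_two_three_four_le_sum (s : Multiset ℕ) (hs : ∀ l ∈ s, 2 ≤ l) :
    (s.sum = 2 * s.count 2 + 3 * s.count 3 ∧ s.card = s.count 2 + s.count 3 ∧ s.count 4 = 0) ∨
      (2 * s.count 2 + 3 * s.count 3 + 4 * s.count 4 ≤ s.sum ∧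
        2 * s.count 2 + 3 * s.count 3 + 4 ≤ s.sum) := by
  induction s using Multiset.induction with
  | empty => simp
  | cons l s ih =>
    have h := ih fun l hl => hs l (Multiset.mem_cons_of_mem hl)
    have hl := hs l (Multiset.mem_cons_self l s)
    simp only [Multiset.sum_cons, Multiset.card_cons, Multiset.count_cons]
    split_ifs <;> omega

section

variable {β : Type} [DecidableEq β] [Fintype β]

theorem sign_eq_neg_one_of_count_two (σ : Perm β) (h2 : σ.cycleType.count 2 = 1)
    (h : σ.cycleType.sum < 3 * σ.cycleType.count 3 + 6) : Perm.sign σ = -1 := by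
  rcases count_two_three_four_le_sum σ.cycleType fun l hl => Perm.two_le_of_mem_cycleType hl with
    ⟨h1, h3, -⟩ | ⟨-, h1⟩
  · rw [Perm.sign_of_cycleType, h1, h3, h2]
    exact Odd.neg_one_pow ⟨2 * σ.cycleType.count 3 + 1, by ring⟩
  · omega

namespace UnitaryRep

variable {V : Type*} [AddCommGroup V] [Module ℝ V]

theorem exists_abs_classAvg_le_peelWeight (U : UnitaryRep β V) {S : Finset β} (hS : U.sym S ≠ ⊥)
    (hmax : ∀ S' : Finset β, S.card < S'.card → U.sym S' = ⊥) (σ : Perm β) :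
    ∃ v ∈ U.W, U.B v v = 1 ∧ |classAvg (U.coeff v) σ| ≤ peelWeight Sᶜ.card σ := by
  obtain ⟨v, hv, h1⟩ := U.exists_unit hS
  refine ⟨v, (U.mem_sym.1 hv).1, h1, ?_⟩
  have := (U.isPeel_of_max hv hmax).abs_classAvg_le σ (b := 1)
    fun h ψ _ => (U.abs_coeff_le v ψ).trans h1.le
  rwa [one_mul] at this

/-- If every unit vector has the same class average at `σ`, then this value is at most the
maximum of the eight characters. -/
theorem exists_le_eightMax : ∃ N : ℕ, ∀ {β : Type} [DecidableEq β] [Fintype β] {V : Type*}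
    [AddCommGroup V] [Module ℝ V] (U : UnitaryRep β V), N ≤ Fintype.card β →
    U.sym Finset.univ = ⊥ → U.twist.sym Finset.univ = ⊥ → ∀ σ : Perm β, fixNum σ ≤ 1 →
    ∀ c : ℝ, (∀ v ∈ U.W, U.B v v = 1 → classAvg (U.coeff v) σ = c) →
    c ≤ eightMax (Fintype.card β) (fixNum σ) (σ.cycleType.count 2) (σ.cycleType.count 3)
      (σ.cycleType.count 4) ((Perm.sign σ : ℤ) : ℝ) := by
  obtain ⟨Q₁, hQ₁⟩ := exists_abs_classAvg_le
  obtain ⟨Q₂, hQ₂⟩ := exists_peelWeight_le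
  refine ⟨max (10 ^ 15) (max (Q₁ ^ 8) (Q₂ ^ 8)), ?_⟩
  intro β _ _ V _ _ U hN hU hU' σ hf c hc
  have hn : 10 ^ 15 ≤ Fintype.card β := (le_max_left _ _).trans hN
  have hn1 : Q₁ ^ 8 ≤ Fintype.card β := ((le_max_left _ _).trans (le_max_right _ _)).trans hN
  have hn2 : Q₂ ^ 8 ≤ Fintype.card β := ((le_max_right _ _).trans (le_max_right _ _)).trans hN
  clear hN
  have hε : ((Perm.sign σ : ℤ) : ℝ) = 1 ∨ ((Perm.sign σ : ℤ) : ℝ) = -1 := by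
    rcases Int.units_eq_one_or (Perm.sign σ) with h | h <;> simp [h]
  have hsum := fixNum_add_sum σ
  have hcyc := count_two_three_four_le_sum σ.cycleType fun l hl =>
    Perm.two_le_of_mem_cycleType hl
  have hc1 : (fixNum σ : ℝ) = 0 ∨ (fixNum σ : ℝ) = 1 := fixNum_eq_zero_or_one hf rfl
  have hN10 : (10 : ℝ) ≤ Fintype.card β := by exact_mod_cast (by omega : 10 ≤ Fintype.card β)
  have heven : fixNum σ = 0 → ((Perm.sign σ : ℤ) : ℝ) = 1 → σ.cycleType.count 2 = 1 →
      3 * σ.cycleType.count 3 + 3 ≤ Fintype.card β := by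
    intro h0 h1 h2
    by_contra hlt
    rw [sign_eq_neg_one_of_count_two σ h2 (by omega)] at h1
    norm_num at h1
  have h₂ : (twoCycleNum σ : ℝ) = 2 * (σ.cycleType.count 2 : ℕ) := by
    rw [twoCycleNum_eq]; push_cast; rfl
  have h₃ : (threeCycleNum σ : ℝ) = 3 * (σ.cycleType.count 3 : ℕ) := by
    rw [threeCycleNum_eq]; push_cast; rfl
  generalize hM : eightMax (Fintype.card β) (fixNum σ) (σ.cycleType.count 2) (σ.cycleType.count 3)
      (σ.cycleType.count 4) ((Perm.sign σ : ℤ) : ℝ) = M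
  have habs : ∀ {c : ℝ}, |c| ≤ M → c ≤ M ∧ ((Perm.sign σ : ℤ) : ℝ) * c ≤ M := by
    intro c hc
    rw [abs_le] at hc
    rcases hε with h | h <;> rw [h] <;> constructor <;> linarith
  have hcube : 1 / (Fintype.card β : ℝ) ^ 3 ≤ M := by
    rw [← hM]; exact one_div_cube_le_eightMax hN10 hc1 hε
  have key : ∀ (U : UnitaryRep β V), U.sym Finset.univ = ⊥ → ∀ S : Finset β, U.sym S ≠ ⊥ →
      (∀ S' : Finset β, S.card < S'.card → U.sym S' = ⊥) →
      (∀ S' : Finset β, S.card < S'.card → U.twist.sym S' = ⊥) →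
      ∃ v ∈ U.W, U.B v v = 1 ∧ classAvg (U.coeff v) σ ≤ M ∧
        ((Perm.sign σ : ℤ) : ℝ) * classAvg (U.coeff v) σ ≤ M := by
    clear hc hU hU' U c
    intro U hU S hS hmax hmax'
    have hSc := Finset.card_add_card_compl S
    have hk0 : Sᶜ.card ≠ 0 := by
      intro h
      rw [Finset.card_eq_zero, Finset.compl_eq_empty_iff] at h
      exact hS (h ▸ hU)
    suffices h : (∃ v ∈ U.W, U.B v v = 1 ∧ |classAvg (U.coeff v) σ| ≤ M) ∨
        ∃ v ∈ U.W, U.B v v = 1 ∧ classAvg (U.coeff v) σ ≤ M ∧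
        ((Perm.sign σ : ℤ) : ℝ) * classAvg (U.coeff v) σ ≤ M by
      rcases h with ⟨v, hv, h1, h⟩ | h
      · exact ⟨v, hv, h1, habs h⟩
      · exact h
    have hpeel : peelWeight Sᶜ.card σ ≤ M →
        ∃ v ∈ U.W, U.B v v = 1 ∧ |classAvg (U.coeff v) σ| ≤ M := by
      intro h
      obtain ⟨v, hv, h1, hle⟩ := U.exists_abs_classAvg_le_peelWeight hS hmax σ
      exact ⟨v, hv, h1, hle.trans h⟩
    obtain ⟨q, hq1, hq2⟩ : ∃ q, q ^ 8 ≤ Fintype.card β ∧ Fintype.card β < (q + 1) ^ 8 := by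
      have hex : ∃ q, Fintype.card β < (q + 1) ^ 8 :=
        ⟨Fintype.card β, (Nat.lt_succ_self _).trans_le (Nat.le_self_pow (by norm_num) _)⟩
      refine ⟨Nat.find hex, ?_, Nat.find_spec hex⟩
      rcases Nat.eq_zero_or_pos (Nat.find hex) with h | h
      · rw [h]; omega
      · have := Nat.find_min hex (Nat.sub_lt h one_pos)
        rw [show Nat.find hex - 1 + 1 = Nat.find hex by omega] at this
        omega
    have hqQ : ∀ Q, Q ^ 8 ≤ Fintype.card β → Q ≤ q := by
      intro Q hQ
      have := lt_of_pow_lt_pow_left₀ 8 (Nat.zero_le _) (hQ.trans_lt hq2)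
      omega
    rcases lt_or_ge S.card (q ^ 5) with hm | hm
    · obtain ⟨v, hv, h1, h⟩ := hQ₁ q (hqQ _ hn1) U hq1 hq2 (fun S' hS' => hmax S' (hm.trans hS'))
        fun S' hS' => hmax' S' (hm.trans hS')
      exact Or.inl ⟨v, hv, h1, (h σ hf).trans hcube⟩
    rcases le_or_gt (Fintype.card β) (100 * Sᶜ.card) with h100 | h100
    · exact Or.inl (hpeel ((hQ₂ q (hqQ _ hn2) σ hf hq1 hq2 _ S.card (by omega) hm h100).trans
        hcube))
    rcases Nat.lt_or_ge Sᶜ.card 7 with h7 | h7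
    swap
    · exact Or.inl (hpeel ((peelWeight_le_of_seven_le h7 h100.le (by omega) σ hf).trans hcube))
    rcases Nat.lt_or_ge Sᶜ.card 4 with h4 | h4
    · right
      have hk : Sᶜ.card = 1 ∨ Sᶜ.card = 2 ∨ Sᶜ.card = 3 := by omega
      rcases hk with hk | hk | hk
      · obtain ⟨v, hv, h1, h⟩ := U.exists_classAvg_of_one hS hmax (σ := σ) (by omega) (by omega)
        refine ⟨v, hv, h1, ?_⟩
        rw [h, ← hM]
        exact level_one_le_eightMax
      · obtain ⟨v, hv, h1, h⟩ := U.exists_classAvg_of_two hS hmax (σ := σ) (by omega) (by omega)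
          hf rfl rfl h₂
        refine ⟨v, hv, h1, ?_⟩
        rw [← hM]
        exact level_two_le_eightMax hN10 hc1 hε h
      · obtain ⟨v, hv, h1, h⟩ := U.exists_classAvg_of_three hS hmax (σ := σ) (by omega) (by omega)
          hf rfl rfl h₂ h₃
        refine ⟨v, hv, h1, ?_⟩
        rw [← hM]
        exact level_three_le_eightMax (by omega) (by omega) hε (by omega) heven h
    rcases Nat.lt_or_ge (Fintype.card β ^ 2) (σ.cycleType.count 2 ^ 3) with h2 | h2
    · refine Or.inl (hpeel ((peelWeight_le_div_sq h4 (by omega) (by omega) σ hf).trans ?_))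
      rw [← hM]
      refine le_eightMax_of_count_two hN10 hc1 ?_
      by_contra hlt
      have a1 : σ.cycleType.count 2 ^ 3 ≤ 700 ^ 3 := Nat.pow_le_pow_left (by omega) 3
      have a2 : (10 ^ 15) ^ 2 ≤ Fintype.card β ^ 2 := Nat.pow_le_pow_left hn 2
      omega
    by_cases h56 : Sᶜ.card = 5 ∨ Sᶜ.card = 6
    · exact Or.inl (hpeel ((peelWeight_five_six_le h56 hn σ hf h2).trans hcube))
    have hk : Sᶜ.card = 4 := by omega
    by_cases hcase : (fixNum σ : ℝ) = 1 ∧ σ.cycleType.count 2 ≤ 1 ∧ ((Perm.sign σ : ℤ) : ℝ) = 1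
    · obtain ⟨hf1, hc2, he⟩ := hcase
      obtain ⟨v, hv, h1, h⟩ := U.exists_classAvg_of_four hS hmax (σ := σ) (by omega) (by omega)
        (by exact_mod_cast hf1) hc2 rfl rfl rfl rfl
      have := level_four_le_eightMax (e := 1) (by omega) hc2 (by omega) h
      rw [hf1, he] at hM
      rw [hM] at this
      exact Or.inr ⟨v, hv, h1, this, by rwa [he, one_mul]⟩
    · refine Or.inl (hpeel ?_)
      rw [hk, ← hM]
      exact (peelWeight_four_le hn σ hf h2).trans (one_div_sq_le_eightMax hN10 hc1 hε hcase)
  obtain ⟨S, hS, hmax⟩ := U.exists_max_sym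
  obtain ⟨S', hS', hmax'⟩ := U.twist.exists_max_sym
  rcases le_total S'.card S.card with h | h
  · obtain ⟨v, hv, h1, hle, -⟩ := key U hU S hS hmax fun T hT => hmax' T (h.trans_lt hT)
    rwa [hc v hv h1] at hle
  · obtain ⟨v, hv, h1, -, hle⟩ := key U.twist hU' S' hS' hmax' fun T hT => by
      rw [twist_twist]
      exact hmax T (h.trans_lt hT)
    rw [classAvg_twist, hc v hv h1, ← mul_assoc] at hle
    rcases hε with h | h <;> rw [h] at hle <;> linarith

end UnitaryRep

end

section FromComplex

variable {β : Type} [DecidableEq β] [Fintype β]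
variable {E : Type*} [AddCommGroup E] [Module ℂ E] [FiniteDimensional ℂ E]

/-- The real part of the average over the group of the standard hermitian form. -/
noncomputable def averagedForm (ρ : Perm β →* E →ₗ[ℂ] E) : E →ₗ[ℝ] E →ₗ[ℝ] ℝ :=
  LinearMap.mk₂ ℝ
    (fun u v => ∑ g, ∑ i, ((starRingEnd ℂ) ((Module.finBasis ℂ E).repr (ρ g u) i) *
      (Module.finBasis ℂ E).repr (ρ g v) i).re)
    (fun u u' v => by simp [add_mul, Finset.sum_add_distrib])
    (fun c u v => by
      rw [← Complex.coe_smul]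
      simp only [map_smul, Finsupp.smul_apply, smul_eq_mul, map_mul, Complex.conj_ofReal, mul_assoc,
        Complex.re_ofReal_mul, Finset.mul_sum])
    (fun u v v' => by simp [mul_add, Finset.sum_add_distrib])
    (fun c u v => by
      rw [← Complex.coe_smul]
      simp only [map_smul, Finsupp.smul_apply, smul_eq_mul, mul_left_comm _ (c : ℂ),
        Complex.re_ofReal_mul, Finset.mul_sum])

theorem averagedForm_apply (ρ : Perm β →* E →ₗ[ℂ] E) (u v : E) :
    averagedForm ρ u v = ∑ g, ∑ i, ((starRingEnd ℂ) ((Module.finBasis ℂ E).repr (ρ g u) i) *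
      (Module.finBasis ℂ E).repr (ρ g v) i).re := rfl

theorem averagedForm_self (ρ : Perm β →* E →ₗ[ℂ] E) (v : E) :
    averagedForm ρ v v = ∑ g, ∑ i, Complex.normSq ((Module.finBasis ℂ E).repr (ρ g v) i) := by
  rw [averagedForm_apply]
  refine Finset.sum_congr rfl fun g _ => Finset.sum_congr rfl fun i _ => ?_
  rw [mul_comm, Complex.mul_conj, Complex.ofReal_re]

theorem averagedForm_smul_self (ρ : Perm β →* E →ₗ[ℂ] E) (c : ℂ) (v : E) :
    averagedForm ρ v (c • v) = c.re * averagedForm ρ v v := by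
  rw [averagedForm_self, averagedForm_apply, Finset.mul_sum]
  refine Finset.sum_congr rfl fun g _ => ?_
  rw [Finset.mul_sum]
  refine Finset.sum_congr rfl fun i _ => ?_
  rw [map_smul, map_smul, Finsupp.smul_apply, smul_eq_mul, mul_left_comm,
    mul_comm ((starRingEnd ℂ) _), Complex.mul_conj, Complex.re_mul_ofReal]

/-- A complex representation, viewed as a real one with an invariant inner product. -/
noncomputable def UnitaryRep.ofComplex [Nontrivial E] (ρ : Perm β →* E →ₗ[ℂ] E) :
    UnitaryRep β E where
  ρ :=
    { toFun := fun g => (ρ g).restrictScalars ℝ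
      map_one' := by ext v; simp
      map_mul' := fun g h => by ext v; simp }
  B := averagedForm ρ
  W := ⊤
  symm v w := by
    rw [averagedForm_apply, averagedForm_apply]
    refine Finset.sum_congr rfl fun g _ => Finset.sum_congr rfl fun i _ => ?_
    simp only [Complex.mul_re, Complex.conj_re, Complex.conj_im]
    ring
  pos v hv := by
    rw [averagedForm_self]
    refine Finset.sum_pos' (fun g _ => Finset.sum_nonneg fun i _ => Complex.normSq_nonneg _)
      ⟨1, Finset.mem_univ _, ?_⟩
    have h : (Module.finBasis ℂ E).repr v ≠ 0 := by simpa using hv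
    obtain ⟨i, hi⟩ := Finsupp.ne_iff.1 h
    refine Finset.sum_pos' (fun i _ => Complex.normSq_nonneg _) ⟨i, Finset.mem_univ _, ?_⟩
    rw [map_one]
    exact Complex.normSq_pos.2 hi
  inv g v w := by
    rw [averagedForm_apply, averagedForm_apply, ← Equiv.sum_comp (Equiv.mulRight g)
      fun h => ∑ i, ((starRingEnd ℂ) ((Module.finBasis ℂ E).repr (ρ h v) i) *
      (Module.finBasis ℂ E).repr (ρ h w) i).re]
    simp
  stable _ _ _ := trivial
  ne_bot := top_ne_bot

end FromComplex

section Schur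

variable {G : Type} [Group G]

theorem FDRep.nontrivial_of_simple (V : FDRep ℂ G) [Simple V] : Nontrivial V := by
  by_contra h
  rw [not_nontrivial_iff_subsingleton] at h
  refine Simple.not_isZero V ((Limits.IsZero.iff_id_eq_zero V).2 ?_)
  ext v
  exact Subsingleton.elim _ _

theorem FDRep.exists_eq_smul_of_commute (V : FDRep ℂ G) [Simple V] (T : V →ₗ[ℂ] V)
    (hT : ∀ g, T ∘ₗ V.ρ g = V.ρ g ∘ₗ T) : ∃ c : ℂ, ∀ v, T v = c • v := by
  let f : V ⟶ V := ⟨InducedCategory.homMk (ModuleCat.ofHom T), fun g => by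
    ext v
    exact LinearMap.congr_fun (hT g) v⟩
  obtain ⟨c, hc⟩ := CategoryTheory.endomorphism_simple_eq_smul_id ℂ f
  refine ⟨c, fun v => ?_⟩
  have := congrArg (fun F : V ⟶ V => F.hom.hom.hom v) hc
  exact this.symm

variable [Fintype G]

/-- Averaging a representing operator over a conjugacy class gives the normalized character. -/
theorem FDRep.sum_conj_apply (V : FDRep ℂ G) [Simple V] (σ : G) (v : V) :
    ∑ h : G, V.ρ (h * σ * h⁻¹) v
      = ((Fintype.card G : ℂ) * (V.character σ / V.character 1)) • v := by
  have hnt := FDRep.nontrivial_of_simple V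
  have hd : (Module.finrank ℂ V : ℂ) ≠ 0 := by
    exact_mod_cast (Module.finrank_pos (R := ℂ) (M := V)).ne'
  obtain ⟨c, hc⟩ := FDRep.exists_eq_smul_of_commute V (∑ h : G, V.ρ (h * σ * h⁻¹)) fun g => by
    change (∑ h : G, V.ρ (h * σ * h⁻¹)) * V.ρ g = V.ρ g * (∑ h : G, V.ρ (h * σ * h⁻¹))
    rw [Finset.sum_mul, Finset.mul_sum, ← Equiv.sum_comp (Equiv.mulLeft g)]
    refine Finset.sum_congr rfl fun h _ => ?_
    rw [← map_mul, ← map_mul]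
    simp [mul_assoc]
  have htr : LinearMap.trace ℂ V (∑ h : G, V.ρ (h * σ * h⁻¹)) = c * Module.finrank ℂ V := by
    rw [show (∑ h : G, V.ρ (h * σ * h⁻¹)) = c • LinearMap.id from LinearMap.ext hc, map_smul,
      LinearMap.trace_id, smul_eq_mul]
  have htr' : LinearMap.trace ℂ V (∑ h : G, V.ρ (h * σ * h⁻¹))
      = Fintype.card G * V.character σ := by
    rw [map_sum]
    change ∑ h : G, V.character (h * σ * h⁻¹) = _
    simp
  have := hc v
  rw [LinearMap.sum_apply] at this
  rw [this, FDRep.char_one]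
  congr 1
  field_simp
  rw [← htr, htr']

theorem FDRep.character_one_sq_of_sq (V : FDRep ℂ G) [Simple V]
    (h : ∀ g, V.character g * V.character g⁻¹ = V.character 1 * V.character 1) :
    V.character 1 = 1 := by
  have hc : (Fintype.card G : ℂ) ≠ 0 := by exact_mod_cast Fintype.card_ne_zero
  have : Invertible (Nat.card G : ℂ) := invertibleOfNonzero (by simp)
  have h1 := FDRep.char_orthonormal V V
  rw [if_pos ⟨Iso.refl V⟩, Finset.sum_congr rfl fun g _ => h g, Finset.sum_const,
    Finset.card_univ, nsmul_eq_mul, Nat.card_eq_fintype_card, inv_mul_cancel_left₀ hc,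
    FDRep.char_one] at h1
  rw [FDRep.char_one]
  have h2 : Module.finrank ℂ V * Module.finrank ℂ V = 1 := by exact_mod_cast h1
  exact_mod_cast Nat.eq_one_of_mul_eq_one_left h2

end Schur

section Symmetric

variable {n : ℕ}

theorem classAvg_coeff_ofComplex (V : FDRep ℂ (Perm (Fin n))) [Simple V] [Nontrivial V]
    (σ : Perm (Fin n)) (v : V) (h1 : (UnitaryRep.ofComplex V.ρ).B v v = 1) :
    UnitaryRep.classAvg ((UnitaryRep.ofComplex V.ρ).coeff v) σ = normChar V σ := by
  have hc : (Fintype.card (Perm (Fin n)) : ℝ) ≠ 0 := by exact_mod_cast Fintype.card_ne_zero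
  rw [UnitaryRep.classAvg, div_eq_iff hc]
  change ∑ h : Perm (Fin n), averagedForm V.ρ v (V.ρ (h * σ * h⁻¹) v) = _
  rw [← map_sum, FDRep.sum_conj_apply, averagedForm_smul_self]
  change averagedForm V.ρ v v = 1 at h1
  rw [h1, mul_one, ← Complex.ofReal_natCast, Complex.re_ofReal_mul, mul_comm, normChar]

theorem character_eq_of_forall_apply (V : FDRep ℂ (Perm (Fin n))) [Simple V] (σ : Perm (Fin n))
    {v : V} (hv : v ≠ 0) {c : ℂ} (h : ∀ g : Perm (Fin n), V.ρ (g * σ * g⁻¹) v = c • v) :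
    V.character σ = c * V.character 1 := by
  have hnt := FDRep.nontrivial_of_simple V
  have hd : V.character 1 ≠ 0 := by
    rw [FDRep.char_one]
    exact_mod_cast (Module.finrank_pos (R := ℂ) (M := V)).ne'
  have hc : (Fintype.card (Perm (Fin n)) : ℂ) ≠ 0 := by exact_mod_cast Fintype.card_ne_zero
  have h1 := FDRep.sum_conj_apply V σ v
  rw [Finset.sum_congr rfl fun g _ => h g, Finset.sum_const, Finset.card_univ,
    ← Nat.cast_smul_eq_nsmul ℂ, smul_smul] at h1
  have h2 := mul_left_cancel₀ hc (smul_left_injective ℂ hv h1)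
  rw [h2, div_mul_cancel₀ _ hd]

theorem sym_univ_ofComplex (V : FDRep ℂ (Perm (Fin n))) [Simple V] [Nontrivial V]
    (hV : V.character ≠ fun _ => 1) :
    (UnitaryRep.ofComplex V.ρ).sym Finset.univ = ⊥ := by
  by_contra h
  obtain ⟨v, hv, hv0⟩ := Submodule.exists_mem_ne_zero_of_ne_bot h
  rw [UnitaryRep.mem_sym] at hv
  have hch : ∀ σ, V.character σ = V.character 1 := fun σ => by
    rw [character_eq_of_forall_apply V σ hv0 (c := 1), one_mul]
    intro g
    rw [one_smul]
    exact hv.2 _ fun a ha => absurd (Finset.mem_univ a) ha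
  refine hV (funext fun σ => ?_)
  rw [hch, FDRep.character_one_sq_of_sq V fun g => by rw [hch g, hch g⁻¹]]

theorem twist_sym_univ_ofComplex (V : FDRep ℂ (Perm (Fin n))) [Simple V] [Nontrivial V]
    (hV : V.character ≠ fun σ => ((Perm.sign σ : ℤ) : ℂ)) :
    (UnitaryRep.ofComplex V.ρ).twist.sym Finset.univ = ⊥ := by
  by_contra h
  obtain ⟨v, hv, hv0⟩ := Submodule.exists_mem_ne_zero_of_ne_bot h
  rw [UnitaryRep.mem_sym] at hv
  have hsq : ∀ σ : Perm (Fin n), ((Perm.sign σ : ℤ) : ℂ) * ((Perm.sign σ : ℤ) : ℂ) = 1 := fun σ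
      => by
    rcases Int.units_eq_one_or (Perm.sign σ) with h | h <;> simp [h]
  have hch : ∀ σ, V.character σ = ((Perm.sign σ : ℤ) : ℂ) * V.character 1 := fun σ => by
    refine character_eq_of_forall_apply V σ hv0 fun g => ?_
    have h1 := hv.2 (g * σ * g⁻¹) fun a ha => absurd (Finset.mem_univ a) ha
    have h2 : ((Perm.sign (g * σ * g⁻¹) : ℤ) : ℝ) • V.ρ (g * σ * g⁻¹) v = v := h1
    have h3 : Perm.sign (g * σ * g⁻¹) = Perm.sign σ := by simp [mul_comm, mul_left_comm]
    rw [h3] at h2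
    have h4 : ((Perm.sign σ : ℤ) : ℂ) • V.ρ (g * σ * g⁻¹) v = v := by
      rw [← Complex.coe_smul, Complex.ofReal_intCast] at h2
      exact h2
    rw [← one_smul ℂ (V.ρ (g * σ * g⁻¹) v), ← hsq σ, mul_smul, h4]
  refine hV (funext fun σ => ?_)
  rw [hch, FDRep.character_one_sq_of_sq V, mul_one]
  intro g
  rw [hch g, hch g⁻¹, Perm.sign_inv, mul_mul_mul_comm, hsq, one_mul]

end Symmetric

/-- **Proposition (c₁ ≤ 1).** There is `N₂` such that for every `n ≥ N₂` and every
`σ ∈ S_n` with at most one fixed point, one of the eight irreps of `EIGHT_n` rules: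
`χ̃(σ) ≤ max {F₁(σ), …, F₈(σ)}` for every irreducible character `χ ∉ {triv, sgn}`. -/
theorem eight_rule_of_few_fixed_points :
    ∃ N₂ : ℕ, ∀ n : ℕ, n ≥ N₂ → ∀ σ : Equiv.Perm (Fin n), fixCount σ ≤ 1 →
      ∀ V : FDRep ℂ (Equiv.Perm (Fin n)), IsNontrivIrr V →
        normChar V σ ≤ maxF n σ := by
  obtain ⟨N, hN⟩ := UnitaryRep.exists_le_eightMax
  refine ⟨N, fun n hn σ hσ V hV => ?_⟩
  obtain ⟨hs, h1, h2⟩ := hV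
  have hnt := FDRep.nontrivial_of_simple V
  have hfix : fixNum σ = fixCount σ := fixNum_eq_card σ
  have h := hN (UnitaryRep.ofComplex V.ρ) (by simpa using hn) (sym_univ_ofComplex V h1)
    (twist_sym_univ_ofComplex V h2) σ (by rw [hfix]; exact hσ) (normChar V σ)
    fun v _ hv => classAvg_coeff_ofComplex V σ v hv
  rw [hfix, Fintype.card_fin] at h
  exact h
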